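/- arXiv:math/9908011 — 4 statements merged into one kernel-verified Lean document; each statement's English description precedes it below -/
import Mathlib

section
/- Every element w of a Coxeter group of type A or B admits a reduced expression s_1 s_2 ··· s_n such that for each index k, either the generator s_k does not occur among s_1,...,s_{k-1}, or s_k does not commute with s_{k-1}. -/
open CoxeterSystem LaurentPolynomial

noncomputable section

/-- The Laurent polynomial ring `A = ℤ[v, v⁻¹]`, with `v = T 1`. -/
abbrev LA := LaurentPolynomial ℤ

/-- `q_c = v + v⁻¹`. -/
def qc : LA := T 1 + T (-1)

/-- The subring `A⁻ = ℤ[v⁻¹]` of `A`. -/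
def LAminus : Subring LA := Subring.closure {T (-1)}

variable {B : Type*} {W : Type*} [Group W]

/-- `w` is complex: it has a reduced factorization `x₁ * w_{ss'} * x₂`, where `w_{ss'}` is the
longest element of a finite rank-2 parabolic subgroup `⟨s, s'⟩` with `s`, `s'` non-commuting
(`3 ≤ M i i'`, which also excludes infinite bonds `M i i' = 0`). -/
def CoxeterSystem.IsComplexElt {M : CoxeterMatrix B} (cs : CoxeterSystem M W) (w : W) : Prop :=
  ∃ (x₁ x₂ : W) (i i' : B), 3 ≤ M i i' ∧
    w = x₁ * cs.wordProd (CoxeterSystem.braidWord M i i') * x₂ ∧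
    cs.length w = cs.length x₁ + M i i' + cs.length x₂

/-- `w` is fully commutative, i.e. not complex; `cs.FC` plays the role of the set `W_c`. -/
def CoxeterSystem.FC {M : CoxeterMatrix B} (cs : CoxeterSystem M W) (w : W) : Prop :=
  ¬ cs.IsComplexElt w

/-- Bruhat--Chevalley order, via the subword characterization. -/
def CoxeterSystem.BruhatLE {M : CoxeterMatrix B} (cs : CoxeterSystem M W) (x w : W) : Prop :=
  ∃ ω : List B, cs.IsReduced ω ∧ cs.wordProd ω = w ∧
    ∃ κ : List B, κ.Sublist ω ∧ cs.wordProd κ = x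

/-- Words on `ℕ` in normal form, built from the left to the right. -/
inductive NFGood : List ℕ → Prop
  | nil : NFGood []
  | fresh (u : List ℕ) (x : ℕ) : NFGood u → x ∉ u → NFGood (u ++ [x])
  | adj (u : List ℕ) (y x : ℕ) : NFGood (u ++ [y]) → (x + 1 = y ∨ y + 1 = x) →
      NFGood (u ++ [y] ++ [x])

/-- The word `k, k+1, …, k+m-1`. -/
def upWord (k : ℕ) : ℕ → List ℕ
  | 0 => []
  | m + 1 => upWord k m ++ [k + m]

/-- The word `N-1, N-2, …, N-m`. -/
def dnWord (N : ℕ) : ℕ → List ℕ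
  | 0 => []
  | m + 1 => dnWord N m ++ [N - 1 - m]

theorem mem_upWord {k m x : ℕ} : x ∈ upWord k m → k ≤ x ∧ x < k + m := by
  induction m with
  | zero => simp [upWord]
  | succ m ih =>
    simp only [upWord, List.mem_append, List.mem_singleton]
    rintro (h | h)
    · have := ih h; omega
    · omega

theorem mem_dnWord {N m x : ℕ} (hm : m ≤ N) : x ∈ dnWord N m → N - m ≤ x ∧ x < N := by
  induction m with
  | zero => simp [dnWord]
  | succ m ih =>
    simp only [dnWord, List.mem_append, List.mem_singleton]
    rintro (h | h)
    · have := ih (by omega) h; omega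
    · omega

theorem length_upWord (k m : ℕ) : (upWord k m).length = m := by
  induction m with
  | zero => rfl
  | succ m ih => simp [upWord, ih]

theorem length_dnWord (k m : ℕ) : (dnWord k m).length = m := by
  induction m with
  | zero => rfl
  | succ m ih => simp [dnWord, ih]

theorem NFGood.up {u : List ℕ} (hu : NFGood u) {k : ℕ} (hk : ∀ x ∈ u, k < x) (m : ℕ) :
    NFGood (u ++ upWord k m) := by
  induction m with
  | zero => simpa [upWord] using hu
  | succ m ih =>
    cases m with
    | zero =>
      simp only [upWord, List.nil_append]
      exact NFGood.fresh _ _ hu (fun h => by have := hk _ h; omega)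
    | succ m =>
      simp only [upWord, ← List.append_assoc] at ih ⊢
      exact NFGood.adj _ _ _ ih (by omega)

theorem NFGood.dn {u : List ℕ} {N : ℕ} (hu : NFGood (u ++ [N])) {m : ℕ} (hm : m ≤ N) :
    NFGood (u ++ [N] ++ dnWord N m) := by
  induction m with
  | zero => simpa [dnWord] using hu
  | succ m ih =>
    have ih := ih (by omega)
    cases m with
    | zero =>
      simp only [dnWord, List.nil_append]
      exact NFGood.adj _ _ _ hu (by omega)
    | succ m =>
      simp only [dnWord, ← List.append_assoc] at ih ⊢
      exact NFGood.adj _ _ _ ih (by omega)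

theorem NFGood.spec {ω : List ℕ} (h : NFGood ω) : ∀ (k : ℕ) (hk : k + 1 < ω.length),
    ω[k + 1] ∉ ω.take (k + 1) ∨ (ω[k + 1] + 1 = ω[k] ∨ ω[k] + 1 = ω[k + 1]) := by
  induction h with
  | nil => intro k hk; simp at hk
  | fresh u x hu hx ih =>
    intro k hk
    simp only [List.length_append, List.length_singleton] at hk
    by_cases hk' : k + 1 < u.length
    · have := ih k hk'
      rw [List.getElem_append_left hk', List.getElem_append_left (by omega),
        List.take_append_of_le_length (by omega)]
      exact this
    · left
      have : k + 1 = u.length := by omega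
      simp [this, hx]
  | adj u y x hu hx ih =>
    intro k hk
    by_cases hk' : k + 1 < (u ++ [y]).length
    · have := ih k hk'
      rw [List.getElem_append_left hk',
        List.getElem_append_left (show k < (u ++ [y]).length by omega),
        List.take_append_of_le_length (by omega)]
      exact this
    · right
      simp only [List.length_append, List.length_singleton] at hk hk'
      have : k = u.length := by omega
      subst this
      simpa using hx

section core

variable {G : Type*} [Group G] (s : ℕ → G)

/-- Product of a word. -/
def wprod (l : List ℕ) : G := (l.map s).prod

theorem wprod_append (l l' : List ℕ) : wprod s (l ++ l') = wprod s l * wprod s l' := by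
  simp [wprod]

theorem wprod_single (x : ℕ) : wprod s [x] = s x := by
  simp [wprod]

theorem wprod_nil : wprod s [] = 1 := by
  simp [wprod]

variable (N : ℕ) (isB : Prop)

/-- The relations of types A and B, with generators numbered `0, …, N`. -/
structure ABRel : Prop where
  sq : ∀ i, s i * s i = 1
  comm : ∀ i j, i + 1 < j → s i * s j = s j * s i
  braid : ∀ i, i < N → (isB → i + 1 < N) →
    s i * s (i + 1) * s i = s (i + 1) * s i * s (i + 1)
  four : isB → ∀ i, i + 1 = N →
    s i * s (i + 1) * s i * s (i + 1) = s (i + 1) * s i * s (i + 1) * s i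

variable {s N isB}

theorem ABRel.far (R : ABRel s N isB) {i j : ℕ} (h : i + 1 < j ∨ j + 1 < i) :
    s i * s j = s j * s i := by
  rcases h with h | h
  · exact R.comm _ _ h
  · exact (R.comm _ _ h).symm

theorem ABRel.far_word (R : ABRel s N isB) {i : ℕ} (l : List ℕ)
    (h : ∀ x ∈ l, i + 1 < x ∨ x + 1 < i) : wprod s l * s i = s i * wprod s l := by
  induction l with
  | nil => simp [wprod]
  | cons a l ih =>
    have h1 : wprod s (a :: l) = s a * wprod s l := by simp [wprod]
    rw [h1, mul_assoc, ih (fun x hx => h x (by simp [hx])), ← mul_assoc, ← mul_assoc,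
      R.far (h a (by simp))]

theorem ABRel.up_shift (R : ABRel s N isB) {k i m : ℕ} (hk : k ≤ i) (hi : i + 1 < k + m)
    (hN : i < N) (hB : isB → i + 1 < N) :
    wprod s (upWord k m) * s i = s (i + 1) * wprod s (upWord k m) := by
  induction m with
  | zero => omega
  | succ m ih =>
    by_cases h : i + 1 < k + m
    · rw [upWord, wprod_append, wprod_single, mul_assoc, ← R.far (by omega), ← mul_assoc,
        ih h, mul_assoc]
    · obtain ⟨m, rfl⟩ : ∃ m', m = m' + 1 := ⟨m - 1, by omega⟩
      obtain rfl : i = k + m := by omega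
      have hfar := R.far_word (i := k + m + 1) (upWord k m)
        (fun x hx => by have := mem_upWord hx; omega)
      have hb := R.braid (k + m) hN hB
      simp only [upWord, wprod_append, wprod_single]
      rw [← add_assoc]
      calc _ = wprod s (upWord k m) * (s (k + m) * s (k + m + 1) * s (k + m)) := by group
        _ = wprod s (upWord k m) * s (k + m + 1) * (s (k + m) * s (k + m + 1)) := by
          rw [hb]; group
        _ = _ := by rw [hfar]; group

theorem ABRel.dn_shift (R : ABRel s N isB) {i m : ℕ} (hm : m ≤ N) (hi : N < i + 1 + m)
    (hN : i + 1 < N) :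
    wprod s (dnWord N m) * s (i + 1) = s i * wprod s (dnWord N m) := by
  induction m with
  | zero => omega
  | succ m ih =>
    by_cases h : N < i + 1 + m
    · rw [dnWord, wprod_append, wprod_single, mul_assoc, R.far (by omega), ← mul_assoc,
        ih (by omega) h, mul_assoc]
    · obtain ⟨m, rfl⟩ : ∃ m', m = m' + 1 := ⟨m - 1, by omega⟩
      have e1 : N - 1 - (m + 1) = i := by omega
      have e2 : N - 1 - m = i + 1 := by omega
      have hfar := R.far_word (i := i) (dnWord N m)
        (fun x hx => by have := mem_dnWord (by omega) hx; omega)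
      have hb := R.braid i (by omega) (fun _ => hN)
      simp only [dnWord, wprod_append, wprod_single, e1, e2]
      calc _ = wprod s (dnWord N m) * (s (i + 1) * s i * s (i + 1)) := by group
        _ = wprod s (dnWord N m) * s i * (s (i + 1) * s i) := by
          rw [← hb]; group
        _ = _ := by rw [hfar]; group

theorem ABRel.top_shift (R : ABRel s N isB) (hB : isB) {k m : ℕ} (hm : m + 1 + k ≤ N) :
    wprod s (upWord k (N + 1 - k)) * wprod s (dnWord N (m + 1)) * s N =
      s N * (wprod s (upWord k (N + 1 - k)) * wprod s (dnWord N (m + 1))) := by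
  induction m with
  | zero =>
    obtain ⟨p, rfl⟩ : ∃ p, N = k + p + 1 := ⟨N - k - 1, by omega⟩
    have hfar := R.far_word (i := k + p + 1) (upWord k p)
      (fun x hx => by have := mem_upWord hx; omega)
    have e : k + p + 1 + 1 - k = p + 1 + 1 := by omega
    have e' : k + p + 1 - 1 - 0 = k + p := by omega
    have h4 := R.four hB (k + p) rfl
    rw [e]
    simp only [upWord, dnWord, wprod_append, wprod_single, wprod_nil, ← add_assoc, e']
    calc _ = wprod s (upWord k p) *
          (s (k + p) * s (k + p + 1) * s (k + p) * s (k + p + 1)) := by group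
      _ = wprod s (upWord k p) * s (k + p + 1) *
          (s (k + p) * s (k + p + 1) * s (k + p)) := by rw [h4]; group
      _ = _ := by rw [hfar]; group
  | succ m ih =>
    have ih := ih (by omega)
    rw [dnWord, wprod_append, wprod_single, mul_assoc, mul_assoc, R.far (by omega)]
    calc _ = (wprod s (upWord k (N + 1 - k)) * wprod s (dnWord N (m + 1)) * s N) *
          s (N - 1 - (m + 1)) := by group
      _ = _ := by rw [ih]; group

/-- Coset representatives. -/
def IsCos (N : ℕ) (isB : Prop) (k : ℕ) (c : List ℕ) : Prop :=
  (∃ m, k + m ≤ N + 1 ∧ c = upWord k m) ∨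
    (isB ∧ ∃ m, m + k ≤ N ∧ c = upWord k (N + 1 - k) ++ dnWord N m)

theorem ABRel.step (R : ABRel s N isB) {k i : ℕ} {c : List ℕ} (hc : IsCos N isB k c)
    (hk : k ≤ i) (hi : i ≤ N) :
    (∃ c', IsCos N isB k c' ∧ c'.length ≤ c.length + 1 ∧ wprod s c * s i = wprod s c') ∨
    (∃ i', k < i' ∧ i' ≤ N ∧ wprod s c * s i = s i' * wprod s c) := by
  rcases hc with ⟨m, hm, rfl⟩ | ⟨hB, m, hm, rfl⟩
  · rcases lt_trichotomy i (k + m) with h | h | h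
    · by_cases h1 : i + 1 = k + m
      · left
        obtain ⟨m, rfl⟩ : ∃ m', m = m' + 1 := ⟨m - 1, by omega⟩
        obtain rfl : i = k + m := by omega
        refine ⟨upWord k m, Or.inl ⟨m, by omega, rfl⟩, by simp [length_upWord]; omega, ?_⟩
        rw [upWord, wprod_append, wprod_single, mul_assoc, R.sq, mul_one]
      · by_cases h2 : isB ∧ i + 1 = N
        · left
          refine ⟨upWord k (N + 1 - k) ++ dnWord N 1,
            Or.inr ⟨h2.1, 1, by omega, rfl⟩, ?_, ?_⟩
          · simp [length_upWord, length_dnWord]; omega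
          · have : N - 1 - 0 = i := by omega
            have e : m = N + 1 - k := by omega
            simp only [dnWord, wprod_append, wprod_single, wprod_nil, one_mul, this, e]
        · right
          exact ⟨i + 1, by omega, by omega, R.up_shift hk (by omega) (by omega)
            (fun hb => by by_contra h3; exact h2 ⟨hb, by omega⟩)⟩
    · left
      subst h
      exact ⟨upWord k (m + 1), Or.inl ⟨m + 1, by omega, rfl⟩, by simp [length_upWord],
        by rw [upWord, wprod_append, wprod_single]⟩
    · right
      exact ⟨i, by omega, hi, R.far_word _ (fun x hx => by have := mem_upWord hx; omega)⟩
  · simp only [wprod_append]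
    by_cases h0 : i + m = N
    · -- `i = N - m`
      left
      cases m with
      | zero =>
        obtain rfl : i = N := by omega
        refine ⟨upWord k (i - k), Or.inl ⟨i - k, by omega, rfl⟩,
          by simp [length_upWord]; omega, ?_⟩
        have e : i + 1 - k = i - k + 1 := by omega
        have e' : k + (i - k) = i := by omega
        rw [e]
        simp only [upWord, dnWord, wprod_append, wprod_single, wprod_nil, mul_one, e']
        rw [mul_assoc, R.sq, mul_one]
      | succ m =>
        refine ⟨upWord k (N + 1 - k) ++ dnWord N m, Or.inr ⟨hB, m, by omega, rfl⟩,
          by simp [length_upWord, length_dnWord]; omega, ?_⟩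
        have e : N - 1 - m = i := by omega
        simp only [dnWord, wprod_append, wprod_single, e]
        rw [mul_assoc, mul_assoc, R.sq, mul_one]
    · by_cases h1 : i + m + 1 = N
      · left
        refine ⟨upWord k (N + 1 - k) ++ dnWord N (m + 1), Or.inr ⟨hB, m + 1, by omega, rfl⟩,
          by simp [length_upWord, length_dnWord]; omega, ?_⟩
        have e : N - 1 - m = i := by omega
        simp only [dnWord, wprod_append, wprod_single, e, mul_assoc]
      · right
        by_cases h2 : i + m < N
        · have hfar := R.far_word (i := i) (dnWord N m)
            (fun x hx => by have := mem_dnWord (by omega) hx; omega)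
          refine ⟨i + 1, by omega, by omega, ?_⟩
          rw [mul_assoc, hfar, ← mul_assoc,
            R.up_shift hk (by omega) (by omega) (fun _ => by omega), mul_assoc]
        · refine ⟨i, by omega, hi, ?_⟩
          by_cases h3 : i = N
          · subst h3
            obtain ⟨m, rfl⟩ : ∃ m', m = m' + 1 := ⟨m - 1, by omega⟩
            exact R.top_shift hB (by omega)
          · obtain ⟨i, rfl⟩ : ∃ i', i = i' + 1 := ⟨i - 1, by omega⟩
            rw [mul_assoc, R.dn_shift (by omega) (by omega) (by omega), ← mul_assoc,
              R.up_shift (by omega) (by omega) (by omega) (fun _ => by omega), mul_assoc]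

theorem ABRel.factor (R : ABRel s N isB) (k : ℕ) (ω : List ℕ) (hk : k ≤ N + 1)
    (h : ∀ x ∈ ω, k ≤ x ∧ x ≤ N) :
    ∃ u c, IsCos N isB k c ∧ (∀ x ∈ u, k + 1 ≤ x ∧ x ≤ N) ∧
      u.length + c.length ≤ ω.length ∧ wprod s ω = wprod s u * wprod s c := by
  induction ω using List.reverseRecOn with
  | nil => exact ⟨[], [], Or.inl ⟨0, by omega, rfl⟩, by simp, by simp, by simp [wprod]⟩
  | append_singleton ω i ih =>
    obtain ⟨u, c, hc, hu, hl, hp⟩ := ih (fun x hx => h x (by simp [hx]))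
    have hi := h i (by simp)
    simp only [wprod_append, wprod_single, List.length_append, List.length_singleton]
    rcases R.step hc hi.1 hi.2 with ⟨c', hc', hl', hp'⟩ | ⟨i', h1, h2, hp'⟩
    · exact ⟨u, c', hc', hu, by omega, by rw [hp, mul_assoc, hp']⟩
    · refine ⟨u ++ [i'], c, hc, ?_, by simp; omega, ?_⟩
      · intro x hx
        rcases List.mem_append.1 hx with hx | hx
        · exact hu x hx
        · simp at hx; omega
      · rw [hp, mul_assoc, hp', wprod_append, wprod_single, mul_assoc]

theorem ABRel.normal (R : ABRel s N isB) (d : ℕ) : ∀ (k : ℕ) (ω : List ℕ), k + d = N + 1 →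
    (∀ x ∈ ω, k ≤ x ∧ x ≤ N) →
    ∃ ω', NFGood ω' ∧ (∀ x ∈ ω', k ≤ x ∧ x ≤ N) ∧ ω'.length ≤ ω.length ∧
      wprod s ω = wprod s ω' := by
  induction d with
  | zero =>
    intro k ω hk h
    refine ⟨[], NFGood.nil, by simp, by simp, ?_⟩
    have : ω = [] := List.eq_nil_iff_forall_not_mem.2 (fun x hx => by have := h x hx; omega)
    rw [this]
  | succ d ih =>
    intro k ω hk h
    obtain ⟨u, c, hc, hu, hl, hp⟩ := R.factor k ω (by omega) h
    obtain ⟨u', hg, hu', hl', hp'⟩ := ih (k + 1) u (by omega) hu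
    refine ⟨u' ++ c, ?_, ?_, by simp; omega, by rw [hp, hp', wprod_append]⟩
    · rcases hc with ⟨m, hm, rfl⟩ | ⟨hB, m, hm, rfl⟩
      · exact hg.up (fun x hx => (hu' x hx).1) m
      · have hg' := hg.up (fun x hx => (hu' x hx).1) (N + 1 - k)
        have e : N + 1 - k = N - k + 1 := by omega
        have e' : k + (N - k) = N := by omega
        rw [e] at hg' ⊢
        simp only [upWord, e', ← List.append_assoc] at hg' ⊢
        exact hg'.dn (by omega)
    · intro x hx
      rcases List.mem_append.1 hx with hx | hx
      · have := hu' x hx; omega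
      · rcases hc with ⟨m, hm, rfl⟩ | ⟨hB, m, hm, rfl⟩
        · have := mem_upWord hx; omega
        · rcases List.mem_append.1 hx with hx | hx
          · have := mem_upWord hx; omega
          · have := mem_dnWord (by omega) hx; omega

end core

theorem pow_two_of_comm {G : Type*} [Group G] {a b : G} (ha : a * a = 1) (hb : b * b = 1)
    (h : a * b = b * a) : (a * b) ^ 2 = 1 := by
  calc (a * b) ^ 2 = (a * b) * (a * b) := pow_two _
    _ = (b * a) * (a * b) := by rw [h]
    _ = b * (a * a) * b := by group
    _ = 1 := by rw [ha, mul_one, hb]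

theorem pow_three_of_braid {G : Type*} [Group G] {a b : G} (ha : a * a = 1) (hb : b * b = 1)
    (h : a * b * a = b * a * b) : (a * b) ^ 3 = 1 := by
  calc (a * b) ^ 3 = (a * b * a) * (b * a * b) := by rw [pow_three]; group
    _ = (a * b * a) * (a * b * a) := by rw [h]
    _ = a * b * (a * a) * b * a := by group
    _ = a * (b * b) * a := by rw [ha]; group
    _ = 1 := by rw [hb, mul_one, ha]

theorem pow_four_of_braid {G : Type*} [Group G] {a b : G} (ha : a * a = 1) (hb : b * b = 1)
    (h : a * b * a * b = b * a * b * a) : (a * b) ^ 4 = 1 := by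
  have e : (a * b) ^ 4 = (a * b * a * b) * (a * b * a * b) := by
    rw [show (4 : ℕ) = 2 + 2 from rfl, pow_add, pow_two]; group
  rw [e]
  nth_rewrite 1 [h]
  calc b * a * b * a * (a * b * a * b) = b * a * b * (a * a) * b * a * b := by group
    _ = b * a * (b * b) * a * b := by rw [ha]; group
    _ = b * (a * a) * b := by rw [hb]; group
    _ = 1 := by rw [ha, mul_one, hb]

theorem braid_of_pow_three {G : Type*} [Group G] {a b : G} (ha : a * a = 1) (hb : b * b = 1)
    (h : (a * b) ^ 3 = 1) : a * b * a = b * a * b := by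
  have ha' : a⁻¹ = a := inv_eq_of_mul_eq_one_left ha
  have hb' : b⁻¹ = b := inv_eq_of_mul_eq_one_left hb
  have : (a * b * a) * (b * a * b) = 1 := by rw [← h, pow_three]; group
  rw [eq_inv_of_mul_eq_one_left this]
  simp [ha', hb', mul_assoc]

theorem braid_of_pow_four {G : Type*} [Group G] {a b : G} (ha : a * a = 1) (hb : b * b = 1)
    (h : (a * b) ^ 4 = 1) : a * b * a * b = b * a * b * a := by
  have ha' : a⁻¹ = a := inv_eq_of_mul_eq_one_left ha
  have hb' : b⁻¹ = b := inv_eq_of_mul_eq_one_left hb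
  have : (a * b * a * b) * (a * b * a * b) = 1 := by
    rw [← h, show (4 : ℕ) = 2 + 2 from rfl, pow_add, pow_two]; group
  rw [eq_inv_of_mul_eq_one_left this]
  simp [ha', hb', mul_assoc]

theorem comm_of_pow_two {G : Type*} [Group G] {a b : G} (ha : a * a = 1) (hb : b * b = 1)
    (h : (a * b) ^ 2 = 1) : a * b = b * a := by
  have ha' : a⁻¹ = a := inv_eq_of_mul_eq_one_left ha
  have hb' : b⁻¹ = b := inv_eq_of_mul_eq_one_left hb
  rw [pow_two] at h
  rw [eq_inv_of_mul_eq_one_left h]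
  simp [ha', hb']

/-- Adjacent transposition. -/
def adjSwap (i : ℕ) : Equiv.Perm ℕ := Equiv.swap i (i + 1)

theorem adjSwap_apply (i x : ℕ) :
    adjSwap i x = if x = i then i + 1 else if x = i + 1 then i else x := by
  simp [adjSwap, Equiv.swap_apply_def]

theorem adjSwap_sq (i : ℕ) : adjSwap i * adjSwap i = 1 := by simp [adjSwap]

theorem adjSwap_comm {i j : ℕ} (h : i + 1 < j) : adjSwap i * adjSwap j = adjSwap j * adjSwap i := by
  ext x
  simp only [Equiv.Perm.mul_apply, adjSwap_apply]
  grind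

theorem adjSwap_braid (i : ℕ) :
    adjSwap i * adjSwap (i + 1) * adjSwap i = adjSwap (i + 1) * adjSwap i * adjSwap (i + 1) := by
  ext x
  simp only [Equiv.Perm.mul_apply, adjSwap_apply]
  grind

/-- Type B generators inside the symmetric group on `2N+2` letters. -/
def bSwap (N i : ℕ) : Equiv.Perm ℕ :=
  if i < N then adjSwap i * adjSwap (2 * N - i) else adjSwap i

theorem bSwap_sq (N i : ℕ) : bSwap N i * bSwap N i = 1 := by
  unfold bSwap
  split_ifs with h
  · have := adjSwap_comm (i := i) (j := 2 * N - i) (by omega)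
    rw [← pow_two]
    exact pow_two_of_comm (adjSwap_sq _) (adjSwap_sq _) this
  · exact adjSwap_sq _

theorem bSwap_comm {N i j : ℕ} (h : i + 1 < j) (hj : j ≤ N) :
    bSwap N i * bSwap N j = bSwap N j * bSwap N i := by
  unfold bSwap
  rw [if_pos (by omega)]
  have c1 : Commute (adjSwap i) (adjSwap j) := adjSwap_comm h
  have c2 : Commute (adjSwap (2 * N - i)) (adjSwap j) := (adjSwap_comm (by omega)).symm
  split_ifs with h'
  · have c3 : Commute (adjSwap i) (adjSwap (2 * N - j)) := adjSwap_comm (by omega)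
    have c4 : Commute (adjSwap (2 * N - i)) (adjSwap (2 * N - j)) :=
      (adjSwap_comm (by omega)).symm
    exact (c1.mul_left c2).mul_right (c3.mul_left c4)
  · exact c1.mul_left c2

theorem bSwap_braid {N i : ℕ} (h : i + 1 < N) :
    bSwap N i * bSwap N (i + 1) * bSwap N i = bSwap N (i + 1) * bSwap N i * bSwap N (i + 1) := by
  obtain ⟨p, rfl⟩ : ∃ p, N = i + 2 + p := ⟨N - i - 2, by omega⟩
  unfold bSwap
  rw [if_pos (by omega), if_pos (by omega)]
  obtain ⟨q, hq⟩ : ∃ q, q = 2 * (i + 2 + p) - (i + 1) := ⟨_, rfl⟩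
  have hq' : 2 * (i + 2 + p) - i = q + 1 := by omega
  rw [← hq, hq']
  have b1 := adjSwap_braid i
  have b2 := adjSwap_braid q
  have c1 : Commute (adjSwap i) (adjSwap q) := adjSwap_comm (by omega)
  have c2 : Commute (adjSwap i) (adjSwap (q + 1)) := adjSwap_comm (by omega)
  have c3 : Commute (adjSwap (i + 1)) (adjSwap q) := adjSwap_comm (by omega)
  have c4 : Commute (adjSwap (i + 1)) (adjSwap (q + 1)) := adjSwap_comm (by omega)
  generalize adjSwap i = a at *
  generalize adjSwap (i + 1) = b at *
  generalize adjSwap q = c at *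
  generalize adjSwap (q + 1) = d at *
  calc a * d * (b * c) * (a * d) = a * (d * b) * (c * a) * d := by group
    _ = a * b * (d * a) * c * d := by rw [← c4.eq, ← c1.eq]; group
    _ = (a * b * a) * (d * c * d) := by rw [← c2.eq]; group
    _ = (b * a * b) * (c * d * c) := by rw [b1, b2]
    _ = b * a * (b * c) * d * c := by group
    _ = b * (a * c) * (b * d) * c := by rw [c3.eq]; group
    _ = _ := by rw [c1.eq, c4.eq]; group

theorem bSwap_four {N i : ℕ} (h : i + 1 = N) :
    bSwap N i * bSwap N (i + 1) * bSwap N i * bSwap N (i + 1) =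
      bSwap N (i + 1) * bSwap N i * bSwap N (i + 1) * bSwap N i := by
  subst h
  unfold bSwap
  rw [if_pos (by omega), if_neg (by omega)]
  have hq' : 2 * (i + 1) - i = i + 2 := by omega
  rw [hq']
  ext x
  by_cases h : x < i ∨ i + 3 < x
  · simp only [Equiv.Perm.mul_apply, adjSwap_apply]
    grind
  · obtain ⟨y, rfl⟩ : ∃ y, x = i + y := ⟨x - i, by omega⟩
    have : y < 4 := by omega
    interval_cases y <;> simp [Equiv.Perm.mul_apply, adjSwap_apply, add_assoc]

theorem adjSwap_not_comm (i : ℕ) :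
    adjSwap i * adjSwap (i + 1) ≠ adjSwap (i + 1) * adjSwap i := by
  intro h
  have := congrArg (fun p : Equiv.Perm ℕ => p i) h
  simp only [Equiv.Perm.mul_apply, adjSwap_apply] at this
  grind

theorem bSwap_not_comm {N i : ℕ} (hi : i < N) :
    bSwap N i * bSwap N (i + 1) ≠ bSwap N (i + 1) * bSwap N i := by
  intro h
  have := congrArg (fun p : Equiv.Perm ℕ => p i) h
  unfold bSwap at this
  by_cases h' : i + 1 < N
  · simp only [if_pos hi, if_pos h', Equiv.Perm.mul_apply, adjSwap_apply] at this
    grind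
  · simp only [if_pos hi, if_neg h', Equiv.Perm.mul_apply, adjSwap_apply] at this
    grind

theorem normal_form_aux {W : Type*} [Group W] {N : ℕ} {M : CoxeterMatrix (Fin (N + 1))}
    (isB : Prop) (cs : CoxeterSystem M W)
    (h2 : ∀ i j : Fin (N + 1), i.val + 1 < j.val → M i j = 2)
    (h3 : ∀ i j : Fin (N + 1), i.val + 1 = j.val → (isB → j.val < N) → M i j = 3)
    (h4 : isB → ∀ i j : Fin (N + 1), i.val + 1 = j.val → j.val = N → M i j = 4)
    (f : ℕ → Equiv.Perm ℕ) (fsq : ∀ i, f i * f i = 1)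
    (fcomm : ∀ i j, i + 1 < j → j ≤ N → f i * f j = f j * f i)
    (fbraid : ∀ i, i < N → (isB → i + 1 < N) →
      f i * f (i + 1) * f i = f (i + 1) * f i * f (i + 1))
    (ffour : isB → ∀ i, i + 1 = N →
      f i * f (i + 1) * f i * f (i + 1) = f (i + 1) * f i * f (i + 1) * f i)
    (fnc : ∀ i, i < N → f i * f (i + 1) ≠ f (i + 1) * f i) (w : W) :
    ∃ ω : List (Fin (N + 1)), cs.IsReduced ω ∧ cs.wordProd ω = w ∧
      ∀ (k : ℕ) (h : k + 1 < ω.length),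
        ω.get ⟨k + 1, h⟩ ∉ ω.take (k + 1) ∨
          ¬ Commute (cs.simple (ω.get ⟨k + 1, h⟩))
            (cs.simple (ω.get ⟨k, Nat.lt_of_succ_lt h⟩)) := by
  -- the representation shows that adjacent generators do not commute
  have key : ∀ i j : Fin (N + 1), i.val < j.val → (f i * f j) ^ M i j = 1 := by
    rintro ⟨i, hi⟩ ⟨j, hj⟩ hij
    simp only at hij ⊢
    rcases Nat.lt_or_ge (i + 1) j with h | h
    · rw [h2 ⟨i, hi⟩ ⟨j, hj⟩ h]
      exact pow_two_of_comm (fsq _) (fsq _) (fcomm _ _ h (by omega))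
    · obtain rfl : j = i + 1 := by omega
      by_cases hB : isB ∧ i + 1 = N
      · rw [h4 hB.1 ⟨i, hi⟩ ⟨i + 1, hj⟩ rfl hB.2]
        exact pow_four_of_braid (fsq _) (fsq _) (ffour hB.1 _ hB.2)
      · have hB' : isB → i + 1 < N := fun b => by
          by_contra hc; exact hB ⟨b, by omega⟩
        rw [h3 ⟨i, hi⟩ ⟨i + 1, hj⟩ rfl hB']
        exact pow_three_of_braid (fsq _) (fsq _) (fbraid _ (by omega) hB')
  have hlift : M.IsLiftable (fun i : Fin (N + 1) => f i) := by
    intro i j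
    rcases lt_trichotomy i.val j.val with h | h | h
    · exact key i j h
    · obtain rfl : i = j := Fin.ext h
      simp [fsq]
    · have := key j i h
      rw [M.symmetric i j]
      have e : f i * f j = (f j * f i)⁻¹ := by
        rw [mul_inv_rev, inv_eq_of_mul_eq_one_left (fsq _), inv_eq_of_mul_eq_one_left (fsq _)]
      rw [e, inv_pow, this, inv_one]
  have hnc : ∀ i j : Fin (N + 1), i.val + 1 = j.val →
      ¬ Commute (cs.simple i) (cs.simple j) := by
    intro i j hij hc
    have h := hc.map (cs.lift ⟨_, hlift⟩)
    rw [cs.lift_apply_simple hlift, cs.lift_apply_simple hlift] at h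
    have := h.eq
    rw [← hij] at this
    exact fnc i (by omega) this
  -- the relations
  let s : ℕ → W := fun i => if h : i < N + 1 then cs.simple ⟨i, h⟩ else 1
  have hs : ∀ i (h : i < N + 1), s i = cs.simple ⟨i, h⟩ := fun i h => dif_pos h
  have hs' : ∀ i, ¬ i < N + 1 → s i = 1 := fun i h => dif_neg h
  have R : ABRel s N isB := by
    refine ⟨?_, ?_, ?_, ?_⟩
    · intro i
      by_cases h : i < N + 1
      · simp [hs i h]
      · simp [hs' i h]
    · intro i j hij
      by_cases h : j < N + 1
      · rw [hs i (by omega), hs j h]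
        refine comm_of_pow_two (by simp) (by simp) ?_
        have := cs.simple_mul_simple_pow ⟨i, by omega⟩ ⟨j, h⟩
        rwa [h2 _ _ hij] at this
      · simp [hs' j h]
    · intro i hi hB
      rw [hs i (by omega), hs (i + 1) (by omega)]
      refine braid_of_pow_three (by simp) (by simp) ?_
      have := cs.simple_mul_simple_pow ⟨i, by omega⟩ ⟨i + 1, by omega⟩
      rwa [h3 _ _ rfl hB] at this
    · intro hB i hi
      rw [hs i (by omega), hs (i + 1) (by omega)]
      refine braid_of_pow_four (by simp) (by simp) ?_
      have := cs.simple_mul_simple_pow ⟨i, by omega⟩ ⟨i + 1, by omega⟩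
      rwa [h4 hB _ _ rfl hi] at this
  have hw : ∀ l : List (Fin (N + 1)), wprod s (l.map Fin.val) = cs.wordProd l := by
    intro l
    simp only [wprod, CoxeterSystem.wordProd, List.map_map]
    congr 1
    apply List.map_congr_left
    intro a _
    exact hs a a.2
  obtain ⟨ω₀, hr, rfl⟩ := cs.exists_isReduced w
  obtain ⟨ω', hg, hm, hl, hp⟩ := R.normal (N + 1) 0 (ω₀.map Fin.val) (by omega) (by
    intro x hx
    obtain ⟨a, _, rfl⟩ := List.mem_map.1 hx
    omega)
  obtain ⟨ω, rfl⟩ : ∃ ω : List (Fin (N + 1)), ω.map Fin.val = ω' := by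
    have hx : ∀ x ∈ ω', x < N + 1 := fun x hx => by have := hm x hx; omega
    exact ⟨ω'.pmap (fun a h => ⟨a, h⟩) hx, by simp [List.map_pmap]⟩
  rw [hw, hw] at hp
  simp only [List.length_map] at hl
  refine ⟨ω, ?_, hp.symm, ?_⟩
  · have h1 := cs.length_wordProd_le ω
    have h5 : cs.length (cs.wordProd ω₀) = ω₀.length := hr
    rw [hp] at h5
    show cs.length (cs.wordProd ω) = ω.length
    omega
  · intro k hk
    have := hg.spec k (by simpa using hk)
    simp only [List.getElem_map, ← List.map_take] at this
    rcases this with h | h | h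
    · left
      intro hmem
      exact h (List.mem_map.2 ⟨_, hmem, rfl⟩)
    · right
      exact hnc _ _ h
    · right
      intro hc
      exact hnc _ _ h hc.symm

/-- Every element `w` of a Coxeter group of type `A` or `B` has a reduced expression
`s_1 s_2 ⋯ s_n` such that for each `k`, either `s_k` does not occur among `s_1, …, s_{k-1}`,
or `s_k` does not commute with `s_{k-1}` (the condition is vacuous for the first letter). -/
theorem exists_normal_form_reduced_word {n : ℕ} {M : CoxeterMatrix (Fin n)}
    (hM : M = CoxeterMatrix.Aₙ n ∨ M = CoxeterMatrix.Bₙ n)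
    (cs : CoxeterSystem M W) (w : W) :
    ∃ ω : List (Fin n), cs.IsReduced ω ∧ cs.wordProd ω = w ∧
      ∀ (k : ℕ) (h : k + 1 < ω.length),
        ω.get ⟨k + 1, h⟩ ∉ ω.take (k + 1) ∨
          ¬ Commute (cs.simple (ω.get ⟨k + 1, h⟩))
            (cs.simple (ω.get ⟨k, Nat.lt_of_succ_lt h⟩)) := by
  cases n with
  | zero =>
    obtain ⟨ω, hr, rfl⟩ := cs.exists_isReduced w
    exact ⟨ω, hr, rfl, fun k h => (ω.get ⟨k + 1, h⟩).elim0⟩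
  | succ N =>
    rcases hM with rfl | rfl
    · refine normal_form_aux False cs ?_ ?_ (fun h => h.elim) adjSwap adjSwap_sq
        (fun i j h _ => adjSwap_comm h) (fun i _ _ => adjSwap_braid i) (fun h => h.elim)
        (fun i _ => adjSwap_not_comm i) w
      · rintro ⟨i, hi⟩ ⟨j, hj⟩ h
        simp only at h
        simp only [CoxeterMatrix.Aₙ, CoxeterMatrix.A, Matrix.of_apply, Fin.mk.injEq]
        rw [if_neg (by omega), if_neg (by omega)]
      · rintro ⟨i, hi⟩ ⟨j, hj⟩ h _
        simp only at h
        simp only [CoxeterMatrix.Aₙ, CoxeterMatrix.A, Matrix.of_apply, Fin.mk.injEq]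
        rw [if_neg (by omega), if_pos (by omega)]
    · refine normal_form_aux True cs ?_ ?_ ?_ (bSwap N) (bSwap_sq N)
        (fun i j h hj => bSwap_comm h hj) (fun i _ h => bSwap_braid (h trivial))
        (fun _ i h => bSwap_four h) (fun i h => bSwap_not_comm h) w
      · rintro ⟨i, hi⟩ ⟨j, hj⟩ h
        simp only at h
        simp only [CoxeterMatrix.Bₙ, CoxeterMatrix.B, Matrix.of_apply, Fin.mk.injEq]
        rw [if_neg (by omega), if_neg (by omega), if_neg (by omega)]
      · rintro ⟨i, hi⟩ ⟨j, hj⟩ h h'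
        have h' := h' trivial
        simp only at h h'
        simp only [CoxeterMatrix.Bₙ, CoxeterMatrix.B, Matrix.of_apply, Fin.mk.injEq]
        rw [if_neg (by omega), if_neg (by omega), if_pos (by omega)]
      · rintro _ ⟨i, hi⟩ ⟨j, hj⟩ h h'
        simp only at h h'
        simp only [CoxeterMatrix.Bₙ, CoxeterMatrix.B, Matrix.of_apply, Fin.mk.injEq]
        rw [if_neg (by omega), if_pos (by omega)]
end
end

section
/- An element w of a Coxeter group W is fully commutative (i.e., w ∈ W_c, not complex) if and only if every reduced expression for w can be transformed into any other reduced expression for w by a sequence of commutation moves (exchanges of adjacent commuting generators). -/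
open CoxeterSystem LaurentPolynomial

noncomputable section

variable {B : Type*} {W : Type*} [Group W]

/-- A single commutation move: exchange two adjacent commuting letters. -/
def CommMove (M : CoxeterMatrix B) (ω ω' : List B) : Prop :=
  ∃ (l₁ l₂ : List B) (i i' : B), M i i' = 2 ∧
    ω = l₁ ++ [i, i'] ++ l₂ ∧ ω' = l₁ ++ [i', i] ++ l₂

namespace FCProof

/-! ### The geometric representation and the exact order of `s_i s_j` -/

/-- Coefficients of (twice) the standard bilinear form. -/
def coef (M : CoxeterMatrix B) (i j : B) : ℝ :=
  if M i j = 0 then -2 else -2 * Real.cos (Real.pi / M i j)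

theorem coef_diag (M : CoxeterMatrix B) (i : B) : coef M i i = 2 := by
  simp [coef]

theorem coef_symm (M : CoxeterMatrix B) (i j : B) : coef M i j = coef M j i := by
  simp [coef, M.symmetric i j]

/-- The coroot functionals. -/
def corootF (M : CoxeterMatrix B) (i : B) : Module.Dual ℝ (B →₀ ℝ) :=
  Finsupp.linearCombination ℝ (coef M i)

theorem corootF_single (M : CoxeterMatrix B) (i j : B) :
    corootF M i (Finsupp.single j 1) = coef M i j := by
  simp [corootF]

theorem corootF_self (M : CoxeterMatrix B) (i : B) :
    corootF M i (Finsupp.single i 1) = 2 := by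
  rw [corootF_single, coef_diag]

/-- The reflections of the geometric representation. -/
def geoRefl (M : CoxeterMatrix B) (i : B) : (B →₀ ℝ) ≃ₗ[ℝ] (B →₀ ℝ) :=
  Module.reflection (corootF_self M i)

theorem sin_pos_of_three {m : ℕ} (hm : 3 ≤ m) : 0 < Real.sin (2 * Real.pi / m) := by
  have hm' : (3 : ℝ) ≤ m := by exact_mod_cast hm
  apply Real.sin_pos_of_pos_of_lt_pi
  · have := Real.pi_pos; positivity
  · rw [div_lt_iff₀ (by linarith)]
    nlinarith [Real.pi_pos]

theorem coef_t (M : CoxeterMatrix B) (i j : B) (h : M i j ≠ 0) :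
    corootF M i (Finsupp.single j 1) * corootF M j (Finsupp.single i 1) - 2
      = 2 * Real.cos (2 * Real.pi / M i j) := by
  rw [corootF_single, corootF_single, coef_symm M j i, coef, if_neg h,
    show 2 * Real.pi / (M i j : ℝ) = 2 * (Real.pi / M i j) by ring, Real.cos_two_mul]
  ring

open Polynomial.Chebyshev in
theorem geoRefl_liftable (M : CoxeterMatrix B) : M.IsLiftable (geoRefl M) := by
  intro i j
  rcases Nat.eq_zero_or_pos (M i j) with h0 | hpos
  · rw [h0, pow_zero]
  by_cases hij : i = j
  · subst hij
    rw [M.diagonal, pow_one]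
    ext1 z
    exact Module.involutive_reflection (corootF_self M i) z
  have h1 : M i j ≠ 1 := M.off_diagonal i j hij
  ext1 z
  rw [geoRefl, geoRefl, Module.reflection_mul_reflection_pow_apply _ _ _ _ _ (coef_t M i j hpos.ne').symm]
  by_cases h2 : M i j = 2
  · have c0 : coef M i j = 0 := by simp [coef, h2]
    have c1 : coef M j i = 0 := by rw [coef_symm, c0]
    rw [h2, corootF_single, corootF_single, c0, c1]
    have : (2 : ℝ) * Real.cos (2 * Real.pi / (2 : ℕ)) = -2 := by
      rw [show 2 * Real.pi / ((2 : ℕ) : ℝ) = Real.pi by push_cast; ring, Real.cos_pi]; norm_num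
    rw [this]
    norm_num
    module
  have h3 : 3 ≤ M i j := by omega
  generalize hm : M i j = m at *
  have hs := sin_pos_of_three h3
  set θ := 2 * Real.pi / (m : ℝ) with hθ
  have hmθ : m * θ = 2 * Real.pi := by
    rw [hθ]; field_simp
  have hS : ∀ n : ℤ, (S ℝ n).eval (2 * Real.cos θ) = Real.sin ((n + 1) * θ) / Real.sin θ := by
    intro n
    rw [eq_div_iff hs.ne', S_two_mul_real_cos]
  rcases Nat.even_or_odd' m with ⟨k, rfl | rfl⟩
  · have e1 : (((2 * k : ℕ) : ℤ) - 2) / 2 = k - 1 := by omega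
    have e2 : (((2 * k : ℕ) : ℤ) - 1) / 2 = k - 1 := by omega
    have hz : (S ℝ ((k : ℤ) - 1)).eval (2 * Real.cos θ) = 0 := by
      rw [hS]
      push_cast at hmθ ⊢
      rw [show ((k : ℝ) - 1 + 1) * θ = Real.pi by linarith, Real.sin_pi, zero_div]
    rw [e1, e2, hz]
    simp
  · have e1 : (((2 * k + 1 : ℕ) : ℤ) - 2) / 2 = k - 1 := by omega
    have e2 : (((2 * k + 1 : ℕ) : ℤ) - 1) / 2 = k := by omega
    have e3 : (((2 * k + 1 : ℕ) : ℤ) - 3) / 2 = k - 1 := by omega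
    have e4 : (((2 * k + 1 : ℕ) : ℤ)) / 2 = k := by omega
    have hz : (S ℝ (k : ℤ)).eval (2 * Real.cos θ)
        + (S ℝ ((k : ℤ) - 1)).eval (2 * Real.cos θ) = 0 := by
      rw [hS, hS]
      push_cast at hmθ ⊢
      rw [show ((k : ℝ) + 1) * θ = 2 * Real.pi - ((k : ℝ) - 1 + 1) * θ by linarith,
        Real.sin_two_pi_sub]
      ring
    rw [e1, e2, e3, e4, hz]
    simp

open Polynomial.Chebyshev in
theorem geoRefl_pow_ne (M : CoxeterMatrix B) {i j : B} (hij : i ≠ j) {p : ℕ} (hp : 0 < p)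
    (hpm : M i j = 0 ∨ p < M i j) : (geoRefl M i * geoRefl M j) ^ p ≠ 1 := by
  intro h
  have key : ∀ t : ℝ, t = corootF M i (Finsupp.single j 1) * corootF M j (Finsupp.single i 1) - 2 →
      ((S ℝ p).eval t + (S ℝ (p - 1)).eval t = 1) ∧ (S ℝ (p - 1)).eval t * coef M i j = 0 := by
    intro t ht
    have := Module.reflection_mul_reflection_pow_apply_self
      (corootF_self M i) (corootF_self M j) p t ht
    change ((geoRefl M i * geoRefl M j) ^ p) _ = _ at this
    rw [h] at this
    have a := DFunLike.congr_fun this i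
    have b := DFunLike.congr_fun this j
    simp [hij, hij.symm, corootF_single, coef_symm M j i] at a b
    refine ⟨a.symm, ?_⟩
    simpa using b
  by_cases h0 : M i j = 0
  · have c : coef M i j = -2 := by simp [coef, h0]
    have c' : coef M j i = -2 := by rw [coef_symm, c]
    have := (key 2 (by rw [corootF_single, corootF_single, c, c']; norm_num)).2
    rw [S_eval_two, c] at this
    have hp' : (0 : ℝ) < p := by exact_mod_cast hp
    push_cast at this
    linarith
  have hlt : p < M i j := hpm.resolve_left h0
  have h1 : M i j ≠ 1 := M.off_diagonal i j hij
  obtain ⟨k1, k2⟩ := key _ (coef_t M i j h0).symm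
  by_cases h2 : M i j = 2
  · have hp1 : p = 1 := by omega
    subst hp1
    rw [h2] at k1
    rw [show 2 * Real.pi / ((2 : ℕ) : ℝ) = Real.pi by push_cast; ring, Real.cos_pi] at k1
    norm_num at k1
  have h3 : 3 ≤ M i j := by omega
  have hc : coef M i j ≠ 0 := by
    rw [coef, if_neg h0]
    have h3' : (3 : ℝ) ≤ M i j := by exact_mod_cast h3
    have : 0 < Real.cos (Real.pi / M i j) := by
      apply Real.cos_pos_of_mem_Ioo
      have := Real.pi_pos
      constructor
      · have : 0 < Real.pi / M i j := by positivity
        linarith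
      · rw [div_lt_iff₀ (by linarith)]
        nlinarith
    linarith
  have z := (mul_eq_zero.mp k2).resolve_right hc
  rw [z, add_zero] at k1
  have hs := sin_pos_of_three h3
  have q1 := S_two_mul_real_cos (2 * Real.pi / M i j) p
  have q2 := S_two_mul_real_cos (2 * Real.pi / M i j) (p - 1)
  rw [k1] at q1
  rw [z] at q2
  push_cast at q1 q2
  rw [sub_add_cancel, zero_mul] at q2
  rw [add_mul, one_mul, one_mul, Real.sin_add, ← q2, zero_mul, zero_add] at q1
  have hcos : Real.cos (p * (2 * Real.pi / M i j)) = 1 := by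
    have := mul_right_cancel₀ hs.ne' ((one_mul _).trans q1)
    exact this.symm
  have hmpos : (0 : ℝ) < M i j := by exact_mod_cast (by omega : 0 < M i j)
  have hpp : (0 : ℝ) < p := by exact_mod_cast hp
  have hpl : (p : ℝ) < M i j := by exact_mod_cast hlt
  have hx : 0 < p * (2 * Real.pi / M i j) := by have := Real.pi_pos; positivity
  have hx2 : p * (2 * Real.pi / M i j) < 2 * Real.pi := by
    rw [← mul_div_assoc, div_lt_iff₀ hmpos]
    nlinarith [Real.pi_pos]
  rw [Real.cos_eq_one_iff_of_lt_of_lt (by linarith [Real.pi_pos]) hx2] at hcos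
  linarith

theorem simple_pow_ne {M : CoxeterMatrix B} (cs : CoxeterSystem M W) {i j : B} (hij : i ≠ j)
    {p : ℕ} (hp : 0 < p) (hpm : M i j = 0 ∨ p < M i j) :
    (cs.simple i * cs.simple j) ^ p ≠ 1 := by
  intro h
  apply geoRefl_pow_ne M hij hp hpm
  have := congrArg (cs.lift ⟨geoRefl M, geoRefl_liftable M⟩) h
  simpa using this

end FCProof

namespace FCProof

variable {M : CoxeterMatrix B} (cs : CoxeterSystem M W)

/-! ### The exchange condition -/

open Classical in
/-- The action of a simple reflection on (group) × (signs). -/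
def actFun (i : B) (x : W × ZMod 2) : W × ZMod 2 :=
  (cs.simple i * x.1 * cs.simple i, x.2 + if x.1 = cs.simple i then 1 else 0)

open Classical in
theorem actFun_invol (i : B) : Function.Involutive (actFun cs i) := by
  rintro ⟨t, e⟩
  have h : cs.simple i * t * cs.simple i = cs.simple i ↔ t = cs.simple i := by
    constructor
    · intro h
      have := congrArg (fun x => cs.simple i * x * cs.simple i) h
      simpa [mul_assoc] using this
    · rintro rfl; simp
  refine Prod.ext ?_ ?_
  · simp [actFun, mul_assoc]
  · change e + (if t = cs.simple i then 1 else 0) +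
      (if cs.simple i * t * cs.simple i = cs.simple i then 1 else 0) = e
    by_cases ht : t = cs.simple i
    · rw [if_pos ht, if_pos (h.mpr ht), add_assoc, show (1 + 1 : ZMod 2) = 0 from rfl, add_zero]
    · rw [if_neg ht, if_neg (fun h' => ht (h.mp h')), add_zero, add_zero]

/-- `actFun` as a permutation. -/
def act (i : B) : Equiv.Perm (W × ZMod 2) := (actFun_invol cs i).toPerm

open Classical in
theorem act_word (ω : List B) (t : W) (e : ZMod 2) :
    (ω.map (act cs)).prod (t, e) =
      (cs.wordProd ω * t * (cs.wordProd ω)⁻¹, e + ((cs.rightInvSeq ω).count t : ZMod 2)) := by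
  induction ω with
  | nil => simp
  | cons i ω ih =>
    rw [List.map_cons, List.prod_cons, Equiv.Perm.mul_apply, ih]
    have h : cs.wordProd ω * t * (cs.wordProd ω)⁻¹ = cs.simple i ↔
        (cs.wordProd ω)⁻¹ * cs.simple i * cs.wordProd ω = t := by
      constructor
      · intro h; rw [← h]; group
      · intro h; rw [← h]; group
    change actFun cs i _ = _
    simp only [actFun, h, wordProd_cons, rightInvSeq, List.count_cons, beq_iff_eq]
    refine Prod.ext ?_ ?_
    · simp [mul_assoc]
    · push_cast
      simp [add_assoc]

/-- `g k = s_j (s_i s_j)^k` are the members of the right inversion sequence. -/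
theorem alt_conj (i j : B) (k : ℕ) :
    (cs.wordProd (alternatingWord i j k))⁻¹ * cs.wordProd (alternatingWord i j (k + 1))
      = cs.simple j * (cs.simple i * cs.simple j) ^ k := by
  induction k generalizing i j with
  | zero => simp [alternatingWord]
  | succ k ih =>
    rw [alternatingWord_succ i j k, alternatingWord_succ i j (k + 1), wordProd_concat,
      wordProd_concat, mul_inv_rev, inv_simple]
    rw [show cs.simple j * (cs.wordProd (alternatingWord j i k))⁻¹ *
      (cs.wordProd (alternatingWord j i (k + 1)) * cs.simple j) =
      cs.simple j * ((cs.wordProd (alternatingWord j i k))⁻¹ *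
      cs.wordProd (alternatingWord j i (k + 1))) * cs.simple j by group, ih]
    have : ∀ n : ℕ, cs.simple i * (cs.simple j * cs.simple i) ^ n * cs.simple j
        = (cs.simple i * cs.simple j) ^ (n + 1) := by
      intro n
      induction n with
      | zero => simp
      | succ n ihn => rw [pow_succ _ (n + 1), ← ihn, pow_succ]; group
    rw [← this]; group

theorem ris_alt (i j : B) (n : ℕ) :
    cs.rightInvSeq (alternatingWord i j n) =
      ((List.range n).map fun k => cs.simple j * (cs.simple i * cs.simple j) ^ k).reverse := by
  induction n with
  | zero => simp [alternatingWord]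
  | succ n ih =>
    rw [List.range_succ, List.map_append, List.reverse_append, ← ih, List.map_singleton,
      List.reverse_singleton, ← alt_conj,
      alternatingWord_succ', wordProd_cons]
    simp [rightInvSeq, mul_assoc]

theorem act_liftable : M.IsLiftable (act cs) := by
  classical
  intro i j
  have hw : ∀ n : ℕ, (act cs i * act cs j) ^ n =
      ((alternatingWord i j (2 * n)).map (act cs)).prod := by
    intro n
    induction n with
    | zero => simp [alternatingWord]
    | succ n ih =>
      rw [show 2 * (n + 1) = 2 * n + 1 + 1 by ring, alternatingWord_succ, alternatingWord_succ,
        pow_succ, ih]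
      simp [mul_assoc]
  have hp : cs.wordProd (alternatingWord i j (2 * M i j)) = 1 := by
    rw [prod_alternatingWord_eq_mul_pow]
    simp
  rw [hw]
  refine Equiv.ext ?_
  rintro ⟨t, e⟩
  rw [act_word, hp, ris_alt, two_mul, List.range_add, List.map_append, List.map_map,
    List.count_reverse, List.count_append]
  have : ((fun k => cs.simple j * (cs.simple i * cs.simple j) ^ k) ∘ fun x => M i j + x)
      = fun k => cs.simple j * (cs.simple i * cs.simple j) ^ k := by
    funext k
    simp [pow_add]
  rw [this]
  refine Prod.ext (by simp) ?_
  push_cast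
  rw [← two_mul, show (2 : ZMod 2) = 0 from rfl]
  simp

open Classical in
theorem count_parity {ω ω' : List B} (h : cs.wordProd ω = cs.wordProd ω') (t : W) :
    ((cs.rightInvSeq ω).count t : ZMod 2) = ((cs.rightInvSeq ω').count t : ZMod 2) := by
  have key : ∀ ω : List B, (ω.map (act cs)).prod
      = cs.lift ⟨act cs, act_liftable cs⟩ (cs.wordProd ω) := by
    intro ω
    rw [wordProd, map_list_prod, List.map_map]
    congr 1
    apply List.map_congr_left
    intro a _
    simp
  have e := act_word cs ω t 0
  have e' := act_word cs ω' t 0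
  rw [key, h, ← key, e'] at e
  simpa using (congrArg Prod.snd e).symm

/-- The exchange condition. -/
theorem exchange {ω : List B} {j : B} (hj : cs.IsLeftDescent (cs.wordProd ω) j) :
    (cs.wordProd ω)⁻¹ * cs.simple j * cs.wordProd ω ∈ cs.rightInvSeq ω := by
  classical
  set t := (cs.wordProd ω)⁻¹ * cs.simple j * cs.wordProd ω with ht
  obtain ⟨κ, hκ, hκw⟩ := cs.exists_isReduced (cs.simple j * cs.wordProd ω)
  have hprod : cs.wordProd ω = cs.wordProd (j :: κ) := by
    rw [wordProd_cons, ← hκw]; simp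
  have hnot : t ∉ cs.rightInvSeq κ := by
    intro hmem
    have := (cs.isRightInversion_of_mem_rightInvSeq hκ hmem).2
    rw [← hκw, ht] at this
    have e : cs.simple j * cs.wordProd ω * ((cs.wordProd ω)⁻¹ * cs.simple j * cs.wordProd ω)
        = cs.wordProd ω := by
      simp [mul_assoc]
    rw [e] at this
    exact absurd hj (by unfold IsLeftDescent; omega)
  have hc : (cs.rightInvSeq (j :: κ)).count t = 1 := by
    rw [rightInvSeq, List.count_cons, List.count_eq_zero_of_not_mem hnot, ← hκw, ht]
    simp [mul_assoc]
  have hpar := count_parity cs hprod t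
  rw [hc] at hpar
  by_contra hmem
  rw [List.count_eq_zero_of_not_mem hmem] at hpar
  exact absurd hpar (by decide)

theorem ris_append (ω ξ : List B) {t : W} (h : t ∈ cs.rightInvSeq (ω ++ ξ)) :
    cs.wordProd ξ * t * (cs.wordProd ξ)⁻¹ ∈ cs.rightInvSeq ω ∨ t ∈ cs.rightInvSeq ξ := by
  induction ω with
  | nil => right; simpa using h
  | cons i ω ih =>
    rw [List.cons_append, rightInvSeq, List.mem_cons] at h
    rcases h with h | h
    · left
      rw [rightInvSeq, List.mem_cons]
      left
      rw [h, wordProd_append]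
      group
    · rcases ih h with h | h
      · left; rw [rightInvSeq]; exact List.mem_cons_of_mem _ h
      · right; exact h

/-- Two distinct left descents `i`, `j` allow to split off alternating words. -/
theorem split_alt {w : W} {i j : B} (hij : i ≠ j) (hi : cs.IsLeftDescent w i)
    (hj : cs.IsLeftDescent w j) (k : ℕ) (hk : M i j = 0 ∨ k ≤ M i j) :
    ∃ x : W, w = cs.wordProd (alternatingWord i j k) * x ∧ cs.length w = k + cs.length x := by
  induction k with
  | zero => exact ⟨w, by simp [alternatingWord]⟩
  | succ k ih =>
    obtain ⟨x, hx, hl⟩ := ih (by omega)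
    obtain ⟨ξ, hξ, rfl⟩ := cs.exists_isReduced x
    set c := if Even k then j else i with hc
    have hcd : cs.IsLeftDescent w c := by rw [hc]; split_ifs <;> assumption
    set a := cs.wordProd (alternatingWord i j k) with ha
    have hw : w = cs.wordProd (alternatingWord i j k ++ ξ) := by rw [wordProd_append, ← ha, hx]
    have hmem := exchange cs (ω := alternatingWord i j k ++ ξ) (j := c) (hw ▸ hcd)
    rw [← hw] at hmem
    have hsucc : cs.wordProd (alternatingWord i j (k + 1)) = cs.simple c * a := by
      rw [alternatingWord_succ', wordProd_cons]
    rcases ris_append cs _ _ hmem with h | h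
    · exfalso
      have e : cs.wordProd ξ * (w⁻¹ * cs.simple c * w) * (cs.wordProd ξ)⁻¹
          = cs.simple j * (cs.simple i * cs.simple j) ^ k := by
        rw [← alt_conj, hsucc, ← ha, hx]; group
      rw [e, ris_alt, List.mem_reverse, List.mem_map] at h
      obtain ⟨p, hp, hpe⟩ := h
      rw [List.mem_range] at hp
      have hpe := mul_left_cancel hpe
      refine simple_pow_ne cs hij (p := k - p) (by omega) (by omega) ?_
      have : (cs.simple i * cs.simple j) ^ k =
          (cs.simple i * cs.simple j) ^ p * (cs.simple i * cs.simple j) ^ (k - p) := by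
        rw [← pow_add]; congr 1; omega
      rw [← hpe] at this
      exact (mul_eq_left.mp this.symm)
    · obtain ⟨n, hn, hne⟩ := List.mem_iff_getElem.mp h
      have h1 := cs.wordProd_mul_getD_rightInvSeq ξ n
      rw [List.getD_eq_getElem _ _ hn, hne] at h1
      have hn' : n < ξ.length := by simpa using hn
      have hw2 : w = cs.wordProd (alternatingWord i j (k + 1)) * cs.wordProd (ξ.eraseIdx n) := by
        rw [hsucc, ← h1, mul_assoc, ← mul_assoc a, ← hx]
        simp [mul_assoc]
      refine ⟨_, hw2, ?_⟩
      have l1 := cs.length_wordProd_le (ξ.eraseIdx n)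
      rw [List.length_eraseIdx_of_lt hn'] at l1
      have l2 := cs.length_mul_le (cs.wordProd (alternatingWord i j (k + 1)))
        (cs.wordProd (ξ.eraseIdx n))
      rw [← hw2] at l2
      have l3 := cs.length_wordProd_le (alternatingWord i j (k + 1))
      rw [length_alternatingWord] at l3
      have := hξ.eq
      omega

/-! ### Commutation moves -/

theorem CommMove_cons {ω ω' : List B} (i : B) (h : Relation.ReflTransGen (CommMove M) ω ω') :
    Relation.ReflTransGen (CommMove M) (i :: ω) (i :: ω') := by
  induction h with
  | refl => exact .refl
  | tail _ hm ih =>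
    refine ih.tail ?_
    obtain ⟨l₁, l₂, a, b, hab, rfl, rfl⟩ := hm
    exact ⟨i :: l₁, l₂, a, b, hab, by simp, by simp⟩

theorem FC_tail {i : B} {α : List B} (hred : cs.IsReduced (i :: α))
    (h : cs.FC (cs.wordProd (i :: α))) : cs.IsReduced α ∧ cs.FC (cs.wordProd α) := by
  have h1 := hred.eq
  have h2 := cs.length_wordProd_le α
  have h3 := cs.length_mul_le (cs.simple i) (cs.wordProd α)
  rw [wordProd_cons, List.length_cons] at h1
  rw [cs.length_simple] at h3
  refine ⟨by unfold CoxeterSystem.IsReduced; omega, ?_⟩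
  rintro ⟨x₁, x₂, a, b, hab, hw, hl⟩
  apply h
  have e : cs.wordProd (i :: α) =
      cs.simple i * x₁ * cs.wordProd (CoxeterSystem.braidWord M a b) * x₂ := by
    rw [wordProd_cons, hw]; group
  refine ⟨cs.simple i * x₁, x₂, a, b, hab, e, ?_⟩
  have l1 := cs.length_mul_le (cs.simple i) x₁
  rw [cs.length_simple] at l1
  have l2 := cs.length_mul_le (cs.simple i * x₁ * cs.wordProd (CoxeterSystem.braidWord M a b)) x₂
  have l3 := cs.length_mul_le (cs.simple i * x₁) (cs.wordProd (CoxeterSystem.braidWord M a b))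
  have l4 := cs.length_wordProd_le (CoxeterSystem.braidWord M a b)
  rw [length_alternatingWord] at l4
  rw [← e] at l2
  rw [wordProd_cons] at l2 ⊢
  omega

theorem leftDescent_cons {i : B} {α : List B} (hred : cs.IsReduced (i :: α)) :
    cs.IsLeftDescent (cs.wordProd (i :: α)) i := by
  have h1 := hred.eq
  have h2 := cs.length_wordProd_le α
  unfold IsLeftDescent
  rw [h1, wordProd_cons, simple_mul_simple_cancel_left, List.length_cons]
  omega

theorem forward (n : ℕ) : ∀ ω ω' : List B, ω.length = n → cs.IsReduced ω → cs.IsReduced ω' →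
    cs.wordProd ω = cs.wordProd ω' → cs.FC (cs.wordProd ω) →
    Relation.ReflTransGen (CommMove M) ω ω' := by
  induction n with
  | zero =>
    intro ω ω' hn hω hω' he _
    have : ω'.length = 0 := by rw [← hω'.eq, ← he, hω.eq, hn]
    rw [List.length_eq_zero_iff] at this hn
    rw [this, hn]
  | succ n ih =>
    intro ω ω' hn hω hω' he hfc
    have hn' : ω'.length = n + 1 := by rw [← hω'.eq, ← he, hω.eq, hn]
    obtain ⟨i, α, rfl⟩ := List.exists_cons_of_length_eq_add_one hn
    obtain ⟨j, β, rfl⟩ := List.exists_cons_of_length_eq_add_one hn'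
    rw [List.length_cons, Nat.add_right_cancel_iff] at hn hn'
    obtain ⟨hα, hαf⟩ := FC_tail cs hω hfc
    obtain ⟨hβ, hβf⟩ := FC_tail cs hω' (he ▸ hfc)
    by_cases hij : i = j
    · subst hij
      refine CommMove_cons i (ih α β hn hα hβ ?_ hαf)
      rw [wordProd_cons, wordProd_cons] at he
      exact mul_left_cancel he
    have di := leftDescent_cons cs hω
    have dj : cs.IsLeftDescent (cs.wordProd (i :: α)) j := he ▸ leftDescent_cons cs hω'
    have h0 : M i j ≠ 0 := by
      intro h0
      obtain ⟨x, _, hl⟩ := split_alt cs hij di dj (cs.length (cs.wordProd (i :: α)) + 1) (.inl h0)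
      omega
    obtain ⟨x, hx, hl⟩ := split_alt cs hij di dj (M i j) (.inr le_rfl)
    have h1 : M i j ≠ 1 := M.off_diagonal i j hij
    have h2 : M i j = 2 := by
      by_contra h2
      exact hfc ⟨1, x, i, j, by omega, by simpa using hx, by simpa using hl⟩
    have h2' : M j i = 2 := by rw [M.symmetric, h2]
    obtain ⟨ξ, hξ, rfl⟩ := cs.exists_isReduced x
    rw [h2] at hx hl
    have hcomm : cs.simple i * cs.simple j = cs.simple j * cs.simple i := by
      have := cs.wordProd_braidWord_eq i j
      unfold braidWord at this
      rw [h2, h2'] at this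
      simpa [alternatingWord, wordProd] using this
    have hx1 : cs.wordProd (i :: α) = cs.simple i * (cs.simple j * cs.wordProd ξ) := by
      rw [hx]; simp [alternatingWord, wordProd, mul_assoc]
    have hx2 : cs.wordProd (i :: α) = cs.simple j * (cs.simple i * cs.wordProd ξ) := by
      rw [hx1, ← mul_assoc, hcomm, mul_assoc]
    have eα : cs.wordProd α = cs.wordProd (j :: ξ) := by
      rw [wordProd_cons] at hx1 ⊢
      exact mul_left_cancel hx1
    have eβ : cs.wordProd (i :: ξ) = cs.wordProd β := by
      rw [he, wordProd_cons] at hx2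
      rw [wordProd_cons]
      exact (mul_left_cancel hx2).symm
    have hlen : ξ.length + 1 = n := by
      rw [hω.eq, List.length_cons, hξ.eq] at hl; omega
    have rj : cs.IsReduced (j :: ξ) := by
      unfold CoxeterSystem.IsReduced; rw [← eα, hα.eq, List.length_cons]; omega
    have ri : cs.IsReduced (i :: ξ) := by
      unfold CoxeterSystem.IsReduced; rw [eβ, hβ.eq, List.length_cons]; omega
    have s1 := CommMove_cons i (ih α (j :: ξ) hn hα rj eα hαf)
    have s2 := CommMove_cons j (ih (i :: ξ) β (by simpa using hlen) ri hβ eβ (eβ ▸ hβf))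
    exact (s1.tail ⟨[], ξ, i, j, h2, by simp, by simp⟩).trans s2

open Classical in
theorem filter_invariant {i j : B} (h3 : 3 ≤ M i j) {ω ω' : List B}
    (h : Relation.ReflTransGen (CommMove M) ω ω') :
    ω.filter (fun b => b = i ∨ b = j) = ω'.filter (fun b => b = i ∨ b = j) := by
  induction h with
  | refl => rfl
  | tail _ hm ih =>
    rw [ih]
    obtain ⟨l₁, l₂, a, b, hab, rfl, rfl⟩ := hm
    simp only [List.filter_append]
    congr 2
    have hij : ¬ (M i j = 2) := by omega
    have hji : ¬ (M j i = 2) := by rw [M.symmetric]; exact hij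
    have hd : ∀ c, M c c = 1 := M.diagonal
    by_cases ha : a = i ∨ a = j <;> by_cases hb : b = i ∨ b = j
    · exfalso
      rcases ha with rfl | rfl <;> rcases hb with rfl | rfl <;> simp_all
    all_goals simp [List.filter_cons, ha, hb]

theorem backward {w : W} (h : ∀ ω ω' : List B, cs.IsReduced ω → cs.wordProd ω = w →
      cs.IsReduced ω' → cs.wordProd ω' = w →
      Relation.ReflTransGen (CommMove M) ω ω') : cs.FC w := by
  classical
  rintro ⟨x₁, x₂, i, j, h3, hw, hl⟩
  obtain ⟨α, hα, rfl⟩ := cs.exists_isReduced x₁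
  obtain ⟨β, hβ, rfl⟩ := cs.exists_isReduced x₂
  rw [hα.eq, hβ.eq] at hl
  have p1 : cs.wordProd (α ++ braidWord M i j ++ β) = w := by
    rw [wordProd_append, wordProd_append, hw]
  have p2 : cs.wordProd (α ++ braidWord M j i ++ β) = w := by
    rw [wordProd_append, wordProd_append, hw, wordProd_braidWord_eq]
  have hs : M j i = M i j := M.symmetric j i
  have r1 : cs.IsReduced (α ++ braidWord M i j ++ β) := by
    unfold CoxeterSystem.IsReduced; rw [p1, hl]; simp [add_assoc]
  have r2 : cs.IsReduced (α ++ braidWord M j i ++ β) := by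
    unfold CoxeterSystem.IsReduced; rw [p2, hl]; simp [hs, add_assoc]
  have key := filter_invariant h3 (h _ _ r1 p1 r2 p2)
  simp only [List.filter_append, List.append_cancel_right_eq, List.append_cancel_left_eq] at key
  have hall : ∀ (n : ℕ) (a b : B), (a = i ∨ a = j) → (b = i ∨ b = j) →
      (alternatingWord a b n).filter (fun b => b = i ∨ b = j) = alternatingWord a b n := by
    intro n
    induction n with
    | zero => intros; simp [alternatingWord]
    | succ n ih =>
      intro a b ha hb
      rw [alternatingWord_succ, List.concat_eq_append, List.filter_append, ih b a hb ha]
      simp [hb]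
  unfold braidWord at key
  rw [hall _ _ _ (.inl rfl) (.inr rfl), hall _ _ _ (.inr rfl) (.inl rfl), hs] at key
  obtain ⟨m, hm⟩ : ∃ m, M i j = m + 1 := ⟨M i j - 1, by omega⟩
  rw [hm, alternatingWord_succ, alternatingWord_succ, List.concat_eq_append,
    List.concat_eq_append] at key
  have := (List.append_inj' key rfl).2
  simp at this
  subst this
  rw [M.diagonal] at h3
  omega

end FCProof

/-- An element `w` of a Coxeter group is fully commutative (not complex) if and only if every
reduced expression for `w` can be transformed into any other reduced expression for `w` by a
sequence of commutation moves. -/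
theorem fullyCommutative_iff_comm_equiv {M : CoxeterMatrix B} (cs : CoxeterSystem M W) (w : W) :
    cs.FC w ↔ ∀ ω ω' : List B, cs.IsReduced ω → cs.wordProd ω = w →
      cs.IsReduced ω' → cs.wordProd ω' = w →
      Relation.ReflTransGen (CommMove M) ω ω' := by
  constructor
  · intro hfc ω ω' hω hw hω' hw'
    exact FCProof.forward cs _ ω ω' rfl hω hω' (hw.trans hw'.symm) (hw ▸ hfc)
  · exact FCProof.backward cs
end
end

section
/- Let W be a Coxeter group of type A or B, let w ∈ W_c be fully commutative, and let s ∈ S satisfy ws ∉ W_c. Then there exists a unique s' ∈ S such that any reduced expression for w can be parsed either as (i) w = w_1 s w_2 s' w_3, where ss' has order 3 and s commutes with every generator in c(w_2) ∪ c(w_3), or as (ii) w = w_1 s' w_2 s w_3 s' w_4, where ss' has order 4, s commutes with every generator in c(w_3) ∪ c(w_4), and s' commutes with every generator in c(w_2) ∪ c(w_3). -/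
open CoxeterSystem LaurentPolynomial

noncomputable section

variable {B : Type*} {W : Type*} [Group W]

namespace FCParse

variable {M : CoxeterMatrix B} (cs : CoxeterSystem M W)

/-! ### The reflection cocycle -/

section Cocycle

theorem end_mul_apply {α : Type*} (f g : Function.End α) (x : α) : (f * g) x = f (g x) := rfl

open Classical in
/-- The involution of `W × ZMod 2` attached to a simple reflection. -/
def act (i : B) : Function.End (W × ZMod 2) := fun p =>
  (cs.simple i * p.1 * cs.simple i, p.2 + if p.1 = cs.simple i then 1 else 0)

theorem simple_mul_pow (i j : B) (k : ℕ) :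
    cs.simple j * (cs.simple i * cs.simple j) ^ k * cs.simple j
      = ((cs.simple i * cs.simple j) ^ k)⁻¹ := by
  have h : cs.simple j * (cs.simple i * cs.simple j) * (cs.simple j)⁻¹
      = (cs.simple i * cs.simple j)⁻¹ := by
    simp [mul_assoc]
  have : (cs.simple j * (cs.simple i * cs.simple j) * (cs.simple j)⁻¹) ^ k
      = ((cs.simple i * cs.simple j)⁻¹) ^ k := by rw [h]
  rw [conj_pow, inv_simple] at this
  rw [this, inv_pow]

theorem inv_pow_mul_simple (i j : B) (k : ℕ) :
    ((cs.simple i * cs.simple j) ^ k)⁻¹ * cs.simple j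
      = cs.simple j * (cs.simple i * cs.simple j) ^ k := by
  rw [← simple_mul_pow]; simp

open Classical in
theorem act_pow (i j : B) (p : ℕ) (x : W × ZMod 2) :
    ((act cs i * act cs j) ^ p) x =
      ((cs.simple i * cs.simple j) ^ p * x.1 * ((cs.simple i * cs.simple j) ^ p)⁻¹,
        x.2 + ∑ k ∈ Finset.range (2 * p),
          if x.1 = cs.simple j * (cs.simple i * cs.simple j) ^ k then 1 else 0) := by
  induction p with
  | zero => simp [Function.End.one_def]
  | succ p ih =>
    rw [pow_succ' (act cs i * act cs j), end_mul_apply, ih,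
      end_mul_apply]
    have e1 : ∀ t : W, ((cs.simple i * cs.simple j) ^ p * t *
        ((cs.simple i * cs.simple j) ^ p)⁻¹ = cs.simple j) ↔
        t = cs.simple j * (cs.simple i * cs.simple j) ^ (2 * p) := by
      intro t
      have : cs.simple j * (cs.simple i * cs.simple j) ^ (2 * p) =
        ((cs.simple i * cs.simple j) ^ p)⁻¹ * cs.simple j * (cs.simple i * cs.simple j) ^ p := by
        rw [inv_pow_mul_simple, two_mul, pow_add, mul_assoc]
      rw [this, mul_inv_eq_iff_eq_mul, mul_assoc, ← eq_inv_mul_iff_mul_eq]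
    have e2 : ∀ t : W, (cs.simple j * ((cs.simple i * cs.simple j) ^ p * t *
        ((cs.simple i * cs.simple j) ^ p)⁻¹) * cs.simple j = cs.simple i) ↔
        t = cs.simple j * (cs.simple i * cs.simple j) ^ (2 * p + 1) := by
      intro t
      have : cs.simple j * (cs.simple i * cs.simple j) ^ (2 * p + 1) =
        ((cs.simple i * cs.simple j) ^ p)⁻¹ * (cs.simple j * cs.simple i * cs.simple j)
          * (cs.simple i * cs.simple j) ^ p := by
        rw [mul_assoc (cs.simple j), ← mul_assoc _ (cs.simple j), inv_pow_mul_simple, two_mul,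
          pow_succ, pow_add]
        simp only [mul_assoc]
        congr 2
        rw [← mul_assoc (cs.simple i), ← pow_succ, ← pow_succ']
      rw [this]
      constructor
      · intro h
        have h' : (cs.simple i * cs.simple j) ^ p * t * ((cs.simple i * cs.simple j) ^ p)⁻¹ =
            cs.simple j * cs.simple i * cs.simple j := by
          rw [eq_comm] at h
          conv_rhs => rw [mul_assoc, h]
          simp [mul_assoc]
        rw [← h']; simp [mul_assoc]
      · rintro rfl
        simp [mul_assoc]
    ext1
    · simp [act, pow_succ', mul_assoc]
    · simp only [act, e1, e2]
      rw [show 2 * (p + 1) = 2 * p + 1 + 1 by ring, Finset.sum_range_succ, Finset.sum_range_succ]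
      ring

theorem act_liftable : M.IsLiftable (act cs) := by
  classical
  intro i j
  funext x
  rw [act_pow, Function.End.one_def]
  ext1
  · simp
  · have : ∑ k ∈ Finset.range (2 * M i j),
        (if x.1 = cs.simple j * (cs.simple i * cs.simple j) ^ k then (1 : ZMod 2) else 0) = 0 := by
      rw [two_mul, Finset.sum_range_add]
      simp only [pow_add, simple_mul_simple_pow, one_mul]
      exact CharTwo.add_self_eq_zero _
    simp [this]

/-- The reflection action. -/
def Act : W →* Function.End (W × ZMod 2) := cs.lift ⟨act cs, act_liftable cs⟩

theorem Act_simple (i : B) : Act cs (cs.simple i) = act cs i := cs.lift_apply_simple _ i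

open Classical in
theorem Act_word (ω : List B) (x : W × ZMod 2) :
    Act cs (cs.wordProd ω) x =
      (cs.wordProd ω * x.1 * (cs.wordProd ω)⁻¹, x.2 + ((cs.rightInvSeq ω).count x.1 : ZMod 2)) := by
  induction ω with
  | nil => simp [Function.End.one_def]
  | cons i ω ih =>
    rw [wordProd_cons, map_mul, end_mul_apply, ih, Act_simple]
    have e : (cs.wordProd ω * x.1 * (cs.wordProd ω)⁻¹ = cs.simple i) ↔
        ((cs.wordProd ω)⁻¹ * cs.simple i * cs.wordProd ω = x.1) := by
      constructor
      · intro h; rw [← h]; simp [mul_assoc]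
      · intro h; rw [← h]; simp [mul_assoc]
    ext1
    · simp [act, mul_assoc]
    · simp only [act, e, rightInvSeq, List.count_cons, beq_iff_eq]
      push_cast
      ring

/-- Parity of the multiplicity of `t` in an inversion sequence of `w`. -/
def eta (w t : W) : ZMod 2 := (Act cs w (t, 0)).2

open Classical in
theorem eta_word (ω : List B) (t : W) :
    eta cs (cs.wordProd ω) t = ((cs.rightInvSeq ω).count t : ZMod 2) := by
  simp [eta, Act_word]

theorem eta_mul (x y t : W) : eta cs (x * y) t = eta cs y t + eta cs x (y * t * y⁻¹) := by
  classical
  obtain ⟨ω, rfl⟩ := cs.wordProd_surjective x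
  obtain ⟨ω', rfl⟩ := cs.wordProd_surjective y
  simp [eta, Act_word, map_mul, end_mul_apply]

theorem lt_of_eta_ne (w t : W) (h : eta cs w t ≠ 0) : cs.length (w * t) < cs.length w := by
  classical
  obtain ⟨ω, h1, rfl⟩ := cs.exists_isReduced w
  rw [eta_word] at h
  have : t ∈ cs.rightInvSeq ω := by
    by_contra hh
    exact h (by simp [List.count_eq_zero_of_not_mem hh])
  exact (cs.isRightInversion_of_mem_rightInvSeq h1 this).2

theorem eta_simple_self (i : B) : eta cs (cs.simple i) (cs.simple i) = 1 := by
  simp [eta, Act_simple, act]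

theorem eta_ne_of_lt (w : W) (i : B) (h : cs.length (w * cs.simple i) < cs.length w) :
    eta cs w (cs.simple i) ≠ 0 := by
  intro h0
  have h1 := eta_mul cs w (cs.simple i) (cs.simple i)
  simp only [eta_simple_self, inv_simple, simple_mul_simple_cancel_right, h0] at h1
  have := lt_of_eta_ne cs (w * cs.simple i) (cs.simple i) (by rw [h1]; simp)
  simp at this
  omega

end Cocycle

/-! ### Rank two parabolic subgroups -/

section RankTwo


theorem mem_ris_alternatingWord (i j : B) (m : ℕ) (x : W)
    (hx : x ∈ cs.rightInvSeq (alternatingWord i j m)) :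
    ∃ k < m, x = cs.simple j * (cs.simple i * cs.simple j) ^ k := by
  induction m with
  | zero => simp [alternatingWord] at hx
  | succ m ih =>
    rw [alternatingWord_succ', rightInvSeq, List.mem_cons] at hx
    rcases hx with hx | hx
    · refine ⟨m, by omega, ?_⟩
      rw [hx, prod_alternatingWord_eq_mul_pow]
      rcases Nat.even_or_odd' m with ⟨q, rfl | rfl⟩
      · simp only [even_two, Even.mul_right, if_true, one_mul]
        rw [show 2 * q / 2 = q by omega, inv_pow_mul_simple, mul_assoc, ← pow_add, two_mul]
      · have h1 : ¬ Even (2 * q + 1) := by simp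
        simp only [h1, if_false]
        rw [show (2 * q + 1) / 2 = q by omega, mul_inv_rev, inv_simple, inv_pow_mul_simple,
          mul_assoc, mul_assoc, ← mul_assoc (cs.simple i), ← pow_succ', ← pow_add]
        congr 2
        omega
    · obtain ⟨k, hk, h⟩ := ih hx
      exact ⟨k, by omega, h⟩

theorem eta_alternatingWord
    (hord : ∀ i j : B, i ≠ j → 2 ≤ M i j ∧
      ∀ k, 0 < k → k < M i j → (cs.simple i * cs.simple j) ^ k ≠ 1)
    (i j : B) (hij : i ≠ j) (m : ℕ) (hm : m < M i j) :
    eta cs (cs.wordProd (alternatingWord i j m)) (cs.simple i) = 0 := by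
  classical
  rw [eta_word, List.count_eq_zero_of_not_mem, Nat.cast_zero]
  intro hmem
  obtain ⟨k, hk, h⟩ := mem_ris_alternatingWord cs i j m _ hmem
  refine (hord i j hij).2 (k + 1) (by omega) (by omega) ?_
  have : cs.simple j * cs.simple i = (cs.simple i * cs.simple j) ^ k := by
    conv_lhs => rw [h]
    simp
  rw [pow_succ', ← this]
  simp [mul_assoc]

theorem alternatingWord_mul (i j : B) (m : ℕ) :
    cs.wordProd (alternatingWord i j m) * cs.simple i =
      cs.wordProd (alternatingWord j i (m + 1)) := by
  rw [alternatingWord_succ, wordProd_concat]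

theorem alternatingWord_mul' (i j : B) (m : ℕ) :
    cs.wordProd (alternatingWord i j (m + 1)) * cs.simple j =
      cs.wordProd (alternatingWord j i m) := by
  rw [alternatingWord_succ, wordProd_concat]; simp

/-- The parabolic subgroup generated by two simple reflections. -/
def para (i j : B) : Subgroup W := Subgroup.closure {cs.simple i, cs.simple j}

theorem simple_left_mem (i j : B) : cs.simple i ∈ para cs i j :=
  Subgroup.subset_closure (by simp)

theorem simple_right_mem (i j : B) : cs.simple j ∈ para cs i j :=
  Subgroup.subset_closure (by simp)

theorem para_comm (i j : B) : para cs i j = para cs j i := by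
  rw [para, para, Set.pair_comm]

theorem alternatingWord_mem (i j : B) (m : ℕ) :
    cs.wordProd (alternatingWord i j m) ∈ para cs i j := by
  induction m generalizing i j with
  | zero => simp [alternatingWord]
  | succ m ih =>
    rw [← alternatingWord_mul]
    exact mul_mem (para_comm cs i j ▸ ih j i) (simple_right_mem cs i j)

theorem mem_para_step (i j : B) (hM : 2 ≤ M i j) (h : W)
    (hh : ∃ m ≤ M i j, h = cs.wordProd (alternatingWord i j m) ∨
      h = cs.wordProd (alternatingWord j i m)) :
    ∃ m ≤ M i j, h * cs.simple i = cs.wordProd (alternatingWord i j m) ∨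
      h * cs.simple i = cs.wordProd (alternatingWord j i m) := by
  obtain ⟨m, hm, rfl | rfl⟩ := hh
  · rcases hm.lt_or_eq with hlt | rfl
    · exact ⟨m + 1, hlt, Or.inr (alternatingWord_mul cs i j m)⟩
    · refine ⟨M i j - 1, by omega, Or.inl ?_⟩
      have := cs.wordProd_braidWord_eq i j
      rw [braidWord, braidWord, ← M.symmetric i j] at this
      rw [this]
      obtain ⟨k, hk⟩ : ∃ k, M i j = k + 1 := ⟨M i j - 1, by omega⟩
      rw [hk, alternatingWord_mul']; rfl
  · rcases m with _ | m
    · exact ⟨1, by omega, Or.inr (by simp [alternatingWord])⟩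
    · exact ⟨m, by omega, Or.inl (alternatingWord_mul' cs j i m)⟩

theorem mem_para (i j : B) (hM : 2 ≤ M i j) (h : W) (hh : h ∈ para cs i j) :
    ∃ m ≤ M i j, h = cs.wordProd (alternatingWord i j m) ∨
      h = cs.wordProd (alternatingWord j i m) := by
  have key : ∀ h : W, ∀ y ∈ ({cs.simple i, cs.simple j} : Set W),
      (∃ m ≤ M i j, h = cs.wordProd (alternatingWord i j m) ∨
      h = cs.wordProd (alternatingWord j i m)) →
      (∃ m ≤ M i j, h * y = cs.wordProd (alternatingWord i j m) ∨
      h * y = cs.wordProd (alternatingWord j i m)) := by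
    rintro h y (rfl | rfl) hh
    · exact mem_para_step cs i j hM h hh
    · rw [M.symmetric i j] at hM hh ⊢
      obtain ⟨m, h1, h2⟩ := mem_para_step cs j i hM h (by simpa only [or_comm] using hh)
      exact ⟨m, h1, h2.symm⟩
  induction hh using Subgroup.closure_induction_right with
  | one => exact ⟨0, by omega, Or.inl (by simp [alternatingWord])⟩
  | mul_right x _ y hy ih => exact key x y hy ih
  | mul_inv_cancel x _ y hy ih =>
    have : y⁻¹ = y := by
      rcases hy with rfl | rfl <;> simp
    rw [this]
    exact key x y hy ih

theorem length_mul_alternatingWord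
    (hord : ∀ i j : B, i ≠ j → 2 ≤ M i j ∧
      ∀ k, 0 < k → k < M i j → (cs.simple i * cs.simple j) ^ k ≠ 1)
    (i j : B) (hij : i ≠ j) (z : W)
    (hz : ∀ h ∈ para cs i j, cs.length z ≤ cs.length (z * h)) (m : ℕ) (hm : m ≤ M i j) :
    cs.length (z * cs.wordProd (alternatingWord i j m)) = cs.length z + m := by
  induction m generalizing i j with
  | zero => simp [alternatingWord]
  | succ m ih =>
    have hlen := ih j i hij.symm (by rw [para_comm]; exact hz) (by rw [M.symmetric]; omega)
    rw [← alternatingWord_mul, ← mul_assoc]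
    rcases cs.length_mul_simple (z * cs.wordProd (alternatingWord j i m)) j with h | h
    · omega
    · exfalso
      have h1 := eta_ne_of_lt cs _ j (by omega : cs.length
        (z * cs.wordProd (alternatingWord j i m) * cs.simple j) < _)
      rw [eta_mul, eta_alternatingWord cs hord j i hij.symm m (by rw [M.symmetric]; omega),
        zero_add] at h1
      have h2 := lt_of_eta_ne cs _ _ h1
      have hv : cs.wordProd (alternatingWord j i m) ∈ para cs i j :=
        para_comm cs i j ▸ alternatingWord_mem cs j i m
      have h3 := hz _ (mul_mem (mul_mem hv (simple_right_mem cs i j)) (inv_mem hv))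
      omega

/-- An element with two distinct right descents is right divisible by a braid word. -/
theorem exists_braid
    (hord : ∀ i j : B, i ≠ j → 2 ≤ M i j ∧
      ∀ k, 0 < k → k < M i j → (cs.simple i * cs.simple j) ^ k ≠ 1)
    (i j : B) (hij : i ≠ j) (y : W) (hi : cs.IsRightDescent y i)
    (hj : cs.IsRightDescent y j) :
    ∃ z, y = z * cs.wordProd (braidWord M i j) ∧ cs.length y = cs.length z + M i j := by
  classical
  have hex : ∃ n, ∃ h ∈ para cs i j, cs.length (y * h) = n := ⟨_, 1, one_mem _, rfl⟩
  obtain ⟨h, hh, hn⟩ := Nat.find_spec hex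
  have hmin : ∀ h' ∈ para cs i j, cs.length (y * h) ≤ cs.length (y * h * h') := by
    intro h' hh'
    rw [hn, mul_assoc]
    exact Nat.find_min' hex ⟨_, mul_mem hh hh', rfl⟩
  generalize hz : y * h = z at hmin
  have hy : y = z * h⁻¹ := by rw [← hz]; simp
  have h2 := (hord i j hij).1
  obtain ⟨m, hm, hv⟩ := mem_para cs i j h2 _ (inv_mem hh)
  have L1 := length_mul_alternatingWord cs hord i j hij z hmin
  have L2 := length_mul_alternatingWord cs hord j i hij.symm z (by rw [para_comm]; exact hmin)
  rw [M.symmetric j i] at L2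
  unfold IsRightDescent at hi hj
  rcases hm.lt_or_eq with hlt | rfl
  · exfalso
    rcases hv with hv | hv
    · rw [hy, hv, mul_assoc, alternatingWord_mul, L1 m hm, L2 (m + 1) hlt] at hi
      omega
    · rw [hy, hv, mul_assoc, alternatingWord_mul, L2 m hm, L1 (m + 1) hlt] at hj
      omega
  · have hb := cs.wordProd_braidWord_eq i j
    have hv' : h⁻¹ = cs.wordProd (braidWord M i j) := by
      rcases hv with hv | hv
      · exact hv
      · rw [hb, braidWord, M.symmetric j i]; exact hv
    refine ⟨z, by rw [hy, hv'], ?_⟩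
    rw [hy, hv']
    exact L1 _ le_rfl

end RankTwo

/-! ### An integral reflection representation -/

section Rep

set_option linter.unusedSimpArgs false

/-- The reflection attached to a linear form and a vector. -/
def refl {V : Type*} [AddCommGroup V] (f : V →ₗ[ℤ] ℤ) (e : V) : Module.End ℤ V :=
  LinearMap.id - f.smulRight e

theorem refl_apply {V : Type*} [AddCommGroup V] (f : V →ₗ[ℤ] ℤ) (e x : V) :
    refl f e x = x - f x • e := by
  simp [refl]

theorem refl_refl {V : Type*} [AddCommGroup V] (f : V →ₗ[ℤ] ℤ) (e : V) (h : f e = 2) :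
    refl f e * refl f e = 1 := by
  ext x
  simp only [Module.End.mul_apply, refl_apply, map_sub, map_smul, h, smul_eq_mul,
    Module.End.one_apply]
  module

theorem refl_two {V : Type*} [AddCommGroup V] (f g : V →ₗ[ℤ] ℤ) (e e' : V) (h : f e = 2)
    (h' : g e' = 2) (hc : f e' = 0) (hd : g e = 0) : (refl f e * refl g e') ^ 2 = 1 := by
  ext x
  simp only [pow_succ, pow_zero, one_mul, Module.End.mul_apply, refl_apply, map_sub, map_smul, h,
    h', hc, hd, smul_eq_mul, Module.End.one_apply]
  module

theorem refl_three {V : Type*} [AddCommGroup V] (f g : V →ₗ[ℤ] ℤ) (e e' : V) (h : f e = 2)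
    (h' : g e' = 2) (hc : f e' = -1) (hd : g e = -1) : (refl f e * refl g e') ^ 3 = 1 := by
  ext x
  simp only [pow_succ, pow_zero, one_mul, Module.End.mul_apply, refl_apply, map_sub, map_smul, h,
    h', hc, hd, smul_eq_mul, Module.End.one_apply]
  module

theorem refl_four {V : Type*} [AddCommGroup V] (f g : V →ₗ[ℤ] ℤ) (e e' : V) (h : f e = 2)
    (h' : g e' = 2) (hcd : (f e' = -1 ∧ g e = -2) ∨ (f e' = -2 ∧ g e = -1)) :
    (refl f e * refl g e') ^ 4 = 1 := by
  rcases hcd with ⟨hc, hd⟩ | ⟨hc, hd⟩ <;> ext x <;>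
  simp only [pow_succ, pow_zero, one_mul, Module.End.mul_apply, refl_apply, map_sub, map_smul, h,
    h', hc, hd, smul_eq_mul, Module.End.one_apply] <;>
  module

variable {n : ℕ} {N : CoxeterMatrix (Fin n)} (ds : CoxeterSystem N W)

/-- An integral Cartan matrix. -/
def cart (N : CoxeterMatrix (Fin n)) (i j : Fin n) : ℤ :=
  if i = j then 2 else if N i j = 2 then 0 else if N i j = 3 then -1 else if i < j then -2 else -1

/-- Simple coroots. -/
def coroot (N : CoxeterMatrix (Fin n)) (i : Fin n) : (Fin n → ℤ) →ₗ[ℤ] ℤ :=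
  ∑ j, cart N i j • LinearMap.proj j

theorem coroot_single (i j : Fin n) : coroot N i (Pi.single j 1) = cart N i j := by
  simp [coroot, Pi.single_apply]

theorem coroot_self (i : Fin n) : coroot N i (Pi.single i 1) = 2 := by
  simp [coroot_single, cart]

/-- Simple reflections of the integral representation. -/
def rho (N : CoxeterMatrix (Fin n)) (i : Fin n) : Module.End ℤ (Fin n → ℤ) :=
  refl (coroot N i) (Pi.single i 1)

theorem cart_cases (hN : ∀ i j, i ≠ j → N i j = 2 ∨ N i j = 3 ∨ N i j = 4) (i j : Fin n)
    (hij : i ≠ j) :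
    (N i j = 2 ∧ cart N i j = 0 ∧ cart N j i = 0) ∨
    (N i j = 3 ∧ cart N i j = -1 ∧ cart N j i = -1) ∨
    (N i j = 4 ∧ ((cart N i j = -1 ∧ cart N j i = -2) ∨ (cart N i j = -2 ∧ cart N j i = -1))) := by
  have hs := N.symmetric i j
  unfold cart
  rcases hN i j hij with h | h | h
  · simp [← hs, h, hij, hij.symm]
  · simp [← hs, h, hij, hij.symm]
  · rcases lt_or_gt_of_ne hij with h' | h'
    · simp [← hs, h, hij, hij.symm, h', h'.le]
    · simp [← hs, h, hij, hij.symm, h', h'.le]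

theorem rho_liftable (hN : ∀ i j, i ≠ j → N i j = 2 ∨ N i j = 3 ∨ N i j = 4) :
    N.IsLiftable (rho N) := by
  intro i j
  by_cases hij : i = j
  · subst hij
    rw [N.diagonal, pow_one]
    exact refl_refl _ _ (coroot_self i)
  · rcases cart_cases hN i j hij with ⟨h, h1, h2⟩ | ⟨h, h1, h2⟩ | ⟨h, h1⟩
    · rw [h]
      exact refl_two _ _ _ _ (coroot_self i) (coroot_self j) (by rwa [coroot_single])
        (by rwa [coroot_single])
    · rw [h]
      exact refl_three _ _ _ _ (coroot_self i) (coroot_self j) (by rwa [coroot_single])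
        (by rwa [coroot_single])
    · rw [h]
      exact refl_four _ _ _ _ (coroot_self i) (coroot_self j) (by simpa only [coroot_single])

theorem order_exact (hN : ∀ i j, i ≠ j → N i j = 2 ∨ N i j = 3 ∨ N i j = 4) (i j : Fin n)
    (hij : i ≠ j) :
    2 ≤ N i j ∧ ∀ k, 0 < k → k < N i j → (ds.simple i * ds.simple j) ^ k ≠ 1 := by
  refine ⟨by rcases hN i j hij with h | h | h <;> omega, ?_⟩
  intro k hk0 hk h1
  have h2 := congrArg (ds.lift ⟨rho N, rho_liftable hN⟩) h1
  rw [map_pow, map_mul, lift_apply_simple, lift_apply_simple, map_one] at h2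
  have h3 := congrFun (congrArg DFunLike.coe h2) (Pi.single i 1)
  have h4 := congrFun h3 i
  have h5 := congrFun h3 j
  have hs := coroot_self (N := N) i
  have hs' := coroot_self (N := N) j
  have hc := coroot_single (N := N) i j
  have hd := coroot_single (N := N) j i
  rcases cart_cases hN i j hij with ⟨h, e1, e2⟩ | ⟨h, e1, e2⟩ | ⟨h, ⟨e1, e2⟩ | ⟨e1, e2⟩⟩ <;>
  rw [e1] at hc <;> rw [e2] at hd <;> rw [h] at hk <;> interval_cases k <;>
  simp only [pow_succ, pow_zero, one_mul, Module.End.mul_apply, Module.End.one_apply, rho,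
    refl_apply, map_sub, map_smul, smul_eq_mul, hs, hs', hc, hd, Pi.sub_apply, Pi.smul_apply,
    Pi.single_eq_same, Pi.single_eq_of_ne hij, Pi.single_eq_of_ne hij.symm] at h4 h5 <;>
  omega

end Rep

/-! ### Parsing automata -/

section Automata

variable [DecidableEq B]

/-- Automaton reading a word from the right, looking for pattern (i). -/
def step3 (M : CoxeterMatrix B) (s s' : B) (j : B) (q : ℕ) : ℕ :=
  if q = 0 then (if j = s' then 1 else if M s j = 2 then 0 else 3)
  else if q = 1 then (if j = s then 2 else if M s j = 2 then 1 else 3)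
  else q

/-- Automaton reading a word from the right, looking for pattern (ii). -/
def step4 (M : CoxeterMatrix B) (s s' : B) (j : B) (q : ℕ) : ℕ :=
  if q = 0 then (if j = s' then 1 else if M s j = 2 then 0 else 4)
  else if q = 1 then (if j = s then 2 else if M s j = 2 ∧ M s' j = 2 then 1 else 4)
  else if q = 2 then (if j = s' then 3 else if M s' j = 2 then 2 else 4)
  else q

theorem step3_comm (s s' i j : B) (hs : M s s' = 3) (hij : M i j = 2) (q : ℕ) :
    step3 M s s' i (step3 M s s' j q) = step3 M s s' j (step3 M s s' i q) := by
  have h1 := M.symmetric i j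
  have h2 := M.symmetric s s'
  have h3 := M.diagonal i
  unfold step3
  grind

theorem step4_comm (s s' i j : B) (hs : M s s' = 4) (hij : M i j = 2) (q : ℕ) :
    step4 M s s' i (step4 M s s' j q) = step4 M s s' j (step4 M s s' i q) := by
  have h1 := M.symmetric i j
  have h2 := M.symmetric s s'
  have h3 := M.diagonal i
  have h4 := M.diagonal s'
  have h5 := M.symmetric s' i
  have h6 := M.symmetric s' j
  have h7 := M.symmetric s i
  have h8 := M.symmetric s j
  by_cases q0 : q = 0
  · subst q0
    simp only [step4]
    grind (splits := 40)
  by_cases q1 : q = 1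
  · subst q1
    simp only [step4]
    grind (splits := 40)
  by_cases q2 : q = 2
  · subst q2
    simp only [step4]
    grind (splits := 40)
  simp [step4, q0, q1, q2]

theorem run3_spec (s s' : B) (ω : List B) :
    (ω.foldr (step3 M s s') 0 = 0 → ∀ j ∈ ω, M s j = 2) ∧
    (ω.foldr (step3 M s s') 0 = 1 → ∃ ω₂ ω₃, ω = ω₂ ++ [s'] ++ ω₃ ∧
      ∀ j ∈ ω₂ ++ ω₃, M s j = 2) ∧
    (ω.foldr (step3 M s s') 0 = 2 → ∃ ω₁ ω₂ ω₃, ω = ω₁ ++ [s] ++ ω₂ ++ [s'] ++ ω₃ ∧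
      ∀ j ∈ ω₂ ++ ω₃, M s j = 2) := by
  induction ω with
  | nil => simp
  | cons a ω ih =>
    obtain ⟨i0, i1, i2⟩ := ih
    rw [List.foldr_cons]
    generalize ω.foldr (step3 M s s') 0 = q at *
    refine ⟨fun h => ?_, fun h => ?_, fun h => ?_⟩
    · have : q = 0 ∧ M s a = 2 := by unfold step3 at h; grind
      have := i0 this.1
      simp_all
    · have : (q = 0 ∧ a = s') ∨ (q = 1 ∧ M s a = 2) := by unfold step3 at h; grind
      rcases this with ⟨hq, rfl⟩ | ⟨hq, ha⟩
      · exact ⟨[], ω, by simp, by simpa using i0 hq⟩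
      · obtain ⟨w2, w3, rfl, hh⟩ := i1 hq
        exact ⟨a :: w2, w3, by simp, by simpa [ha] using hh⟩
    · have : (q = 1 ∧ a = s) ∨ q = 2 := by unfold step3 at h; grind
      rcases this with ⟨hq, rfl⟩ | hq
      · obtain ⟨w2, w3, rfl, hh⟩ := i1 hq
        exact ⟨[], w2, w3, by simp, hh⟩
      · obtain ⟨w1, w2, w3, rfl, hh⟩ := i2 hq
        exact ⟨a :: w1, w2, w3, by simp, hh⟩

theorem run4_spec (s s' : B) (ω : List B) :
    (ω.foldr (step4 M s s') 0 = 0 → ∀ j ∈ ω, M s j = 2) ∧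
    (ω.foldr (step4 M s s') 0 = 1 → ∃ ω₃ ω₄, ω = ω₃ ++ [s'] ++ ω₄ ∧
      (∀ j ∈ ω₃ ++ ω₄, M s j = 2) ∧ ∀ j ∈ ω₃, M s' j = 2) ∧
    (ω.foldr (step4 M s s') 0 = 2 → ∃ ω₂ ω₃ ω₄, ω = ω₂ ++ [s] ++ ω₃ ++ [s'] ++ ω₄ ∧
      (∀ j ∈ ω₃ ++ ω₄, M s j = 2) ∧ ∀ j ∈ ω₂ ++ ω₃, M s' j = 2) ∧
    (ω.foldr (step4 M s s') 0 = 3 → ∃ ω₁ ω₂ ω₃ ω₄,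
      ω = ω₁ ++ [s'] ++ ω₂ ++ [s] ++ ω₃ ++ [s'] ++ ω₄ ∧
      (∀ j ∈ ω₃ ++ ω₄, M s j = 2) ∧ ∀ j ∈ ω₂ ++ ω₃, M s' j = 2) := by
  induction ω with
  | nil => simp
  | cons a ω ih =>
    obtain ⟨i0, i1, i2, i3⟩ := ih
    rw [List.foldr_cons]
    generalize ω.foldr (step4 M s s') 0 = q at *
    refine ⟨fun h => ?_, fun h => ?_, fun h => ?_, fun h => ?_⟩
    · have : q = 0 ∧ M s a = 2 := by unfold step4 at h; grind
      have := i0 this.1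
      simp_all
    · have : (q = 0 ∧ a = s') ∨ (q = 1 ∧ M s a = 2 ∧ M s' a = 2) := by
        unfold step4 at h; grind
      rcases this with ⟨hq, rfl⟩ | ⟨hq, ha, hb⟩
      · exact ⟨[], ω, by simp, by simpa using i0 hq, by simp⟩
      · obtain ⟨w2, w3, rfl, hh, hk⟩ := i1 hq
        exact ⟨a :: w2, w3, by simp, by simpa [ha] using hh, by simpa [hb] using hk⟩
    · have : (q = 1 ∧ a = s) ∨ (q = 2 ∧ M s' a = 2) := by unfold step4 at h; grind
      rcases this with ⟨hq, rfl⟩ | ⟨hq, ha⟩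
      · obtain ⟨w2, w3, rfl, hh, hk⟩ := i1 hq
        exact ⟨[], w2, w3, by simp, hh, by simpa using hk⟩
      · obtain ⟨w1, w2, w3, rfl, hh, hk⟩ := i2 hq
        exact ⟨a :: w1, w2, w3, by simp, hh, by simpa [ha] using hk⟩
    · have : (q = 2 ∧ a = s') ∨ q = 3 := by unfold step4 at h; grind
      rcases this with ⟨hq, rfl⟩ | hq
      · obtain ⟨w1, w2, w3, rfl, hh, hk⟩ := i2 hq
        exact ⟨[], w1, w2, w3, by simp, hh, hk⟩
      · obtain ⟨w0, w1, w2, w3, rfl, hh, hk⟩ := i3 hq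
        exact ⟨a :: w0, w1, w2, w3, by simp, hh, hk⟩

/-- The word `ω` is accepted by one of the two automata. -/
def Acc (M : CoxeterMatrix B) (s s' : B) (ω : List B) : Prop :=
  (M s s' = 3 ∧ ω.foldr (step3 M s s') 0 = 2) ∨ (M s s' = 4 ∧ ω.foldr (step4 M s s') 0 = 3)

/-- An elementary commutation move. -/
inductive Swap (M : CoxeterMatrix B) : List B → List B → Prop
  | mk (α β : List B) (i j : B) (h : M i j = 2) : Swap M (α ++ [i, j] ++ β) (α ++ [j, i] ++ β)

theorem Acc.swap {s s' : B} {ω ω' : List B} (h : Acc M s s' ω) (hs : Swap M ω ω') :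
    Acc M s s' ω' := by
  obtain ⟨α, β, i, j, hij⟩ := hs
  rcases h with ⟨h1, h2⟩ | ⟨h1, h2⟩
  · refine Or.inl ⟨h1, ?_⟩
    rw [← h2]
    simp [List.foldr_append, step3_comm s s' i j h1 hij]
  · refine Or.inr ⟨h1, ?_⟩
    rw [← h2]
    simp [List.foldr_append, step4_comm s s' i j h1 hij]

theorem Acc.swaps {s s' : B} {ω ω' : List B} (h : Acc M s s' ω)
    (hs : Relation.ReflTransGen (Swap M) ω ω') : Acc M s s' ω' := by
  induction hs with
  | refl => exact h
  | tail _ h2 ih => exact ih.swap h2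

theorem acc3 (s s' : B) (hs : M s s' = 3) (ζ : List B) : Acc M s s' (ζ ++ [s, s']) := by
  refine Or.inl ⟨hs, ?_⟩
  have hne : s ≠ s' := by rintro rfl; simp at hs
  rw [List.foldr_append]
  have : [s, s'].foldr (step3 M s s') 0 = 2 := by simp [step3]
  rw [this]
  induction ζ with
  | nil => rfl
  | cons a ζ ih => rw [List.foldr_cons, ih]; simp [step3]

theorem acc4 (s s' : B) (hs : M s s' = 4) (ζ : List B) : Acc M s s' (ζ ++ [s', s, s']) := by
  refine Or.inr ⟨hs, ?_⟩
  have hne : s ≠ s' := by rintro rfl; simp at hs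
  rw [List.foldr_append]
  have : [s', s, s'].foldr (step4 M s s') 0 = 3 := by simp [step4]
  rw [this]
  induction ζ with
  | nil => rfl
  | cons a ζ ih => rw [List.foldr_cons, ih]; simp [step4]

theorem Acc.append {s s' t : B} {ω : List B} (h : Acc M s s' ω) (ht : M s t = 2) :
    Acc M s s' (ω ++ [t]) := by
  rcases h with ⟨h1, h2⟩ | ⟨h1, h2⟩
  · refine Or.inl ⟨h1, ?_⟩
    have : t ≠ s' := by rintro rfl; omega
    simp [List.foldr_append, step3, this, ht] at h2 ⊢
    exact h2
  · refine Or.inr ⟨h1, ?_⟩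
    have : t ≠ s' := by rintro rfl; omega
    simp [List.foldr_append, step4, this, ht] at h2 ⊢
    exact h2

end Automata

/-! ### Fully commutative elements -/

section FCElements


theorem FC.of_mul_simple {w : W} {t : B} (h : cs.FC (w * cs.simple t))
    (hl : cs.length (w * cs.simple t) = cs.length w + 1) : cs.FC w := by
  rintro ⟨x₁, x₂, i, i', h3, rfl, hlen⟩
  refine h ⟨x₁, x₂ * cs.simple t, i, i', h3, by simp only [mul_assoc], ?_⟩
  have h1 := cs.length_mul_le x₂ (cs.simple t)
  have h2 := cs.length_mul_le (x₁ * cs.wordProd (braidWord M i i')) (x₂ * cs.simple t)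
  have h4 := cs.length_mul_le x₁ (cs.wordProd (braidWord M i i'))
  have h5 := cs.length_wordProd_le (braidWord M i i')
  rw [length_alternatingWord] at h5
  rw [cs.length_simple] at h1
  rw [← mul_assoc] at h2
  omega

theorem complex_of_braid {w z : W} {i j : B} (h3 : 3 ≤ M i j)
    (h : w = z * cs.wordProd (braidWord M i j)) (hl : cs.length w = cs.length z + M i j) :
    ¬ cs.FC w := by
  intro hw
  exact hw ⟨z, 1, i, j, h3, by simpa using h, by simpa using hl⟩

/-- Two commuting descents. -/
theorem exists_comm
    (hord : ∀ i j : B, i ≠ j → 2 ≤ M i j ∧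
      ∀ k, 0 < k → k < M i j → (cs.simple i * cs.simple j) ^ k ≠ 1)
    {y : W} {i j : B} (hij : i ≠ j) (hM : M i j = 2)
    (hi : cs.IsRightDescent y i) (hj : cs.IsRightDescent y j) :
    ∃ z, y * cs.simple j = z * cs.simple i ∧ y * cs.simple i = z * cs.simple j ∧
      cs.length (z * cs.simple i) = cs.length z + 1 ∧
      cs.length (z * cs.simple j) = cs.length z + 1 ∧ cs.length y = cs.length z + 2 := by
  obtain ⟨z, hz, hl⟩ := exists_braid cs hord i j hij y hi hj
  have h1 : y = z * cs.simple i * cs.simple j := by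
    rw [hz, braidWord, hM]
    simp [alternatingWord, wordProd_cons, mul_assoc]
  have h2 : y = z * cs.simple j * cs.simple i := by
    rw [hz, cs.wordProd_braidWord_eq, braidWord, M.symmetric, hM]
    simp [alternatingWord, wordProd_cons, mul_assoc]
  have e1 : y * cs.simple j = z * cs.simple i := by rw [h1]; simp
  have e2 : y * cs.simple i = z * cs.simple j := by
    conv_lhs => rw [h2]
    simp
  have l1 := cs.length_mul_simple z i
  have l2 := cs.length_mul_simple z j
  have l3 := cs.length_mul_le (z * cs.simple i) (cs.simple j)
  have l4 := cs.length_mul_le (z * cs.simple j) (cs.simple i)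
  rw [← h1, cs.length_simple] at l3
  rw [← h2, cs.length_simple] at l4
  exact ⟨z, e1, e2, by omega, by omega, by omega⟩

theorem reduced_concat {ω : List B} {a : B} (h : cs.IsReduced (ω ++ [a])) :
    cs.IsReduced ω ∧ cs.length (cs.wordProd ω * cs.simple a) = cs.length (cs.wordProd ω) + 1 := by
  have h1 : cs.IsReduced ω := by simpa using h.take ω.length
  refine ⟨h1, ?_⟩
  have := h.eq
  rw [wordProd_append, wordProd_singleton] at this
  rw [this, h1.eq]; simp

theorem reduced_append {ω : List B} {a : B} (h : cs.IsReduced ω)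
    (hl : cs.length (cs.wordProd ω * cs.simple a) = cs.length (cs.wordProd ω) + 1) :
    cs.IsReduced (ω ++ [a]) := by
  unfold CoxeterSystem.IsReduced
  rw [wordProd_append, wordProd_singleton, hl, h.eq]; simp

theorem swaps_append {ω ω' : List B} (h : Relation.ReflTransGen (Swap M) ω ω') (a : B) :
    Relation.ReflTransGen (Swap M) (ω ++ [a]) (ω' ++ [a]) := by
  refine Relation.ReflTransGen.lift (fun l => l ++ [a]) ?_ _ _ h
  rintro _ _ ⟨α, β, i, j, hij⟩
  show Swap M (_ ++ [a]) (_ ++ [a])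
  have := Swap.mk α (β ++ [a]) i j hij
  simpa using this

/-- Reduced words of a fully commutative element are commutation equivalent. -/
theorem fc_words
    (hord : ∀ i j : B, i ≠ j → 2 ≤ M i j ∧
      ∀ k, 0 < k → k < M i j → (cs.simple i * cs.simple j) ^ k ≠ 1)
    (n : ℕ) (ω ω' : List B) (hn : ω.length = n) (h : cs.IsReduced ω)
    (h' : cs.IsReduced ω') (he : cs.wordProd ω = cs.wordProd ω') (hw : cs.FC (cs.wordProd ω)) :
    Relation.ReflTransGen (Swap M) ω ω' := by
  induction n generalizing ω ω' with
  | zero =>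
    have h0 : ω = [] := List.eq_nil_of_length_eq_zero hn
    have : ω'.length = 0 := by rw [← h'.eq, ← he, h0]; simp
    rw [h0, List.eq_nil_of_length_eq_zero this]
  | succ n ih =>
    have hn' : ω'.length = n + 1 := by rw [← h'.eq, ← he, h.eq, hn]
    obtain ⟨ω₁, a, rfl⟩ := List.eq_nil_or_concat' ω |>.resolve_left (by rintro rfl; simp at hn)
    obtain ⟨ω₂, b, rfl⟩ := List.eq_nil_or_concat' ω' |>.resolve_left (by rintro rfl; simp at hn')
    obtain ⟨r1, l1⟩ := reduced_concat cs h
    obtain ⟨r2, l2⟩ := reduced_concat cs h'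
    simp only [wordProd_append, wordProd_singleton] at he hw
    simp only [List.length_append, List.length_singleton] at hn hn'
    have f1 : cs.FC (cs.wordProd ω₁) := FC.of_mul_simple cs hw l1
    have f2 : cs.FC (cs.wordProd ω₂) := FC.of_mul_simple cs (he ▸ hw) l2
    by_cases hab : a = b
    · subst hab
      exact swaps_append (ih ω₁ ω₂ (by omega) r1 r2 (mul_right_cancel he) f1) a
    · generalize hy : cs.wordProd ω₁ * cs.simple a = y at *
      have ea : y * cs.simple a = cs.wordProd ω₁ := by rw [← hy]; simp
      have eb : y * cs.simple b = cs.wordProd ω₂ := by rw [he]; simp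
      have da : cs.IsRightDescent y a := by unfold IsRightDescent; rw [ea]; omega
      have db : cs.IsRightDescent y b := by unfold IsRightDescent; rw [eb, he]; omega
      have hM : M a b = 2 := by
        by_contra hne
        obtain ⟨z, hz, hl⟩ := exists_braid cs hord a b hab y da db
        have := (hord a b hab).1
        exact complex_of_braid cs (by omega) hz hl hw
      obtain ⟨z, e1, e2, k1, k2, -⟩ := exists_comm cs hord hab hM da db
      obtain ⟨ζ, hζ, rfl⟩ := cs.exists_isReduced z
      have q1 := ih ω₁ (ζ ++ [b]) (by omega) r1 (reduced_append cs hζ k2)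
        (by rw [wordProd_append, wordProd_singleton, ← e2, ea]) f1
      have q2 := ih (ζ ++ [a]) ω₂ (by
          have t1 := (reduced_append cs hζ k1).eq
          rw [wordProd_append, wordProd_singleton, ← e1, eb, r2.eq] at t1
          omega) (reduced_append cs hζ k1) r2
        (by rw [wordProd_append, wordProd_singleton, ← e1, eb])
        (by rw [wordProd_append, wordProd_singleton, ← e1, eb]; exact f2)
      have q3 : Swap M (ζ ++ [b] ++ [a]) (ζ ++ [a] ++ [b]) := by
        have := Swap.mk ζ [] b a (by rw [M.symmetric]; exact hM)
        simpa using this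
      exact ((swaps_append q1 a).tail q3).trans (swaps_append q2 b)

variable [DecidableEq B]

theorem acc_of_braid (hM : ∀ i j, i ≠ j → M i j = 2 ∨ M i j = 3 ∨ M i j = 4)
    {w z : W} {s t : B} (hst : s ≠ t) (h3 : 3 ≤ M s t)
    (hz : w * cs.simple s = z * cs.wordProd (braidWord M t s))
    (hl : cs.length (w * cs.simple s) = cs.length z + M s t)
    (hws : cs.length (w * cs.simple s) = cs.length w + 1) :
    ∃ s' ω, cs.IsReduced ω ∧ cs.wordProd ω = w ∧ Acc M s s' ω := by
  obtain ⟨ζ, hζ, rfl⟩ := cs.exists_isReduced z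
  have hw : w = cs.wordProd ζ * cs.wordProd (braidWord M t s) * cs.simple s := by
    rw [← hz]; simp
  rw [hζ.eq] at hl
  rcases hM s t hst with h | h | h
  · omega
  · have e : cs.wordProd (ζ ++ [s, t]) = w := by
      rw [hw, braidWord, M.symmetric, h]
      simp [alternatingWord, wordProd_append, wordProd_cons, mul_assoc]
    refine ⟨t, ζ ++ [s, t], ?_, e, acc3 s t h ζ⟩
    unfold CoxeterSystem.IsReduced
    rw [e]; simp; omega
  · have e : cs.wordProd (ζ ++ [t, s, t]) = w := by
      rw [hw, braidWord, M.symmetric, h]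
      simp [alternatingWord, wordProd_append, wordProd_cons, mul_assoc]
    refine ⟨t, ζ ++ [t, s, t], ?_, e, acc4 s t h ζ⟩
    unfold CoxeterSystem.IsReduced
    rw [e]; simp; omega

theorem acc_of_descent
    (hord : ∀ i j : B, i ≠ j → 2 ≤ M i j ∧
      ∀ k, 0 < k → k < M i j → (cs.simple i * cs.simple j) ^ k ≠ 1)
    (hM : ∀ i j, i ≠ j → M i j = 2 ∨ M i j = 3 ∨ M i j = 4)
    {w : W} {s t : B} (hst : s ≠ t) (h3 : 3 ≤ M s t)
    (ht : cs.IsRightDescent (w * cs.simple s) t)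
    (hws : cs.length (w * cs.simple s) = cs.length w + 1) :
    ∃ s' ω, cs.IsReduced ω ∧ cs.wordProd ω = w ∧ Acc M s s' ω := by
  obtain ⟨z, hz, hl⟩ := exists_braid cs hord t s hst.symm (w * cs.simple s) ht
    (by unfold IsRightDescent; simp; omega)
  exact acc_of_braid cs hM hst h3 hz (by rw [M.symmetric]; exact hl) hws

theorem descent_of_braid {y z : W} {i j : B} (h3 : 3 ≤ M i j)
    (hz : y = z * cs.wordProd (braidWord M i j)) (hl : cs.length y = cs.length z + M i j) :
    cs.IsRightDescent y j := by
  obtain ⟨k, hk⟩ : ∃ k, M i j = k + 1 := ⟨M i j - 1, by omega⟩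
  unfold IsRightDescent
  have : y * cs.simple j = z * cs.wordProd (alternatingWord j i k) := by
    rw [hz, braidWord, hk, mul_assoc, alternatingWord_mul']
  rw [this]
  have h1 := cs.length_mul_le z (cs.wordProd (alternatingWord j i k))
  have h2 := cs.length_wordProd_le (alternatingWord j i k)
  rw [length_alternatingWord] at h2
  omega

theorem exists_acc
    (hord : ∀ i j : B, i ≠ j → 2 ≤ M i j ∧
      ∀ k, 0 < k → k < M i j → (cs.simple i * cs.simple j) ^ k ≠ 1)
    (hM : ∀ i j, i ≠ j → M i j = 2 ∨ M i j = 3 ∨ M i j = 4) (n : ℕ)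
    (w : W) (s : B) (hn : cs.length w = n) (hw : cs.FC w)
    (hws : cs.length (w * cs.simple s) = cs.length w + 1) (hc : cs.IsComplexElt (w * cs.simple s)) :
    ∃ s' ω, cs.IsReduced ω ∧ cs.wordProd ω = w ∧ Acc M s s' ω := by
  induction n using Nat.strong_induction_on generalizing w with
  | _ n ih =>
  have ds : cs.IsRightDescent (w * cs.simple s) s := by unfold IsRightDescent; simp; omega
  obtain ⟨x₁, x₂, i, j, h3, hy, hl⟩ := hc
  have hij : i ≠ j := by rintro rfl; simp at h3
  by_cases hx : x₂ = 1
  · subst hx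
    simp only [mul_one, length_one, add_zero] at hy hl
    have dj := descent_of_braid cs h3 hy hl
    have di := descent_of_braid cs (y := w * cs.simple s) (z := x₁) (i := j) (j := i)
      (by rwa [M.symmetric]) (by rw [hy, cs.wordProd_braidWord_eq])
      (by rw [M.symmetric j i]; exact hl)
    by_cases hsi : 3 ≤ M s i
    · exact acc_of_descent cs hord hM (by rintro rfl; simp at hsi) hsi di hws
    by_cases hsj : 3 ≤ M s j
    · exact acc_of_descent cs hord hM (by rintro rfl; simp at hsj) hsj dj hws
    have nsi : s ≠ i := by rintro rfl; exact hsj h3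
    have nsj : s ≠ j := by rintro rfl; rw [M.symmetric] at h3; exact hsi h3
    have m1 : M s i = 2 := by have := (hord s i nsi).1; omega
    have m2 : M s j = 2 := by have := (hord s j nsj).1; omega
    have di' : cs.IsRightDescent w i := by
      obtain ⟨z, -, e, -, k, -⟩ := exists_comm cs hord nsi m1 ds di
      simp only [simple_mul_simple_cancel_right] at e
      unfold IsRightDescent
      rw [e, k]; simp
    have dj' : cs.IsRightDescent w j := by
      obtain ⟨z, -, e, -, k, -⟩ := exists_comm cs hord nsj m2 ds dj
      simp only [simple_mul_simple_cancel_right] at e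
      unfold IsRightDescent
      rw [e, k]; simp
    obtain ⟨z, hz, hlz⟩ := exists_braid cs hord i j hij w di' dj'
    exact absurd hw (complex_of_braid cs h3 hz hlz)
  · obtain ⟨t, ht⟩ := cs.exists_rightDescent_of_ne_one hx
    have ht' := cs.isRightDescent_iff.1 ht
    have eyt : w * cs.simple s * cs.simple t =
        x₁ * cs.wordProd (braidWord M i j) * (x₂ * cs.simple t) := by
      rw [hy]; simp only [mul_assoc]
    have lyt : cs.length (w * cs.simple s * cs.simple t) =
        cs.length x₁ + M i j + cs.length (x₂ * cs.simple t) := by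
      have h1 := cs.length_mul_le (x₁ * cs.wordProd (braidWord M i j)) (x₂ * cs.simple t)
      have h2 := cs.length_mul_le x₁ (cs.wordProd (braidWord M i j))
      have h4 := cs.length_wordProd_le (braidWord M i j)
      rw [length_alternatingWord] at h4
      rw [← eyt] at h1
      have h5 := cs.length_mul_simple (w * cs.simple s) t
      omega
    have hct : cs.IsComplexElt (w * cs.simple s * cs.simple t) := ⟨_, _, i, j, h3, eyt, lyt⟩
    have dt : cs.IsRightDescent (w * cs.simple s) t := by
      unfold IsRightDescent; omega
    by_cases hst : s = t
    · subst hst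
      rw [simple_mul_simple_cancel_right] at hct
      exact absurd hct hw
    by_cases hm : 3 ≤ M s t
    · exact acc_of_descent cs hord hM hst hm dt hws
    have m2 : M s t = 2 := by have := (hord s t hst).1; omega
    obtain ⟨z, e1, e2, k1, k2, k3⟩ := exists_comm cs hord hst m2 ds dt
    simp only [simple_mul_simple_cancel_right] at e2
    rw [e1] at hct
    have hz : cs.FC z := FC.of_mul_simple cs (e2 ▸ hw) k2
    obtain ⟨s', ω, hω, rfl, hacc⟩ := ih (cs.length z) (by rw [← hn, e2]; omega) z rfl hz k1 hct
    exact ⟨s', ω ++ [t], reduced_append cs hω k2, by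
      rw [wordProd_append, wordProd_singleton, e2], hacc.append m2⟩

end FCElements

theorem last_unique {P : B → Prop} {α β α' β' : List B} {a a' : B}
    (h : α ++ [a] ++ β = α' ++ [a'] ++ β') (ha : ¬ P a) (ha' : ¬ P a')
    (hβ : ∀ j ∈ β, P j) (hβ' : ∀ j ∈ β', P j) : a = a' := by
  classical
  have h1 := congrArg (fun l => (l.reverse.find? (fun j => decide (¬ P j)))) h
  have e1 : β.reverse.find? (fun j => decide (¬ P j)) = none := by
    simpa [List.find?_eq_none] using hβ
  have e2 : β'.reverse.find? (fun j => decide (¬ P j)) = none := by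
    simpa [List.find?_eq_none] using hβ'
  simp only [List.reverse_append, List.find?_append, e1, e2] at h1
  simpa [ha, ha'] using h1

theorem commute_of_two {i j : B} (h : M i j = 2) : Commute (cs.simple i) (cs.simple j) := by
  have h1 := cs.simple_mul_simple_pow i j
  rw [h, pow_two] at h1
  have h2 := eq_inv_of_mul_eq_one_left h1
  rw [mul_inv_rev, inv_simple, inv_simple] at h2
  exact h2

end FCParse

/-- Let `W` be of type `A` or `B`, let `w ∈ W_c`, and let `s` be a generator with `ws ∉ W_c`.
Then there is a unique generator `s'` such that every reduced expression for `w` can be parsed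
either as (i) `w = w₁ s w₂ s' w₃`, where `ss'` has order 3 and `s` commutes with every generator
occurring in `w₂` or `w₃`, or as (ii) `w = w₁ s' w₂ s w₃ s' w₄`, where `ss'` has order 4,
`s` commutes with every generator occurring in `w₃` or `w₄`, and `s'` commutes with every
generator occurring in `w₂` or `w₃`. -/
theorem exists_unique_parsing {n : ℕ} {M : CoxeterMatrix (Fin n)}
    (hM : M = CoxeterMatrix.Aₙ n ∨ M = CoxeterMatrix.Bₙ n)
    (cs : CoxeterSystem M W) (w : W) (s : Fin n)
    (hw : cs.FC w) (hws : ¬ cs.FC (w * cs.simple s)) :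
    ∃! s' : Fin n, ∀ ω : List (Fin n), cs.IsReduced ω → cs.wordProd ω = w →
      (∃ ω₁ ω₂ ω₃ : List (Fin n), ω = ω₁ ++ [s] ++ ω₂ ++ [s'] ++ ω₃ ∧ M s s' = 3 ∧
        ∀ j ∈ ω₂ ++ ω₃, Commute (cs.simple s) (cs.simple j)) ∨
      (∃ ω₁ ω₂ ω₃ ω₄ : List (Fin n), ω = ω₁ ++ [s'] ++ ω₂ ++ [s] ++ ω₃ ++ [s'] ++ ω₄ ∧
        M s s' = 4 ∧
        (∀ j ∈ ω₃ ++ ω₄, Commute (cs.simple s) (cs.simple j)) ∧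
        (∀ j ∈ ω₂ ++ ω₃, Commute (cs.simple s') (cs.simple j))) := by
  have hN : ∀ i j, i ≠ j → M i j = 2 ∨ M i j = 3 ∨ M i j = 4 := by
    intro i j hij
    rcases hM with rfl | rfl
    · simp only [CoxeterMatrix.Aₙ, CoxeterMatrix.A, Matrix.of_apply, if_neg hij]
      split_ifs <;> simp
    · simp only [CoxeterMatrix.Bₙ, CoxeterMatrix.B, Matrix.of_apply, if_neg hij]
      split_ifs <;> simp
  clear hM
  have hord := FCParse.order_exact cs hN
  have hc : cs.IsComplexElt (w * cs.simple s) := not_not.1 hws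
  have hl : cs.length (w * cs.simple s) = cs.length w + 1 := by
    rcases cs.length_mul_simple w s with h | h
    · exact h
    · exact absurd (FCParse.FC.of_mul_simple cs (w := w * cs.simple s) (t := s)
        (by simpa using hw) (by simpa using h.symm)) hws
  have hnc : ∀ s', M s s' = 3 ∨ M s s' = 4 → ¬ Commute (cs.simple s) (cs.simple s') := by
    intro s' h hcomm
    have hne : s ≠ s' := by rintro rfl; simp at h
    refine (hord s s' hne).2 2 (by omega) (by omega) ?_
    rw [hcomm.mul_pow]; simp
  obtain ⟨s', ω₀, hω₀, hp₀, hacc⟩ := FCParse.exists_acc cs hord hN _ w s rfl hw hl hc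
  refine ⟨s', ?_, ?_⟩
  · intro ω hω hp
    have hsw := FCParse.fc_words cs hord _ ω₀ ω rfl hω₀ hω (by rw [hp₀, hp]) (by rwa [hp₀])
    rcases hacc.swaps hsw with ⟨h1, h2⟩ | ⟨h1, h2⟩
    · obtain ⟨ω₁, ω₂, ω₃, e, h⟩ := (FCParse.run3_spec s s' ω).2.2 h2
      exact Or.inl ⟨ω₁, ω₂, ω₃, e, h1, fun j hj => FCParse.commute_of_two cs (h j hj)⟩
    · obtain ⟨ω₁, ω₂, ω₃, ω₄, e, h, h'⟩ := (FCParse.run4_spec s s' ω).2.2.2 h2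
      exact Or.inr ⟨ω₁, ω₂, ω₃, ω₄, e, h1, fun j hj => FCParse.commute_of_two cs (h j hj),
        fun j hj => FCParse.commute_of_two cs (h' j hj)⟩
  · intro t ht
    have hlast : ∃ α β, ω₀ = α ++ [t] ++ β ∧ ¬ Commute (cs.simple s) (cs.simple t) ∧
        ∀ j ∈ β, Commute (cs.simple s) (cs.simple j) := by
      rcases ht ω₀ hω₀ hp₀ with ⟨ω₁, ω₂, ω₃, e, h1, h⟩ | ⟨ω₁, ω₂, ω₃, ω₄, e, h1, h, -⟩
      · exact ⟨_, ω₃, e, hnc t (Or.inl h1), fun j hj => h j (by simp [hj])⟩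
      · exact ⟨_, ω₄, e, hnc t (Or.inr h1), fun j hj => h j (by simp [hj])⟩
    have hlast' : ∃ α β, ω₀ = α ++ [s'] ++ β ∧ ¬ Commute (cs.simple s) (cs.simple s') ∧
        ∀ j ∈ β, Commute (cs.simple s) (cs.simple j) := by
      rcases hacc with ⟨h1, h2⟩ | ⟨h1, h2⟩
      · obtain ⟨ω₁, ω₂, ω₃, e, h⟩ := (FCParse.run3_spec s s' ω₀).2.2 h2
        exact ⟨_, ω₃, e, hnc s' (Or.inl h1), fun j hj =>
          FCParse.commute_of_two cs (h j (by simp [hj]))⟩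
      · obtain ⟨ω₁, ω₂, ω₃, ω₄, e, h, -⟩ := (FCParse.run4_spec s s' ω₀).2.2.2 h2
        exact ⟨_, ω₄, e, hnc s' (Or.inr h1), fun j hj =>
          FCParse.commute_of_two cs (h j (by simp [hj]))⟩
    obtain ⟨α, β, e, k1, k2⟩ := hlast
    obtain ⟨α', β', e', k1', k2'⟩ := hlast'
    exact FCParse.last_unique (P := fun j => Commute (cs.simple s) (cs.simple j))
      (e.symm.trans e') k1 k1' k2 k2'
end
end

section
/- In the generalized Temperley–Lieb algebra TL(X) of type A or B, for any fully commutative w ∈ W_c and any generator s ∈ S, the product b_w b_s equals a q_c^m b_{w'} for some w' ∈ W_c, a nonnegative integer a, and m ∈ {0,1}, where ℓ(w's) < ℓ(w'). Moreover if w has a reduced expression ending in a generator s' not commuting with s, then m = 0. -/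
open CoxeterSystem LaurentPolynomial

noncomputable section

variable {B : Type*} {W : Type*} [Group W]

/-- The defining relations of the generalized Temperley--Lieb algebra `TL(X)`. -/
inductive TLRel (M : CoxeterMatrix B) : FreeAlgebra LA B → FreeAlgebra LA B → Prop
  | sq (i : B) : TLRel M (FreeAlgebra.ι LA i * FreeAlgebra.ι LA i) (qc • FreeAlgebra.ι LA i)
  | comm (i i' : B) : M i i' = 2 → TLRel M (FreeAlgebra.ι LA i * FreeAlgebra.ι LA i')
      (FreeAlgebra.ι LA i' * FreeAlgebra.ι LA i)
  | braid3 (i i' : B) : M i i' = 3 → TLRel M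
      (FreeAlgebra.ι LA i * FreeAlgebra.ι LA i' * FreeAlgebra.ι LA i) (FreeAlgebra.ι LA i)
  | braid4 (i i' : B) : M i i' = 4 → TLRel M
      (FreeAlgebra.ι LA i * FreeAlgebra.ι LA i' * FreeAlgebra.ι LA i * FreeAlgebra.ι LA i')
      (2 * (FreeAlgebra.ι LA i * FreeAlgebra.ι LA i'))

/-- The generalized Temperley--Lieb algebra `TL(X)` as an `A`-algebra. -/
abbrev TL (M : CoxeterMatrix B) := RingQuot (TLRel M)

/-- The generator `b_s` of `TL(X)`. -/
def bgen (M : CoxeterMatrix B) (i : B) : TL M :=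
  RingQuot.mkAlgHom LA (TLRel M) (FreeAlgebra.ι LA i)

/-- The product `b_{s_1} b_{s_2} ⋯ b_{s_n}` over a word; for a reduced word of a fully
commutative element this is the monomial basis element `b_w`. -/
def bprod (M : CoxeterMatrix B) (ω : List B) : TL M := (ω.map (bgen M)).prod

namespace TLproof

section Exchange

open Classical in
/-- The action of a generator on `W × ZMod 2`. -/
def exAct {M : CoxeterMatrix B} (cs : CoxeterSystem M W) (i : B) :
    Function.End (W × ZMod 2) :=
  fun p => (cs.simple i * p.1 * cs.simple i, p.2 + if p.1 = cs.simple i then 1 else 0)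

open Classical in
theorem exAct_word {M : CoxeterMatrix B} (cs : CoxeterSystem M W) (ω : List B) (p : W × ZMod 2) :
    (ω.map (exAct cs)).prod p =
      (cs.wordProd ω * p.1 * (cs.wordProd ω)⁻¹,
        p.2 + ((cs.rightInvSeq ω).count p.1 : ZMod 2)) := by
  induction ω with
  | nil => 
    simp only [List.map_nil, List.prod_nil, wordProd_nil, rightInvSeq_nil, List.count_nil]
    simp [Function.End.one_def]
  | cons i ω ih =>
    rw [List.map_cons, List.prod_cons]
    change exAct cs i ((List.map (exAct cs) ω).prod p) = _
    rw [ih]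
    simp only [exAct, rightInvSeq, wordProd_cons, List.count_cons, mul_inv_rev, inv_simple]
    refine Prod.ext ?_ ?_
    · simp [mul_assoc]
    · have : (cs.wordProd ω * p.1 * (cs.wordProd ω)⁻¹ = cs.simple i) ↔
        ((cs.wordProd ω)⁻¹ * cs.simple i * cs.wordProd ω = p.1) := by
        constructor
        · intro h; rw [← h]; group
        · intro h; rw [← h]; group
      simp only [this, beq_iff_eq]
      push_cast
      rw [add_assoc]

theorem alt_two (i j : B) (k : ℕ) :
    alternatingWord i j (2 * (k + 1)) = alternatingWord i j (2 * k) ++ [i, j] := by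
  rw [show 2 * (k + 1) = 2 * k + 1 + 1 by ring, alternatingWord_succ, alternatingWord_succ]
  simp

theorem alt_reverse (i j : B) (k : ℕ) :
    (alternatingWord i j (2 * k)).reverse = alternatingWord j i (2 * k) := by
  induction k with
  | zero => rfl
  | succ k ih =>
    rw [alt_two, List.reverse_append, ih, show 2 * (k + 1) = 2 * k + 1 + 1 by ring,
      alternatingWord_succ', alternatingWord_succ']
    simp

theorem alt_pow {G : Type*} [Monoid G] (f : B → G) (i j : B) (k : ℕ) :
    ((alternatingWord i j (2 * k)).map f).prod = (f i * f j) ^ k := by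
  induction k with
  | zero => simp [alternatingWord]
  | succ k ih => rw [alt_two, List.map_append, List.prod_append, ih, pow_succ]; simp

open Classical in
theorem alt_count {M : CoxeterMatrix B} (cs : CoxeterSystem M W) (i j : B) (t : W) :
    (((cs.rightInvSeq (alternatingWord i j (2 * M i j))).count t : ℕ) : ZMod 2) = 0 := by
  rw [← alt_reverse, rightInvSeq_reverse, List.count_reverse]
  set L := cs.leftInvSeq (alternatingWord j i (2 * M i j)) with hL
  have hlen : L.length = 2 * M i j := by simp [hL]
  have h : L.drop (M i j) = L.take (M i j) := by
    apply List.ext_getElem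
    · simp [hlen]; omega
    · intro k h1 h2
      simp only [List.length_drop, hlen] at h1
      rw [List.getElem_drop, List.getElem_take]
      simp only [hL]
      rw [getElem_leftInvSeq_alternatingWord _ _ _ _ _ (by omega),
        getElem_leftInvSeq_alternatingWord _ _ _ _ _ (by omega),
        prod_alternatingWord_eq_mul_pow, prod_alternatingWord_eq_mul_pow]
      have e1 : ¬ Even (2 * (M i j + k) + 1) := by simp [parity_simps]
      have e2 : ¬ Even (2 * k + 1) := by simp [parity_simps]
      rw [if_neg e1, if_neg e2, show (2 * (M i j + k) + 1) / 2 = M i j + k by omega,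
        show (2 * k + 1) / 2 = k by omega, pow_add, simple_mul_simple_pow, one_mul]
  rw [← List.take_append_drop (M i j) L, List.count_append, h]
  push_cast
  exact CharTwo.add_self_eq_zero _

theorem exAct_liftable {M : CoxeterMatrix B} (cs : CoxeterSystem M W) :
    M.IsLiftable (exAct cs) := by
  intro i j
  rw [← alt_pow]
  funext p
  rw [exAct_word, alt_count]
  have : cs.wordProd (alternatingWord i j (2 * M i j)) = 1 := by
    rw [wordProd, alt_pow, simple_mul_simple_pow]
  rw [this]
  simp [Function.End.one_def]

open Classical in
theorem count_eq {M : CoxeterMatrix B} (cs : CoxeterSystem M W) (ω ω' : List B)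
    (h : cs.wordProd ω = cs.wordProd ω') (t : W) :
    (((cs.rightInvSeq ω).count t : ℕ) : ZMod 2) = ((cs.rightInvSeq ω').count t : ℕ) := by
  have key : ∀ ω : List B, cs.lift ⟨exAct cs, exAct_liftable cs⟩ (cs.wordProd ω)
      = (ω.map (exAct cs)).prod := by
    intro ω
    rw [wordProd, map_list_prod, List.map_map]
    congr 1
    apply List.map_congr_left
    intro i _
    simp
  have h1 := key ω
  rw [h, key ω'] at h1
  have h2 := congrFun h1 (t, 0)
  rw [exAct_word, exAct_word] at h2
  have := congrArg Prod.snd h2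
  simpa using this.symm

/-- The exchange property. -/
theorem exchange {M : CoxeterMatrix B} (cs : CoxeterSystem M W) (ω : List B) (i : B)
    (h : cs.length (cs.wordProd ω * cs.simple i) < cs.length (cs.wordProd ω)) :
    ∃ j < ω.length, cs.wordProd ω * cs.simple i = cs.wordProd (ω.eraseIdx j) := by
  classical
  obtain ⟨ξ, hξ, hξ'⟩ := cs.exists_isReduced (cs.wordProd ω * cs.simple i)
  have hp : cs.wordProd ω = cs.wordProd (ξ.concat i) := by
    rw [wordProd_concat, ← hξ']; simp
  have h0 : cs.simple i ∉ cs.rightInvSeq ξ := by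
    intro hmem
    have := (cs.isRightInversion_of_mem_rightInvSeq hξ hmem).2
    rw [← hξ'] at this
    simp at this
    omega
  have h1 := count_eq cs ω _ hp (cs.simple i)
  rw [rightInvSeq_concat, List.concat_eq_append, List.count_append] at h1
  have h2 : List.count (cs.simple i) (List.map (MulAut.conj (cs.simple i)) (cs.rightInvSeq ξ)) = 0 := by
    rw [List.count_eq_zero]
    intro hm
    obtain ⟨t, ht, ht'⟩ := List.mem_map.1 hm
    have : t = cs.simple i := by
      have := congrArg (fun x => cs.simple i * x * cs.simple i) ht'
      simpa [mul_assoc] using this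
    exact h0 (this ▸ ht)
  rw [h2] at h1
  have h3 : cs.simple i ∈ cs.rightInvSeq ω := by
    by_contra hn
    rw [List.count_eq_zero.2 hn] at h1
    simp at h1
  obtain ⟨j, hj, hj'⟩ := List.mem_iff_getElem.mp h3
  refine ⟨j, by simpa using hj, ?_⟩
  rw [← cs.wordProd_mul_getD_rightInvSeq, List.getD_eq_getElem _ 1 hj, hj']

end Exchange

end TLproof

namespace TLproof

section Cartan

/-- All the bonds are `2`, `3` or `4`. -/
def Bonds {n : ℕ} (M : CoxeterMatrix (Fin n)) : Prop :=
  ∀ i j, i ≠ j → M i j = 2 ∨ M i j = 3 ∨ M i j = 4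

/-- Cartan matrix. -/
def cartan {n : ℕ} (M : CoxeterMatrix (Fin n)) (i j : Fin n) : ℤ :=
  if i = j then 2 else if M i j = 3 then -1
    else if M i j = 4 then (if i < j then -2 else -1) else 0

/-- Coroot functionals. -/
def coroot {n : ℕ} (M : CoxeterMatrix (Fin n)) (i : Fin n) : (Fin n → ℤ) →ₗ[ℤ] ℤ :=
  ∑ k, cartan M i k • LinearMap.proj k

/-- Simple root. -/
def sroot {n : ℕ} (j : Fin n) : Fin n → ℤ := Pi.single j 1

theorem coroot_sroot {n : ℕ} (M : CoxeterMatrix (Fin n)) (i j : Fin n) :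
    coroot M i (sroot j) = cartan M i j := by
  simp [coroot, sroot, Pi.single_apply]

/-- Simple reflection. -/
def refl {n : ℕ} (M : CoxeterMatrix (Fin n)) (i : Fin n) : Module.End ℤ (Fin n → ℤ) :=
  LinearMap.id - (coroot M i).smulRight (sroot i)

theorem refl_apply {n : ℕ} (M : CoxeterMatrix (Fin n)) (i : Fin n) (v : Fin n → ℤ) :
    refl M i v = v - coroot M i v • sroot i := by
  simp [refl]

theorem cartan_self {n : ℕ} (M : CoxeterMatrix (Fin n)) (i : Fin n) : cartan M i i = 2 := by
  simp [cartan]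

theorem cartan_two {n : ℕ} (M : CoxeterMatrix (Fin n)) (i j : Fin n) (h : M i j = 2) :
    cartan M i j = 0 := by
  have : i ≠ j := by rintro rfl; simp at h
  simp [cartan, h, this]

theorem cartan_three {n : ℕ} (M : CoxeterMatrix (Fin n)) (i j : Fin n) (h : M i j = 3) :
    cartan M i j = -1 := by
  have : i ≠ j := by rintro rfl; simp at h
  simp [cartan, h, this]

theorem cartan_four {n : ℕ} (M : CoxeterMatrix (Fin n)) (i j : Fin n) (h : M i j = 4) :
    (cartan M i j = -1 ∧ cartan M j i = -2) ∨ (cartan M i j = -2 ∧ cartan M j i = -1) := by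
  have hne : i ≠ j := by rintro rfl; simp at h
  have h' : M j i = 4 := by rw [M.symmetric, h]
  rcases lt_or_gt_of_ne hne with hl | hl
  · right; simp [cartan, h, h', hne, hne.symm, hl, hl.le]
  · left; simp [cartan, h, h', hne, hne.symm, hl, hl.le]

theorem refl_liftable {n : ℕ} (M : CoxeterMatrix (Fin n)) (hB : Bonds M) :
    M.IsLiftable (refl M) := by
  intro i j
  by_cases hij : i = j
  · subst hij
    rw [M.diagonal, pow_one]
    apply LinearMap.ext; intro v
    simp only [Module.End.mul_apply, refl_apply, map_sub, map_smul, coroot_sroot, cartan_self,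
      Module.End.one_apply]
    module
  rcases hB i j hij with h | h | h
  · have h' : M j i = 2 := by rw [M.symmetric, h]
    rw [h]
    apply LinearMap.ext; intro v
    simp only [pow_succ, pow_zero, one_mul, Module.End.mul_apply, refl_apply, map_sub, map_smul,
      coroot_sroot, cartan_self, cartan_two M _ _ h, cartan_two M _ _ h',
      Module.End.one_apply]
    module
  · have h' : M j i = 3 := by rw [M.symmetric, h]
    rw [h]
    apply LinearMap.ext; intro v
    simp only [pow_succ, pow_zero, one_mul, Module.End.mul_apply, refl_apply, map_sub, map_smul,
      coroot_sroot, cartan_self, cartan_three M _ _ h, cartan_three M _ _ h',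
      Module.End.one_apply]
    module
  · rw [h]
    rcases cartan_four M i j h with ⟨h1, h2⟩ | ⟨h1, h2⟩
    · apply LinearMap.ext; intro v
      simp only [pow_succ, pow_zero, one_mul, Module.End.mul_apply, refl_apply, map_sub, map_smul,
        coroot_sroot, cartan_self, h1, h2, Module.End.one_apply]
      module
    · apply LinearMap.ext; intro v
      simp only [pow_succ, pow_zero, one_mul, Module.End.mul_apply, refl_apply, map_sub, map_smul,
        coroot_sroot, cartan_self, h1, h2, Module.End.one_apply]
      module

theorem sroot_self {n : ℕ} (i : Fin n) : sroot i i = 1 := by simp [sroot]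

theorem sroot_ne {n : ℕ} {i j : Fin n} (h : i ≠ j) : sroot i j = 0 := by
  simp [sroot, h.symm]

theorem simple_ne {n : ℕ} {M : CoxeterMatrix (Fin n)} (cs : CoxeterSystem M W) (hB : Bonds M)
    {i j : Fin n} (h : i ≠ j) : cs.simple i ≠ cs.simple j := by
  intro he
  have := congrArg (cs.lift ⟨refl M, refl_liftable M hB⟩) he
  rw [lift_apply_simple, lift_apply_simple] at this
  have := congrFun (LinearMap.congr_fun this (sroot i)) i
  simp [refl_apply, coroot_sroot, cartan_self, sroot_self, sroot_ne h.symm] at this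

theorem sq_ne {n : ℕ} {M : CoxeterMatrix (Fin n)} (cs : CoxeterSystem M W) (hB : Bonds M)
    {i j : Fin n} (h : 3 ≤ M i j) : (cs.simple i * cs.simple j) ^ 2 ≠ 1 := by
  intro he
  have hij : i ≠ j := by rintro rfl; simp at h
  have := congrArg (cs.lift ⟨refl M, refl_liftable M hB⟩) he
  rw [map_pow, map_mul, map_one, lift_apply_simple, lift_apply_simple] at this
  have := congrFun (LinearMap.congr_fun this (sroot j)) j
  simp only [pow_succ, pow_zero, one_mul, Module.End.mul_apply, refl_apply, map_sub, map_smul,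
      coroot_sroot, cartan_self, Module.End.one_apply, smul_eq_mul, Pi.sub_apply, Pi.smul_apply,
      sroot_self, sroot_ne hij] at this
  have h0 : cartan M i j * cartan M j i ≠ 0 := by
    rcases hB i j hij with h | h | h
    · omega
    · rw [cartan_three M i j h, cartan_three M j i (by rw [M.symmetric, h])]; norm_num
    · rcases cartan_four M i j h with ⟨h1, h2⟩ | ⟨h1, h2⟩ <;> rw [h1, h2] <;> norm_num
  apply h0
  linarith

theorem cube_ne {n : ℕ} {M : CoxeterMatrix (Fin n)} (cs : CoxeterSystem M W) (hB : Bonds M)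
    {i j : Fin n} (h : M i j = 4) : (cs.simple i * cs.simple j) ^ 3 ≠ 1 := by
  intro he
  have hij : i ≠ j := by rintro rfl; simp at h
  have := congrArg (cs.lift ⟨refl M, refl_liftable M hB⟩) he
  rw [map_pow, map_mul, map_one, lift_apply_simple, lift_apply_simple] at this
  have := congrFun (LinearMap.congr_fun this (sroot j)) i
  simp only [pow_succ, pow_zero, one_mul, Module.End.mul_apply, refl_apply, map_sub, map_smul,
      coroot_sroot, cartan_self, Module.End.one_apply, smul_eq_mul, Pi.sub_apply, Pi.smul_apply,
      sroot_self, sroot_ne hij.symm] at this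
  rcases cartan_four M i j h with ⟨h1, h2⟩ | ⟨h1, h2⟩ <;> rw [h1, h2] at this <;> norm_num at this

end Cartan

end TLproof

namespace TLproof

section LemmaD

theorem D_step {M : CoxeterMatrix B} (cs : CoxeterSystem M W) {ξ τ : List B} {i : B}
    (hr : cs.IsReduced (ξ ++ τ))
    (hd : cs.length (cs.wordProd (ξ ++ τ) * cs.simple i) < cs.length (cs.wordProd (ξ ++ τ)))
    (hne : ∀ j < τ.length, cs.wordProd τ * cs.simple i ≠ cs.wordProd (τ.eraseIdx j)) :
    ∃ ξ', cs.IsReduced (ξ' ++ (τ ++ [i])) ∧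
      cs.wordProd (ξ' ++ (τ ++ [i])) = cs.wordProd (ξ ++ τ) := by
  obtain ⟨j, hj, he⟩ := exchange cs _ _ hd
  rcases lt_or_ge j ξ.length with h | h
  · rw [List.eraseIdx_append_of_lt_length h] at he
    have hp : cs.wordProd (ξ.eraseIdx j ++ (τ ++ [i])) = cs.wordProd (ξ ++ τ) := by
      rw [← List.append_assoc, wordProd_append, ← he]
      simp
    refine ⟨ξ.eraseIdx j, ?_, hp⟩
    rw [CoxeterSystem.IsReduced, hp, hr.eq]
    have := List.length_eraseIdx_add_one h
    simp
    omega
  · exfalso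
    rw [List.eraseIdx_append_of_length_le h, wordProd_append, wordProd_append, mul_assoc] at he
    exact hne (j - ξ.length) (by simp at hj; omega) (mul_left_cancel he)

theorem lemma_D {n : ℕ} {M : CoxeterMatrix (Fin n)} (cs : CoxeterSystem M W) (hB : Bonds M)
    {w : W} {i j : Fin n} (hij : i ≠ j)
    (hi : cs.length (w * cs.simple i) < cs.length w)
    (hj : cs.length (w * cs.simple j) < cs.length w) :
    ∃ ξ, cs.IsReduced (ξ ++ braidWord M i j) ∧ cs.wordProd (ξ ++ braidWord M i j) = w := by
  have key : ∀ i j : Fin n, i ≠ j →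
      cs.length (w * cs.simple i) < cs.length w → cs.length (w * cs.simple j) < cs.length w →
      (∃ ξ, cs.IsReduced (ξ ++ [i, j]) ∧ cs.wordProd (ξ ++ [i, j]) = w) ∧
      (3 ≤ M i j → ∃ ξ, cs.IsReduced (ξ ++ [i, j, i]) ∧ cs.wordProd (ξ ++ [i, j, i]) = w) ∧
      (M i j = 4 → ∃ ξ, cs.IsReduced (ξ ++ [i, j, i, j]) ∧
        cs.wordProd (ξ ++ [i, j, i, j]) = w) := by
    intro i j hij hi hj
    have hs := simple_ne cs hB hij
    obtain ⟨ξ₀, h0, h0'⟩ := cs.exists_isReduced w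
    obtain ⟨ξ₁, h1, h1'⟩ := D_step cs (ξ := ξ₀) (τ := []) (i := i) (by simpa using h0)
      (by simpa [← h0'] using hi) (by simp)
    simp only [List.append_nil, ← h0', List.nil_append] at h1 h1'
    obtain ⟨ξ₂, h2, h2'⟩ := D_step cs h1 (i := j) (by rwa [h1']) (by
      intro k hk
      have : k = 0 := by simpa using hk
      subst this
      simp only [List.eraseIdx_zero, List.tail_cons, wordProd_singleton, wordProd_nil]
      intro h
      apply hs
      rw [← mul_left_inj (cs.simple j), h]; simp)
    rw [h1'] at h2'
    simp only [List.cons_append, List.nil_append] at h2 h2'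
    refine ⟨⟨ξ₂, h2, h2'⟩, ?_⟩
    have e3 : 3 ≤ M i j → ∃ ξ, cs.IsReduced (ξ ++ [i, j, i]) ∧
        cs.wordProd (ξ ++ [i, j, i]) = w := by
      intro hM
      have hsq := sq_ne cs hB hM
      obtain ⟨ξ₃, h3, h3'⟩ := D_step cs h2 (i := i) (by rwa [h2']) (by
        intro k hk h
        have : k = 0 ∨ k = 1 := by simp at hk; omega
        rcases this with rfl | rfl
        · simp only [List.eraseIdx_zero, List.tail_cons, wordProd_cons] at h
          apply hsq
          rw [pow_two, ← mul_assoc]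
          rw [wordProd_nil, mul_one] at h
          rw [h]; simp
        · simp only [List.eraseIdx_cons_succ, List.eraseIdx_zero, List.tail_cons,
            wordProd_cons] at h
          simp only [wordProd_nil, mul_one] at h
          rw [mul_assoc, mul_eq_left] at h
          apply hs
          rw [← mul_left_inj (cs.simple i), simple_mul_simple_self, h])
      rw [h2'] at h3'
      exact ⟨ξ₃, h3, h3'⟩
    refine ⟨e3, ?_⟩
    intro hM
    obtain ⟨ξ₃, h3, h3'⟩ := e3 (by omega)
    have hsq := sq_ne cs hB (i := i) (j := j) (by omega)
    have hcu := cube_ne cs hB hM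
    obtain ⟨ξ₄, h4, h4'⟩ := D_step cs h3 (i := j) (by rwa [h3']) (by
      intro k hk h
      have : k = 0 ∨ k = 1 ∨ k = 2 := by simp at hk; omega
      rcases this with rfl | rfl | rfl
      · simp only [List.eraseIdx_zero, List.tail_cons, wordProd_cons, wordProd_nil, mul_one] at h
        apply hcu
        have : (cs.simple i * cs.simple j) ^ 3 =
          (cs.simple i * (cs.simple j * cs.simple i) * cs.simple j) *
            (cs.simple i * cs.simple j) := by
          simp only [pow_succ, pow_zero, one_mul, mul_assoc]
        rw [this, h]; simp [mul_assoc]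
      · simp only [List.eraseIdx_cons_succ, List.eraseIdx_zero, List.tail_cons,
            wordProd_cons, wordProd_nil, mul_one] at h
        apply hsq
        rw [pow_two]
        simpa [mul_assoc] using h
      · simp only [List.eraseIdx_cons_succ, List.eraseIdx_zero, List.tail_cons,
            wordProd_cons, wordProd_nil, mul_one] at h
        apply hs
        rw [mul_assoc, mul_assoc, mul_right_inj, mul_eq_left] at h
        rw [← mul_left_inj (cs.simple j), simple_mul_simple_self, h])
    rw [h3'] at h4'
    exact ⟨ξ₄, h4, h4'⟩
  rcases hB i j hij with h | h | h
  · rw [braidWord, h]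
    exact (key i j hij hi hj).1
  · rw [braidWord, h]
    exact (key j i hij.symm hj hi).2.1 (by rw [M.symmetric]; omega)
  · rw [braidWord, h]
    exact (key i j hij hi hj).2.2 h

end LemmaD

end TLproof

namespace TLproof

section Comm

/-- One commutation move. -/
def CStep (M : CoxeterMatrix B) (ω ω' : List B) : Prop :=
  ∃ x y i j, M i j = 2 ∧ ω = x ++ ([i, j] ++ y) ∧ ω' = x ++ ([j, i] ++ y)

/-- Commutation equivalence. -/
def Cm (M : CoxeterMatrix B) : List B → List B → Prop := Relation.ReflTransGen (CStep M)

theorem CStep.symm {M : CoxeterMatrix B} {ω ω' : List B} (h : CStep M ω ω') : CStep M ω' ω := by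
  obtain ⟨x, y, i, j, h, rfl, rfl⟩ := h
  exact ⟨x, y, j, i, by rw [M.symmetric, h], rfl, rfl⟩

theorem Cm.refl {M : CoxeterMatrix B} (ω : List B) : Cm M ω ω := Relation.ReflTransGen.refl

theorem Cm.trans {M : CoxeterMatrix B} {a b c : List B} (h : Cm M a b) (h' : Cm M b c) :
    Cm M a c := Relation.ReflTransGen.trans h h'

theorem Cm.symm {M : CoxeterMatrix B} {ω ω' : List B} (h : Cm M ω ω') : Cm M ω' ω := by
  induction h with
  | refl => exact Cm.refl _
  | tail _ h ih => exact Relation.ReflTransGen.head h.symm ih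

theorem Cm.left {M : CoxeterMatrix B} (a : List B) {ω ω' : List B} (h : Cm M ω ω') :
    Cm M (a ++ ω) (a ++ ω') := by
  induction h with
  | refl => exact Cm.refl _
  | tail _ h ih =>
    refine Relation.ReflTransGen.tail ih ?_
    obtain ⟨x, y, i, j, h, rfl, rfl⟩ := h
    exact ⟨a ++ x, y, i, j, h, by simp, by simp⟩

theorem Cm.right {M : CoxeterMatrix B} {ω ω' : List B} (h : Cm M ω ω') (a : List B) :
    Cm M (ω ++ a) (ω' ++ a) := by
  induction h with
  | refl => exact Cm.refl _
  | tail _ h ih =>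
    refine Relation.ReflTransGen.tail ih ?_
    obtain ⟨x, y, i, j, h, rfl, rfl⟩ := h
    exact ⟨x, y ++ a, i, j, h, by simp, by simp⟩

theorem Cm.swap {M : CoxeterMatrix B} {i j : B} (h : M i j = 2) : Cm M [i, j] [j, i] :=
  Relation.ReflTransGen.single ⟨[], [], i, j, h, rfl, rfl⟩

theorem Cm.move {M : CoxeterMatrix B} {s : B} {u : List B} (h : ∀ x ∈ u, M x s = 2) :
    Cm M (u ++ [s]) (s :: u) := by
  induction u with
  | nil => exact Cm.refl _
  | cons a u ih =>
    have h1 := (ih (fun x hx => h x (List.mem_cons_of_mem _ hx))).left [a]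
    have h2 := (Cm.swap (h a List.mem_cons_self)).right u
    exact h1.trans h2

theorem Cm.block {M : CoxeterMatrix B} {u v : List B} (h : ∀ x ∈ u, ∀ y ∈ v, M x y = 2) :
    Cm M (u ++ v) (v ++ u) := by
  induction v with
  | nil => simpa using Cm.refl _
  | cons a v ih =>
    have h1 := (Cm.move (s := a) (fun x hx => h x hx a List.mem_cons_self)).right v
    have h2 := (ih (fun x hx y hy => h x hx y (List.mem_cons_of_mem _ hy))).left [a]
    have e : u ++ a :: v = u ++ [a] ++ v := by simp
    rw [e]
    exact h1.trans h2

theorem Cm.length {M : CoxeterMatrix B} {ω ω' : List B} (h : Cm M ω ω') :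
    ω.length = ω'.length := by
  induction h with
  | refl => rfl
  | tail _ h ih =>
    obtain ⟨x, y, i, j, h, rfl, rfl⟩ := h
    rw [ih]; simp

theorem simple_comm {M : CoxeterMatrix B} (cs : CoxeterSystem M W) {i j : B} (h : M i j = 2) :
    cs.simple i * cs.simple j = cs.simple j * cs.simple i := by
  have h2 := cs.simple_mul_simple_pow i j
  rw [h, pow_two, mul_eq_one_iff_eq_inv] at h2
  simpa using h2

theorem Cm.wordProd {M : CoxeterMatrix B} (cs : CoxeterSystem M W) {ω ω' : List B}
    (h : Cm M ω ω') : cs.wordProd ω = cs.wordProd ω' := by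
  induction h with
  | refl => rfl
  | tail _ h ih =>
    obtain ⟨x, y, i, j, h, rfl, rfl⟩ := h
    rw [ih]
    have := simple_comm cs h
    simp [wordProd_append, wordProd_cons, ← mul_assoc]
    simp [mul_assoc, this]

theorem Cm.reduced {M : CoxeterMatrix B} (cs : CoxeterSystem M W) {ω ω' : List B}
    (h : Cm M ω ω') (hr : cs.IsReduced ω) : cs.IsReduced ω' := by
  rw [CoxeterSystem.IsReduced, ← h.wordProd cs, ← h.length]; exact hr

/-- Reduced word of a fully commutative element. -/
def FCw {M : CoxeterMatrix B} (cs : CoxeterSystem M W) (ω : List B) : Prop :=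
  cs.IsReduced ω ∧ cs.FC (cs.wordProd ω)

theorem FCw.comm {M : CoxeterMatrix B} {cs : CoxeterSystem M W} {ω ω' : List B}
    (hf : FCw cs ω) (h : Cm M ω ω') : FCw cs ω' :=
  ⟨h.reduced cs hf.1, h.wordProd cs ▸ hf.2⟩

theorem red_left {M : CoxeterMatrix B} {cs : CoxeterSystem M W} {x y : List B}
    (h : cs.IsReduced (x ++ y)) : cs.IsReduced x := by
  have := h.take x.length
  simpa using this

theorem red_right {M : CoxeterMatrix B} {cs : CoxeterSystem M W} {x y : List B}
    (h : cs.IsReduced (x ++ y)) : cs.IsReduced y := by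
  have := h.drop x.length
  simpa using this

theorem FCw.no_braid {M : CoxeterMatrix B} {cs : CoxeterSystem M W} {x y : List B} {i j : B}
    (h : FCw cs (x ++ (braidWord M i j ++ y))) (hM : 3 ≤ M i j) : False := by
  apply h.2
  refine ⟨cs.wordProd x, cs.wordProd y, i, j, hM, ?_, ?_⟩
  · simp [wordProd_append, mul_assoc]
  · rw [h.1.eq, (red_left h.1).eq, (red_right (red_right h.1)).eq]
    simp; omega

theorem FCw.no_sq {M : CoxeterMatrix B} {cs : CoxeterSystem M W} {x y : List B} {i : B}
    (h : FCw cs (x ++ ([i, i] ++ y))) : False := by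
  have h1 := (red_left (red_right h.1)).eq
  simp [wordProd_cons] at h1

theorem FCw.pre {M : CoxeterMatrix B} {cs : CoxeterSystem M W} {x y : List B}
    (h : FCw cs (x ++ y)) : FCw cs x := by
  refine ⟨red_left h.1, ?_⟩
  rintro ⟨x₁, x₂, i, j, hM, he, hl⟩
  apply h.2
  refine ⟨x₁, x₂ * cs.wordProd y, i, j, hM, ?_, ?_⟩
  · rw [wordProd_append, he]; simp [mul_assoc]
  · have h1 := h.1.eq
    have h2 := (red_left h.1).eq
    have h3 := cs.length_mul_le x₂ (cs.wordProd y)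
    have h4 := cs.length_wordProd_le y
    have h5 := cs.length_mul_le x₁ (cs.wordProd (braidWord M i j) * (x₂ * cs.wordProd y))
    have h6 := cs.length_mul_le (cs.wordProd (braidWord M i j)) (x₂ * cs.wordProd y)
    have h7 := cs.length_wordProd_le (braidWord M i j)
    have h8 : cs.wordProd (x ++ y) =
        x₁ * (cs.wordProd (braidWord M i j) * (x₂ * cs.wordProd y)) := by
      rw [wordProd_append, he]; simp [mul_assoc]
    rw [← h8] at h5
    simp at h1 h7
    omega

/-- A word contains a long braid word. -/
def HasBraid (M : CoxeterMatrix B) (ω : List B) : Prop :=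
  ∃ x y i j, 3 ≤ M i j ∧ ω = x ++ (braidWord M i j ++ y)

theorem HasBraid.right {M : CoxeterMatrix B} {ω : List B} (h : HasBraid M ω) (a : List B) :
    HasBraid M (ω ++ a) := by
  obtain ⟨x, y, i, j, h, rfl⟩ := h
  exact ⟨x, y ++ a, i, j, h, by simp⟩

theorem descent_of_concat {M : CoxeterMatrix B} {cs : CoxeterSystem M W} {ω : List B} {i : B}
    (h : cs.IsReduced (ω ++ [i])) :
    cs.length (cs.wordProd (ω ++ [i]) * cs.simple i) < cs.length (cs.wordProd (ω ++ [i])) := by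
  rw [h.eq, wordProd_append]
  simp [(red_left h).eq]

theorem braid_concat (M : CoxeterMatrix B) (i j : B) (h : M i j ≠ 0) :
    braidWord M i j = alternatingWord j i (M i j - 1) ++ [j] := by
  obtain ⟨k, hk⟩ := Nat.exists_eq_succ_of_ne_zero h
  rw [braidWord, hk, Nat.succ_eq_add_one, alternatingWord_succ]
  simp

/-- Word property, in the form needed here. -/
theorem matsumoto {n : ℕ} {M : CoxeterMatrix (Fin n)} (cs : CoxeterSystem M W) (hB : Bonds M) :
    ∀ (k : ℕ) (ω ω' : List (Fin n)), ω.length = k → cs.IsReduced ω → cs.IsReduced ω' →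
      cs.wordProd ω = cs.wordProd ω' →
      Cm M ω ω' ∨ ∃ u, Cm M ω u ∧ HasBraid M u := by
  intro k
  induction k with
  | zero =>
    intro ω ω' hk h h' he
    have h1 : ω = [] := List.length_eq_zero_iff.1 hk
    have h2 : ω' = [] := by
      apply List.length_eq_zero_iff.1
      rw [← h'.eq, ← he, h.eq, hk]
    subst h1 h2
    exact Or.inl (Cm.refl _)
  | succ k IH =>
    intro ω ω' hk h h' he
    have hk' : ω'.length = k + 1 := by rw [← h'.eq, ← he, h.eq, hk]
    obtain ⟨ω₁, i, rfl⟩ : ∃ ω₁ i, ω = ω₁ ++ [i] := by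
      rcases List.eq_nil_or_concat ω with rfl | ⟨a, b, rfl⟩
      · simp at hk
      · exact ⟨a, b, by simp⟩
    obtain ⟨ω₁', j, rfl⟩ : ∃ ω₁ i, ω' = ω₁ ++ [i] := by
      rcases List.eq_nil_or_concat ω' with rfl | ⟨a, b, rfl⟩
      · simp at hk'
      · exact ⟨a, b, by simp⟩
    have hk1 : ω₁.length = k := by simpa using hk
    have hk1' : ω₁'.length = k := by simpa using hk'
    have cancel : ∀ (a b : List (Fin n)) (i : Fin n),
        cs.wordProd (a ++ [i]) = cs.wordProd (b ++ [i]) → cs.wordProd a = cs.wordProd b := by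
      intro a b i h
      simpa [wordProd_append] using h
    -- wrap the induction hypothesis
    have IH' : ∀ (a b : List (Fin n)) (i : Fin n), a.length = k → cs.IsReduced (a ++ [i]) →
        cs.IsReduced (b ++ [i]) → cs.wordProd (a ++ [i]) = cs.wordProd (b ++ [i]) →
        Cm M (a ++ [i]) (b ++ [i]) ∨ ∃ u, Cm M (a ++ [i]) u ∧ HasBraid M u := by
      intro a b i ha h1 h2 h3
      rcases IH a b ha (red_left h1) (red_left h2) (cancel _ _ _ h3) with h | ⟨u, hu, hb⟩
      · exact Or.inl (h.right _)
      · exact Or.inr ⟨u ++ [i], hu.right _, hb.right _⟩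
    by_cases hij : i = j
    · subst hij
      exact IH' _ _ _ hk1 h h' he
    · have di := descent_of_concat h
      have dj := descent_of_concat h'
      rw [← he] at dj
      obtain ⟨ξ, hξ, hξ'⟩ := lemma_D cs hB (fun h => hij h.symm) dj di
      have hM0 : M j i ≠ 0 := by
        rcases hB j i (fun h => hij h.symm) with h | h | h <;> omega
      have hb := braid_concat M j i hM0
      have r1 : Cm M (ω₁ ++ [i]) (ξ ++ braidWord M j i) ∨
          ∃ u, Cm M (ω₁ ++ [i]) u ∧ HasBraid M u := by
        rw [hb, ← List.append_assoc] at hξ hξ' ⊢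
        exact IH' _ _ _ hk1 h hξ hξ'.symm
      rcases r1 with r1 | r1
      swap
      · exact Or.inr r1
      by_cases h3 : 3 ≤ M j i
      · exact Or.inr ⟨_, r1, ⟨ξ, [], j, i, h3, by simp⟩⟩
      · have h2 : M j i = 2 := by
          rcases hB j i (fun h => hij h.symm) with h | h | h <;> omega
        have e2 : braidWord M j i = [j, i] := by rw [braidWord, h2]; rfl
        rw [e2] at r1
        have r2 : Cm M (ω₁ ++ [i]) (ξ ++ [i] ++ [j]) := by
          refine r1.trans ?_
          simpa using (Cm.swap h2).left ξ
        have hr2 := r2.reduced cs h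
        have hp2 := r2.wordProd cs
        have hl2 := r2.length
        rcases IH' (ξ ++ [i]) ω₁' j (by simp at hl2 ⊢; omega) hr2 h' (hp2.symm.trans he) with
          h4 | ⟨u, hu, hbu⟩
        · exact Or.inl (r2.trans h4)
        · exact Or.inr ⟨u, r2.trans hu, hbu⟩

theorem FCw.unique {n : ℕ} {M : CoxeterMatrix (Fin n)} {cs : CoxeterSystem M W} (hB : Bonds M)
    {ω ω' : List (Fin n)} (h : FCw cs ω) (h' : cs.IsReduced ω')
    (he : cs.wordProd ω = cs.wordProd ω') : Cm M ω ω' := by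
  rcases matsumoto cs hB _ ω ω' rfl h.1 h' he with h1 | ⟨u, hu, x, y, i, j, hM, rfl⟩
  · exact h1
  · exact ((h.comm hu).no_braid hM).elim

theorem exists_braid {n : ℕ} {M : CoxeterMatrix (Fin n)} {cs : CoxeterSystem M W} (hB : Bonds M)
    {ω : List (Fin n)} (h : cs.IsReduced ω) (hn : ¬ FCw cs ω) :
    ∃ u, Cm M ω u ∧ HasBraid M u := by
  have hc : cs.IsComplexElt (cs.wordProd ω) := by
    by_contra hc
    exact hn ⟨h, hc⟩
  obtain ⟨x₁, x₂, i, j, hM, he, hl⟩ := hc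
  obtain ⟨ξ₁, h1, rfl⟩ := cs.exists_isReduced x₁
  obtain ⟨ξ₂, h2, rfl⟩ := cs.exists_isReduced x₂
  have hp : cs.wordProd ω = cs.wordProd (ξ₁ ++ (braidWord M i j ++ ξ₂)) := by
    rw [he]; simp [wordProd_append, mul_assoc]
  have hr : cs.IsReduced (ξ₁ ++ (braidWord M i j ++ ξ₂)) := by
    rw [CoxeterSystem.IsReduced, ← hp, hl, h1.eq, h2.eq]
    simp; omega
  rcases matsumoto cs hB _ _ _ rfl h hr hp with h3 | h3
  · exact ⟨_, h3, ξ₁, ξ₂, i, j, hM, rfl⟩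
  · exact h3

end Comm

end TLproof

namespace TLproof

section Words

theorem split3 {x L y u v : List B} {s : B} (h : x ++ (L ++ y) = u ++ s :: v) :
    (∃ t, x = u ++ s :: t ∧ v = t ++ (L ++ y)) ∨
    (∃ t, u = x ++ (L ++ t) ∧ y = t ++ s :: v) ∨
    (∃ L₁ L₂, L = L₁ ++ s :: L₂ ∧ u = x ++ L₁ ∧ v = L₂ ++ y) := by
  rcases List.append_eq_append_iff.1 h with ⟨a, rfl, h1⟩ | ⟨a, rfl, h1⟩
  · rcases List.append_eq_append_iff.1 h1 with ⟨b, rfl, h2⟩ | ⟨b, rfl, h2⟩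
    · right; left
      exact ⟨b, by simp, h2⟩
    · rcases b with _ | ⟨c, b⟩
      · simp at h2
        right; left
        exact ⟨[], by simp, by simp [← h2]⟩
      · simp at h2
        obtain ⟨rfl, rfl⟩ := h2
        right; right
        exact ⟨a, b, rfl, rfl, rfl⟩
  · rcases a with _ | ⟨c, b⟩
    · simp at h1
      rcases L with _ | ⟨d, L⟩
      · right; left
        exact ⟨[], by simp, by simpa using h1.symm⟩
      · simp at h1
        obtain ⟨rfl, rfl⟩ := h1
        right; right
        exact ⟨[], L, by simp, by simp, by simp⟩
    · simp at h1
      obtain ⟨rfl, rfl⟩ := h1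
      left
      exact ⟨b, rfl, by simp⟩

/-- `r` can be commuted to the end of `ω`. -/
def EndW (M : CoxeterMatrix B) (r : B) (ω : List B) : Prop :=
  ∃ u v, ω = u ++ r :: v ∧ ∀ x ∈ v, M x r = 2

theorem EndW.last (M : CoxeterMatrix B) (r : B) (ω : List B) : EndW M r (ω ++ [r]) :=
  ⟨ω, [], rfl, by simp⟩

theorem EndW.cm {M : CoxeterMatrix B} {r : B} {ω : List B} (h : EndW M r ω) :
    ∃ u, Cm M ω (u ++ [r]) := by
  obtain ⟨u, v, rfl, hv⟩ := h
  refine ⟨u ++ v, ?_⟩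
  have := ((Cm.move hv).symm).left u
  simpa using this

theorem Cm.del {M : CoxeterMatrix B} {ω u : List B} {s : B} (h : Cm M (ω ++ [s]) u) :
    ∃ u₁ u₂, u = u₁ ++ s :: u₂ ∧ (∀ x ∈ u₂, M x s = 2) ∧ Cm M ω (u₁ ++ u₂) := by
  induction h with
  | refl => exact ⟨ω, [], rfl, by simp, by simpa using Cm.refl _⟩
  | tail _ hs ih =>
    obtain ⟨x, y, i, j, hij, rfl, rfl⟩ := hs
    obtain ⟨u₁, u₂, he, hc, hcm⟩ := ih
    rcases split3 he with ⟨t, rfl, rfl⟩ | ⟨t, rfl, rfl⟩ | ⟨L₁, L₂, hL, rfl, rfl⟩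
    · refine ⟨u₁, t ++ ([j, i] ++ y), by simp, ?_, hcm.trans ?_⟩
      · intro z hz
        apply hc
        simp at hz ⊢
        tauto
      · have := (((Cm.swap hij).right y).left (u₁ ++ t))
        simpa using this
    · refine ⟨x ++ ([j, i] ++ t), u₂, by simp, hc, hcm.trans ?_⟩
      have := (((Cm.swap hij).right (t ++ u₂)).left x)
      simpa using this
    · rcases L₁ with _ | ⟨a, L₁⟩
      · simp at hL
        obtain ⟨rfl, rfl⟩ := hL
        refine ⟨x ++ [j], y, by simp, ?_, ?_⟩
        · intro z hz
          apply hc; simp [hz]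
        · simpa using hcm
      · rcases L₁ with _ | ⟨b, L₁⟩
        · simp at hL
          obtain ⟨rfl, rfl, rfl⟩ := hL
          refine ⟨x, i :: y, by simp, ?_, ?_⟩
          · intro z hz
            simp at hz
            rcases hz with rfl | hz
            · exact hij
            · apply hc; simp [hz]
          · simpa using hcm
        · simp at hL

theorem EndW.comm {M : CoxeterMatrix B} {r : B} {ω ω' : List B} (h : EndW M r ω)
    (hc : Cm M ω ω') : EndW M r ω' := by
  obtain ⟨u, hu⟩ := h.cm
  obtain ⟨u₁, u₂, he, h2, _⟩ := Cm.del (hu.symm.trans hc)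
  exact ⟨u₁, u₂, he, h2⟩

/-- Elementary reductions. -/
inductive BaseR (M : CoxeterMatrix B) : List B → ℕ → ℕ → List B → Prop
  | comm (i j : B) : M i j = 2 → BaseR M [i, j] 1 0 [j, i]
  | sq (i : B) : BaseR M [i, i] 1 1 [i]
  | b3 (i j : B) : M i j = 3 → BaseR M [i, j, i] 1 0 [i]
  | b4 (i j : B) : M i j = 4 → BaseR M [i, j, i, j] 2 0 [i, j]

theorem BaseR.sub {M : CoxeterMatrix B} {L L' : List B} {a m : ℕ} (h : BaseR M L a m L') :
    ∀ x ∈ L', x ∈ L := by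
  cases h <;> simp

theorem BaseR.endW {M : CoxeterMatrix B} {L L' : List B} {a m : ℕ} (h : BaseR M L a m L')
    {r : B} (he : EndW M r L) : EndW M r L' := by
  cases h with
  | comm i j hij => exact he.comm (Cm.swap hij)
  | sq i =>
    obtain ⟨u, v, h1, h2⟩ := he
    have : r = i := by
      have : r ∈ [i, i] := by rw [h1]; simp
      simpa using this
    subst this
    exact ⟨[], [], rfl, by simp⟩
  | b3 i j hij =>
    obtain ⟨u, v, h1, h2⟩ := he
    rcases u with _ | ⟨a, _ | ⟨b, _ | ⟨c, u⟩⟩⟩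
    · simp at h1; obtain ⟨rfl, rfl⟩ := h1
      exact ⟨[], [], rfl, by simp⟩
    · simp at h1; obtain ⟨rfl, rfl, rfl⟩ := h1
      have := h2 i (by simp)
      omega
    · simp at h1; obtain ⟨rfl, rfl, rfl, rfl⟩ := h1
      exact ⟨[], [], rfl, by simp⟩
    · simp at h1
  | b4 i j hij =>
    obtain ⟨u, v, h1, h2⟩ := he
    rcases u with _ | ⟨a, _ | ⟨b, _ | ⟨c, _ | ⟨d, u⟩⟩⟩⟩
    · simp at h1; obtain ⟨rfl, rfl⟩ := h1
      have := h2 j (by simp)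
      rw [M.symmetric] at this
      omega
    · simp at h1; obtain ⟨rfl, rfl, rfl⟩ := h1
      exact ⟨[i], [], rfl, by simp⟩
    · simp at h1; obtain ⟨rfl, rfl, rfl, rfl⟩ := h1
      have := h2 j (by simp)
      rw [M.symmetric] at this
      omega
    · simp at h1; obtain ⟨rfl, rfl, rfl, rfl, rfl⟩ := h1
      exact ⟨[i], [], rfl, by simp⟩
    · simp at h1

/-- Reductions in context. -/
inductive RedR (M : CoxeterMatrix B) : List B → ℕ → ℕ → List B → Prop
  | refl (ω : List B) : RedR M ω 1 0 ω
  | step {x y L L' ω' : List B} {a m b k : ℕ} : BaseR M L a m L' →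
      RedR M (x ++ (L' ++ y)) b k ω' → RedR M (x ++ (L ++ y)) (a * b) (m + k) ω'

theorem RedR.endW {M : CoxeterMatrix B} {L L' : List B} {a m : ℕ} (h : RedR M L a m L')
    {r : B} (he : EndW M r L) : EndW M r L' := by
  induction h with
  | refl => exact he
  | step hb _ ih =>
    apply ih
    obtain ⟨u, v, h1, h2⟩ := he
    rcases split3 h1 with ⟨t, rfl, rfl⟩ | ⟨t, rfl, rfl⟩ | ⟨L₁, L₂, rfl, rfl, rfl⟩
    · refine ⟨u, _, by simp; rfl, ?_⟩
      intro z hz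
      apply h2
      simp at hz ⊢
      rcases hz with hz | hz | hz
      · tauto
      · have := hb.sub z hz; tauto
      · tauto
    · exact ⟨_ , _, by rw [← List.append_assoc, ← List.append_assoc], h2⟩
    · obtain ⟨u', v', rfl, h3⟩ := hb.endW ⟨L₁, L₂, rfl, fun x hx => h2 x (by simp [hx])⟩
      refine ⟨_ ++ u', v' ++ _, by simp; rfl, ?_⟩
      intro z hz
      rcases List.mem_append.1 hz with hz | hz
      · exact h3 z hz
      · exact h2 z (by simp [hz])

theorem RedR.trans {M : CoxeterMatrix B} {L L' L'' : List B} {a m b k : ℕ}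
    (h : RedR M L a m L') (h' : RedR M L' b k L'') : RedR M L (a * b) (m + k) L'' := by
  induction h with
  | refl => simpa using h'
  | step hb _ ih =>
    rw [mul_assoc, add_assoc]
    exact RedR.step hb (ih h')

theorem RedR.right {M : CoxeterMatrix B} {L L' : List B} {a m : ℕ}
    (h : RedR M L a m L') (z : List B) : RedR M (L ++ z) a m (L' ++ z) := by
  induction h with
  | refl => exact RedR.refl _
  | step hb _ ih =>
    simp only [List.append_assoc] at ih ⊢
    exact RedR.step hb ih

theorem RedR.base {M : CoxeterMatrix B} {L L' : List B} {a m : ℕ} (h : BaseR M L a m L')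
    (x y : List B) : RedR M (x ++ (L ++ y)) a m (x ++ (L' ++ y)) := by
  simpa using RedR.step h (RedR.refl (x ++ (L' ++ y)))

theorem RedR.cm {M : CoxeterMatrix B} {L L' : List B} (h : Cm M L L') : RedR M L 1 0 L' := by
  induction h with
  | refl => exact RedR.refl _
  | tail _ hs ih =>
    obtain ⟨x, y, i, j, hij, rfl, rfl⟩ := hs
    simpa using ih.trans (RedR.base (BaseR.comm i j hij) x y)

theorem BaseR.sound {M : CoxeterMatrix B} {L L' : List B} {a m : ℕ} (h : BaseR M L a m L') :
    bprod M L = a • (qc ^ m • bprod M L') := by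
  cases h with
  | comm i j hij =>
    have := RingQuot.mkAlgHom_rel LA (TLRel.comm (M := M) i j hij)
    simpa [bprod, bgen] using this
  | sq i =>
    have := RingQuot.mkAlgHom_rel LA (TLRel.sq (M := M) i)
    simpa [bprod, bgen] using this
  | b3 i j hij =>
    have := RingQuot.mkAlgHom_rel LA (TLRel.braid3 (M := M) i j hij)
    simpa [bprod, bgen, mul_assoc] using this
  | b4 i j hij =>
    have := RingQuot.mkAlgHom_rel LA (TLRel.braid4 (M := M) i j hij)
    simpa [bprod, bgen, mul_assoc, two_mul, two_smul] using this

theorem bprod_append (M : CoxeterMatrix B) (x y : List B) :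
    bprod M (x ++ y) = bprod M x * bprod M y := by
  simp [bprod]

theorem RedR.sound {M : CoxeterMatrix B} {L L' : List B} {a m : ℕ} (h : RedR M L a m L') :
    bprod M L = a • (qc ^ m • bprod M L') := by
  induction h with
  | refl => simp
  | @step x y L L' ω' a m b k hb _ ih =>
    rw [bprod_append, bprod_append, hb.sound]
    rw [smul_mul_assoc, mul_smul_comm, smul_mul_assoc, mul_smul_comm, ← bprod_append,
      ← bprod_append, ih, smul_comm (qc ^ m) b, smul_smul, smul_smul, pow_add]

end Words

end TLproof

namespace TLproof

section Main

/-- The Coxeter graph is a path, with a possible bond of order four at the far end. -/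
structure PathM {n : ℕ} (M : CoxeterMatrix (Fin n)) : Prop where
  bonds : Bonds M
  adj : ∀ i j : Fin n, 3 ≤ M i j → (i : ℕ) + 1 = j ∨ (j : ℕ) + 1 = i
  four : ∀ i j : Fin n, M i j = 4 →
    ((i : ℕ) + 1 = n ∧ (j : ℕ) + 2 = n) ∨ ((j : ℕ) + 1 = n ∧ (i : ℕ) + 2 = n)

/-- The possible prefixes `p` such that `p s' s` reduces to `p`. -/
def PreW (M : CoxeterMatrix B) (s s' : B) (p : List B) : Prop :=
  (M s s' = 3 ∧ p = [s]) ∨ (M s s' = 4 ∧ p = [s', s])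

theorem ne_of_three {M : CoxeterMatrix B} {i j : B} (h : 3 ≤ M i j) : i ≠ j := by
  rintro rfl
  simp at h

theorem ne_of_two {M : CoxeterMatrix B} {i j : B} (h : M i j = 2) : i ≠ j := by
  rintro rfl
  simp at h

theorem PreW.three {M : CoxeterMatrix B} {s s' : B} {p : List B} (h : PreW M s s' p) :
    3 ≤ M s s' := by
  rcases h with h | h <;> omega

theorem PreW.red {M : CoxeterMatrix B} {s s' : B} {p : List B} (h : PreW M s s' p)
    (x : List B) {y : List B} (hy : ∀ k ∈ y, M k s = 2) :
    ∃ a, RedR M (x ++ (p ++ s' :: y) ++ [s]) a 0 (x ++ (p ++ y)) := by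
  have h1 : RedR M (x ++ (p ++ s' :: y) ++ [s]) 1 0 (x ++ (p ++ [s', s] ++ y)) := by
    apply RedR.cm
    have := (Cm.move hy).left (x ++ (p ++ [s']))
    simpa using this
  rcases h with ⟨h, rfl⟩ | ⟨h, rfl⟩
  · have := h1.trans (RedR.base (BaseR.b3 s s' h) x y)
    exact ⟨_, this⟩
  · have := h1.trans (RedR.base (BaseR.b4 s' s (by rw [M.symmetric, h])) x y)
    exact ⟨_, this⟩

theorem brk {n : ℕ} {M : CoxeterMatrix (Fin n)} {cs : CoxeterSystem M W} (hB : Bonds M)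
    {ω : List (Fin n)} {s : Fin n} (hω : FCw cs ω) (hn : ¬ FCw cs (ω ++ [s]))
    (he : ¬ EndW M s ω) :
    ∃ s' p y₁ y₂, PreW M s s' p ∧ Cm M ω (y₁ ++ (p ++ s' :: y₂)) ∧ ∀ x ∈ y₂, M x s = 2 := by
  have hr : cs.IsReduced (ω ++ [s]) := by
    by_contra hr
    apply he
    obtain ⟨ξ, hξ, hξ'⟩ := cs.exists_isReduced (cs.wordProd ω * cs.simple s)
    have hl := cs.length_mul_simple (cs.wordProd ω) s
    have hp : cs.wordProd (ω ++ [s]) = cs.wordProd ω * cs.simple s := by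
      simp [wordProd_append]
    have hl2 : cs.length (cs.wordProd ω * cs.simple s) + 1 = cs.length (cs.wordProd ω) := by
      rcases hl with hl | hl
      · exfalso; apply hr
        rw [CoxeterSystem.IsReduced, hp, hl, hω.1.eq]; simp
      · exact hl
    have hw : cs.wordProd (ξ ++ [s]) = cs.wordProd ω := by
      simp [wordProd_append, ← hξ']
    have hr2 : cs.IsReduced (ξ ++ [s]) := by
      rw [CoxeterSystem.IsReduced, hw, ← hl2, hξ', hξ.eq]; simp
    exact (EndW.last M s ξ).comm (hω.unique hB hr2 hw.symm).symm
  obtain ⟨u, hu, x, y, i, j, hM, rfl⟩ := exists_braid hB hr hn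
  obtain ⟨u₁, u₂, h1, h2, h3⟩ := hu.del
  rcases split3 h1 with ⟨t, rfl, rfl⟩ | ⟨t, rfl, rfl⟩ | ⟨L₁, L₂, hL, rfl, rfl⟩
  · exfalso
    have := hω.comm h3
    rw [← List.append_assoc] at this
    exact this.no_braid hM
  · exfalso
    have := hω.comm h3
    simp only [List.append_assoc] at this
    exact this.no_braid hM
  · have hij := ne_of_three hM
    rcases hB i j hij with h | h | h
    · omega
    · have e : braidWord M i j = [j, i, j] := by rw [braidWord, h]; rfl
      rw [e] at hL
      rcases L₁ with _ | ⟨a, _ | ⟨b, _ | ⟨c, u⟩⟩⟩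
      · simp at hL; obtain ⟨rfl, rfl⟩ := hL
        have := h2 i (by simp); omega
      · simp at hL; obtain ⟨rfl, rfl, rfl⟩ := hL
        have := h2 j (by simp); rw [M.symmetric] at this; omega
      · simp at hL; obtain ⟨rfl, rfl, rfl, rfl⟩ := hL
        refine ⟨i, [j], x, y, Or.inl ⟨by rw [M.symmetric, h], rfl⟩, by simpa using h3, ?_⟩
        simpa using h2
      · simp at hL
    · have e : braidWord M i j = [i, j, i, j] := by rw [braidWord, h]; rfl
      rw [e] at hL
      rcases L₁ with _ | ⟨a, _ | ⟨b, _ | ⟨c, _ | ⟨d, u⟩⟩⟩⟩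
      · simp at hL; obtain ⟨rfl, rfl⟩ := hL
        have := h2 j (by simp); rw [M.symmetric] at this; omega
      · simp at hL; obtain ⟨rfl, rfl, rfl⟩ := hL
        have := h2 i (by simp); omega
      · simp at hL; obtain ⟨rfl, rfl, rfl, rfl⟩ := hL
        have := h2 j (by simp); rw [M.symmetric] at this; omega
      · simp at hL; obtain ⟨rfl, rfl, rfl, rfl, rfl⟩ := hL
        refine ⟨i, [i, j], x, y, Or.inr ⟨by rw [M.symmetric, h], rfl⟩, by simpa using h3, ?_⟩
        simpa using h2
      · simp at hL

theorem not_both {M : CoxeterMatrix B} {s s' : B} {ω : List B} (h : EndW M s ω)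
    (h' : EndW M s' ω) (h3 : 3 ≤ M s s') : False := by
  obtain ⟨u, hu⟩ := h'.cm
  obtain ⟨a, b, e, hb⟩ := h.comm hu
  rcases List.eq_nil_or_concat b with rfl | ⟨b, k, rfl⟩
  · have := List.append_inj_right' e rfl
    simp at this
    exact ne_of_three h3 this.symm
  · have : u ++ [s'] = (a ++ s :: b) ++ [k] := by simpa using e
    have := List.append_inj_right' this rfl
    simp at this
    subst this
    have := hb s' (by simp)
    rw [M.symmetric] at this
    omega

theorem lemma_Mo {n : ℕ} {M : CoxeterMatrix (Fin n)} {cs : CoxeterSystem M W} (hB : Bonds M)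
    {ω : List (Fin n)} {s s' : Fin n} (hω : FCw cs ω) (he : EndW M s' ω) (h3 : 3 ≤ M s s') :
    ∃ ω' a, RedR M (ω ++ [s]) a 0 ω' ∧ FCw cs ω' := by
  by_cases hn : FCw cs (ω ++ [s])
  · exact ⟨_, _, RedR.refl _, hn⟩
  obtain ⟨t, p, y₁, y₂, hp, hc, hy⟩ := brk hB hω hn (fun h => not_both h he h3)
  have hs : M s' s = M s s' := M.symmetric _ _
  have key : s' = t ∧ ∀ x ∈ y₂, M x s' = 2 := by
    obtain ⟨u, v, e, hv⟩ := he.comm hc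
    rcases split3 e with ⟨r, rfl, rfl⟩ | ⟨r, rfl, e2⟩ | ⟨L₁, L₂, rfl, rfl, rfl⟩
    · exfalso
      have := hv s (by rcases hp with ⟨_, rfl⟩ | ⟨_, rfl⟩ <;> simp)
      omega
    · rcases r with _ | ⟨a, r⟩
      · simp at e2
        obtain ⟨rfl, rfl⟩ := e2
        exact ⟨rfl, hv⟩
      · exfalso
        simp at e2
        have := hy s' (by rw [e2.2]; simp)
        omega
    · exfalso
      rcases L₂ with _ | ⟨a, L₂⟩
      · have : s' = s := by
          rcases hp with ⟨_, h⟩ | ⟨_, h⟩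
          · exact (List.append_inj_right' (s₁ := L₁) (s₂ := []) h rfl |> List.cons.inj).1
          · exact (List.append_inj_right' (s₁ := L₁) (s₂ := [t]) h rfl |> List.cons.inj).1
        exact ne_of_three h3 this.symm
      · have : s ∈ a :: L₂ := by
          rcases hp with ⟨_, h⟩ | ⟨_, h⟩
          · rcases L₁ with _ | ⟨b, L₁⟩ <;> simp at h
          · rcases L₁ with _ | ⟨b, L₁⟩
            · simp at h; simp [h.2]
            · rcases L₁ with _ | ⟨b, L₁⟩ <;> simp at h
        have := hv s (List.mem_append_left _ this)
        omega
  obtain ⟨rfl, hy'⟩ := key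
  obtain ⟨a, ha⟩ := hp.red y₁ hy
  have := (RedR.cm (hc.right [s])).trans ha
  refine ⟨_, _, this, ?_⟩
  have h5 := hω.comm hc
  have h6 : Cm M (y₁ ++ (p ++ s' :: y₂)) (y₁ ++ (p ++ y₂) ++ [s']) := by
    have := ((Cm.move hy').symm).left (y₁ ++ p)
    simpa using this
  exact (h5.comm h6).pre

theorem chain_mul {n : ℕ} {M : CoxeterMatrix (Fin n)} {cs : CoxeterSystem M W} (hB : Bonds M)
    (c : List (Fin n)) : ∀ (t : Fin n) (z : List (Fin n)), FCw cs z → EndW M t z →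
    (t :: c).IsChain (fun a b => 3 ≤ M a b) →
    ∃ z' a, RedR M (z ++ c) a 0 z' ∧ FCw cs z' := by
  induction c with
  | nil =>
    intro t z hz _ _
    exact ⟨z, 1, by simpa using RedR.refl z, hz⟩
  | cons k c ih =>
    intro t z hz he hc
    rw [List.isChain_cons_cons] at hc
    obtain ⟨z₁, a, h1, h2⟩ := lemma_Mo hB hz he (s := k) (by rw [M.symmetric]; exact hc.1)
    obtain ⟨z₂, b, h3, h4⟩ := ih k z₁ h2 (h1.endW (EndW.last _ _ _)) hc.2
    refine ⟨z₂, a * b, ?_, h4⟩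
    have := (h1.right c).trans h3
    simpa using this

theorem no_three {n : ℕ} {M : CoxeterMatrix (Fin n)} {cs : CoxeterSystem M W}
    {x y : List (Fin n)} {j k : Fin n} (h : M j k = 3)
    (hf : FCw cs (x ++ ([j, k, j] ++ y))) : False := by
  have h' : M k j = 3 := by rw [M.symmetric, h]
  have e : braidWord M k j = [j, k, j] := by rw [braidWord, h']; rfl
  rw [← e] at hf
  exact hf.no_braid (by omega)

theorem no_four {n : ℕ} {M : CoxeterMatrix (Fin n)} {cs : CoxeterSystem M W}
    {x y : List (Fin n)} {j k : Fin n} (h : M k j = 4)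
    (hf : FCw cs (x ++ ([k, j, k, j] ++ y))) : False := by
  have e : braidWord M k j = [k, j, k, j] := by rw [braidWord, h]; rfl
  rw [← e] at hf
  exact hf.no_braid (by omega)

theorem lemma_C_step {n : ℕ} {M : CoxeterMatrix (Fin n)} {cs : CoxeterSystem M W}
    (hP : PathM M) {x c y d e : List (Fin n)} {s s' u k e₀ : Fin n}
    (h3 : 3 ≤ M s s')
    (hf : FCw cs (x ++ ((s' :: c) ++ u :: y)))
    (hch : (s' :: c).IsChain (fun a b => 3 ≤ M a b))
    (hc : ∀ z ∈ c, M z s = 2) (hu : M u s = 2)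
    (hd : s' :: c = d ++ k :: e₀ :: e) (hcomm : ∀ z ∈ e₀ :: e, M z u = 2) : M k u = 2 := by
  have hke : 3 ≤ M k e₀ := by
    rw [hd] at hch
    have := hch.right_of_append
    rw [List.isChain_cons_cons] at this
    exact this.1
  have hs3 : 3 ≤ M k s' ∨ True := Or.inr trivial
  have he₀u : M e₀ u = 2 := hcomm e₀ (by simp)
  by_contra hku
  have hne : k ≠ u := by
    rintro rfl
    rw [M.symmetric] at he₀u
    omega
  have hku3 : 3 ≤ M k u := by
    rcases hP.bonds k u hne with h | h | h <;> omega
  have he₀u' : (e₀ : ℕ) ≠ u := fun h => ne_of_two he₀u (Fin.ext h)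
  have a1 := hP.adj _ _ hke
  have a2 := hP.adj _ _ hku3
  have hus' : (u : ℕ) ≠ s := fun h => ne_of_two hu (Fin.ext h)
  have ass := hP.adj _ _ h3
  rcases List.eq_nil_or_concat d with rfl | ⟨d, j, rfl⟩
  · simp at hd
    obtain ⟨rfl, rfl⟩ := hd
    have : (e₀ : ℕ) ≠ s := fun h => ne_of_two (hc e₀ (by simp)) (Fin.ext h)
    omega
  · have hjk : 3 ≤ M j k := by
      rw [hd] at hch
      simp only [List.append_assoc, List.concat_eq_append] at hch
      have := hch.right_of_append
      simp only [List.cons_append, List.nil_append, List.isChain_cons_cons] at this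
      exact this.1
    have a3 := hP.adj _ _ hjk
    have hY : ∃ Y, FCw cs (x ++ (d ++ ([j, k, j] ++ Y))) := by
      have hj : j = u ∨ j = e₀ := by
        have : (j : ℕ) = u ∨ (j : ℕ) = e₀ := by omega
        rcases this with h | h
        · exact Or.inl (Fin.ext h)
        · exact Or.inr (Fin.ext h)
      rw [hd] at hf
      rcases hj with rfl | rfl
      · refine ⟨e₀ :: e ++ y, hf.comm ?_⟩
        have := (((Cm.move hcomm).right y).left (x ++ (d ++ [j, k])))
        simpa using this
      · exact ⟨e ++ u :: y, by simpa using hf⟩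
    obtain ⟨Y, hY⟩ := hY
    rcases hP.bonds j k (ne_of_three hjk) with h | h | h
    · omega
    · rw [← List.append_assoc] at hY
      exact no_three h hY
    · have hf4 := hP.four _ _ h
      have hu2 := u.2
      have he2 := e₀.2
      rcases List.eq_nil_or_concat d with rfl | ⟨d, l, rfl⟩
      · simp at hd
        obtain ⟨rfl, rfl⟩ := hd
        have : (k : ℕ) ≠ s := fun h => ne_of_two (hc k (by simp)) (Fin.ext h)
        have := s.2
        omega
      · have hlj : 3 ≤ M l j := by
          rw [hd] at hch
          simp only [List.append_assoc, List.concat_eq_append] at hch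
          have := hch.right_of_append
          simp only [List.cons_append, List.nil_append, List.isChain_cons_cons] at this
          exact this.1
        have a4 := hP.adj _ _ hlj
        have hl : l = k := by
          apply Fin.ext
          have := l.2
          omega
        subst hl
        apply no_four (cs := cs) (x := x ++ d) (y := Y) (k := l) (j := j)
        · rw [M.symmetric, h]
        · simpa using hY

theorem lemma_C {n : ℕ} {M : CoxeterMatrix (Fin n)} {cs : CoxeterSystem M W}
    (hP : PathM M) {x c y : List (Fin n)} {s s' u : Fin n}
    (h3 : 3 ≤ M s s')
    (hf : FCw cs (x ++ ((s' :: c) ++ u :: y)))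
    (hch : (s' :: c).IsChain (fun a b => 3 ≤ M a b))
    (hc : ∀ z ∈ c, M z s = 2) (hu : M u s = 2) (d : List (Fin n)) :
    ∀ e₀ e, s' :: c = d ++ e₀ :: e → (∀ z ∈ e₀ :: e, M z u = 2) → ∀ z ∈ s' :: c, M z u = 2 := by
  induction d using List.reverseRecOn with
  | nil =>
    intro e₀ e he hz
    rw [he]; exact hz
  | append_singleton d k ih =>
    intro e₀ e he hz
    have he' : s' :: c = d ++ k :: e₀ :: e := by simpa using he
    have := lemma_C_step hP h3 hf hch hc hu he' hz
    refine ih k (e₀ :: e) he' ?_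
    intro z hz'
    rcases List.mem_cons.1 hz' with rfl | hz'
    · exact this
    · exact hz z hz'

theorem lemma_chain {n : ℕ} {M : CoxeterMatrix (Fin n)} {cs : CoxeterSystem M W}
    (hP : PathM M) {s s' : Fin n} {p : List (Fin n)} (hp : PreW M s s' p) (y : List (Fin n)) :
    ∀ x c : List (Fin n), FCw cs (x ++ (p ++ ((s' :: c) ++ y))) →
    (s' :: c).IsChain (fun a b => 3 ≤ M a b) → (∀ z ∈ c, M z s = 2) → (∀ z ∈ y, M z s = 2) →
    ∃ z c', Cm M (x ++ (p ++ ((s' :: c) ++ y))) (z ++ (p ++ s' :: c')) ∧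
      (s' :: c').IsChain (fun a b => 3 ≤ M a b) ∧ (∀ z ∈ c', M z s = 2) := by
  induction y with
  | nil =>
    intro x c hf hch hc _
    exact ⟨x, c, by simpa using Cm.refl _, hch, hc⟩
  | cons u y ih =>
    intro x c hf hch hc hy
    have hu : M u s = 2 := hy u (by simp)
    have hy' : ∀ z ∈ y, M z s = 2 := fun z hz => hy z (by simp [hz])
    obtain ⟨d, k, hdk⟩ : ∃ d k, s' :: c = d ++ [k] := by
      rcases List.eq_nil_or_concat (s' :: c) with h | ⟨d, k, h⟩
      · simp at h
      · exact ⟨d, k, by simpa using h⟩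
    have hku : k ≠ u := by
      rintro rfl
      rw [hdk] at hf
      apply FCw.no_sq (cs := cs) (x := x ++ (p ++ d)) (y := y) (i := k)
      simpa using hf
    by_cases hk : M k u = 2
    · have hall : ∀ z ∈ s' :: c, M z u = 2 := by
        rw [← List.append_assoc] at hf
        exact lemma_C hP hp.three hf hch hc hu d k [] hdk (by simpa using hk)
      have hps : ∀ z ∈ p, M z u = 2 := by
        have h1 := hall s' (by simp)
        have h2 : M s u = 2 := by rw [M.symmetric, hu]
        rcases hp with ⟨_, rfl⟩ | ⟨_, rfl⟩ <;> simp [h1, h2]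
      have hcm : Cm M (x ++ (p ++ ((s' :: c) ++ u :: y)))
          (x ++ [u] ++ (p ++ ((s' :: c) ++ y))) := by
        have hz : ∀ z ∈ p ++ s' :: c, M z u = 2 := by
          intro z hz
          rcases List.mem_append.1 hz with hz | hz
          · exact hps z hz
          · exact hall z hz
        have := ((Cm.move hz).right y).left x
        simpa using this
      obtain ⟨z, c', h1, h2, h3⟩ := ih (x ++ [u]) c (hf.comm hcm) hch hc hy'
      exact ⟨z, c', hcm.trans h1, h2, h3⟩
    · have hku3 : 3 ≤ M k u := by
        rcases hP.bonds k u hku with h | h | h <;> omega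
      have hch' : (s' :: (c ++ [u])).IsChain (fun a b => 3 ≤ M a b) := by
        have e : s' :: (c ++ [u]) = d ++ [k] ++ [u] := by rw [← hdk]; simp
        rw [e, List.isChain_append]
        refine ⟨hdk ▸ hch, by simp, ?_⟩
        intro a ha b hb
        simp at ha hb
        subst ha hb
        exact hku3
      have e : x ++ (p ++ ((s' :: c) ++ u :: y)) = x ++ (p ++ ((s' :: (c ++ [u])) ++ y)) := by simp
      rw [e] at hf ⊢
      refine ih x (c ++ [u]) hf hch' ?_ hy'
      intro z hz
      rcases List.mem_append.1 hz with hz | hz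
      · exact hc z hz
      · simp at hz; subst hz; exact hu

theorem lemma_main {n : ℕ} {M : CoxeterMatrix (Fin n)} {cs : CoxeterSystem M W}
    (hP : PathM M) : ∀ (N : ℕ) (ω : List (Fin n)) (s : Fin n), ω.length < N → FCw cs ω →
    ∃ ω' a m, m ≤ 1 ∧ RedR M (ω ++ [s]) a m ω' ∧ FCw cs ω' := by
  intro N
  induction N with
  | zero => intro ω s h; omega
  | succ N IH =>
    intro ω s hN hω
    by_cases he : EndW M s ω
    · obtain ⟨u, hu⟩ := he.cm
      have h1 := (RedR.cm (hu.right [s])).trans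
        (by simpa using RedR.base (BaseR.sq (M := M) s) u [])
      exact ⟨_, _, _, by omega, h1, hω.comm hu⟩
    by_cases hn : FCw cs (ω ++ [s])
    · exact ⟨_, _, _, by omega, RedR.refl _, hn⟩
    obtain ⟨s', p, y₁, y₂, hp, hc, hy⟩ := brk hP.bonds hω hn he
    obtain ⟨z, c, h1, h2, h3⟩ := lemma_chain (cs := cs) hP hp y₂ y₁ []
      (by simpa using hω.comm hc) (by simp) (by simp) hy
    have h4 : Cm M ω (z ++ (p ++ s' :: c)) := hc.trans (by simpa using h1)
    obtain ⟨a, ha⟩ := hp.red z h3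
    have h5 := (RedR.cm (h4.right [s])).trans ha
    have hf := hω.comm h4
    have hzp : FCw cs (z ++ p) := by
      rw [← List.append_assoc] at hf
      exact hf.pre
    have hl := h4.length
    rcases c with _ | ⟨t, c⟩
    · exact ⟨_, _, _, by omega, h5, by simpa using hzp⟩
    · obtain ⟨z₁, b, m, hm, h6, h7⟩ := IH (z ++ p) t (by simp at hl ⊢; omega) hzp
      rw [List.isChain_cons_cons] at h2
      obtain ⟨z₂, b', h8, h9⟩ := chain_mul (cs := cs) hP.bonds c t z₁ h7
        (h6.endW (EndW.last _ _ _)) h2.2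
      have h10 := (h6.right c).trans h8
      have h11 := h5.trans (by simpa using h10)
      exact ⟨z₂, _, _, by omega, h11, h9⟩

theorem pathA (n : ℕ) : PathM (CoxeterMatrix.Aₙ n) := by
  have key : ∀ i j : Fin n, CoxeterMatrix.Aₙ n i j = (if i = j then 1
      else if (j : ℕ) + 1 = i ∨ (i : ℕ) + 1 = j then 3 else 2) := fun _ _ => rfl
  refine ⟨?_, ?_, ?_⟩
  · intro i j h
    have h1 : (i : ℕ) ≠ j := fun e => h (Fin.ext e)
    rw [key]
    split_ifs <;> simp_all
  · intro i j h
    rw [key] at h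
    split_ifs at h <;> omega
  · intro i j h
    have h1 := i.2
    have h2 := j.2
    rw [key] at h
    split_ifs at h <;> (try subst_vars) <;> omega

theorem pathB (n : ℕ) : PathM (CoxeterMatrix.Bₙ n) := by
  have key : ∀ i j : Fin n, CoxeterMatrix.Bₙ n i j = (if i = j then 1
      else if ((i : ℕ) = n - 1 ∧ (j : ℕ) = n - 2) ∨ ((j : ℕ) = n - 1 ∧ (i : ℕ) = n - 2) then 4
      else if (j : ℕ) + 1 = i ∨ (i : ℕ) + 1 = j then 3 else 2) := fun _ _ => rfl
  refine ⟨?_, ?_, ?_⟩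
  · intro i j h
    have h1 : (i : ℕ) ≠ j := fun e => h (Fin.ext e)
    rw [key]
    split_ifs <;> simp_all
  · intro i j h
    rw [key] at h
    split_ifs at h <;> omega
  · intro i j h
    have h1 := i.2
    have h2 := j.2
    rw [key] at h
    split_ifs at h <;> (try subst_vars) <;> omega

theorem conclude {n : ℕ} {M : CoxeterMatrix (Fin n)} {cs : CoxeterSystem M W} (hB : Bonds M)
    {ω₁ ω₂ : List (Fin n)} {s : Fin n} {a m : ℕ} (h : FCw cs ω₁) (h' : FCw cs ω₂)
    (hr : RedR M (ω₁ ++ [s]) a m ω₂) :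
    cs.length (cs.wordProd ω₂ * cs.simple s) < cs.length (cs.wordProd ω₂) ∧
      (∀ ω ω' : List (Fin n), cs.IsReduced ω → cs.wordProd ω = cs.wordProd ω₁ →
        cs.IsReduced ω' → cs.wordProd ω' = cs.wordProd ω₂ →
        bprod M ω * bgen M s = a • (qc ^ m • bprod M ω')) := by
  constructor
  · obtain ⟨u, hu⟩ := (hr.endW (EndW.last _ _ _)).cm
    rw [hu.wordProd cs]
    exact descent_of_concat (h'.comm hu).1
  · intro ω ω' h1 h2 h3 h4
    have c1 := h.unique hB h1 h2.symm
    have c2 := h'.unique hB h3 h4.symm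
    have r := ((RedR.cm (c1.symm.right [s])).trans hr).trans (RedR.cm c2)
    have := r.sound
    rw [bprod_append] at this
    simpa [bprod] using this

end Main

end TLproof

/-- In `TL(X)` of type `A` or `B`: for fully commutative `w` and a generator `s`,
`b_w b_s = a q_c^m b_{w'}` for some fully commutative `w'`, a nonnegative integer `a` and
`m ∈ {0, 1}`, with `ℓ(w's) < ℓ(w')`; moreover if `w` has a reduced expression ending in a
generator not commuting with `s`, then `m = 0`.  (Here `b_w` is expressed as `bprod` over any
reduced word.) -/
theorem bmul_bgen_eq {n : ℕ} {M : CoxeterMatrix (Fin n)}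
    (hM : M = CoxeterMatrix.Aₙ n ∨ M = CoxeterMatrix.Bₙ n)
    (cs : CoxeterSystem M W) (w : W) (hw : cs.FC w) (s : Fin n) :
    ∃ (w' : W) (a m : ℕ), cs.FC w' ∧ m ≤ 1 ∧
      cs.length (w' * cs.simple s) < cs.length w' ∧
      (∀ ω ω' : List (Fin n), cs.IsReduced ω → cs.wordProd ω = w →
        cs.IsReduced ω' → cs.wordProd ω' = w' →
        bprod M ω * bgen M s = a • (qc ^ m • bprod M ω')) ∧
      ((∃ (ω₀ : List (Fin n)) (s' : Fin n), ¬ Commute (cs.simple s) (cs.simple s') ∧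
          cs.IsReduced (ω₀ ++ [s']) ∧ cs.wordProd (ω₀ ++ [s']) = w) → m = 0) := by
  have hP : TLproof.PathM M := by
    rcases hM with rfl | rfl
    · exact TLproof.pathA n
    · exact TLproof.pathB n
  by_cases hex : ∃ (ω₀ : List (Fin n)) (s' : Fin n), ¬ Commute (cs.simple s) (cs.simple s') ∧
          cs.IsReduced (ω₀ ++ [s']) ∧ cs.wordProd (ω₀ ++ [s']) = w
  · obtain ⟨ω₀, s', hc, hr, rfl⟩ := hex
    have hne : s ≠ s' := by
      rintro rfl
      exact hc (Commute.refl _)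
    have h3 : 3 ≤ M s s' := by
      rcases hP.bonds s s' hne with h | h | h
      · exact (hc (TLproof.simple_comm cs h)).elim
      · omega
      · omega
    have hf : TLproof.FCw cs (ω₀ ++ [s']) := ⟨hr, hw⟩
    obtain ⟨ω', a, h1, h2⟩ := TLproof.lemma_Mo hP.bonds hf (TLproof.EndW.last _ _ _) h3
    obtain ⟨h4, h5⟩ := TLproof.conclude hP.bonds hf h2 h1
    exact ⟨_, a, 0, h2.2, by omega, h4, h5, fun _ => rfl⟩
  · obtain ⟨ω, hr, rfl⟩ := cs.exists_isReduced w
    have hf : TLproof.FCw cs ω := ⟨hr, hw⟩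
    obtain ⟨ω', a, m, hm, h1, h2⟩ := TLproof.lemma_main (cs := cs) hP _ ω s (Nat.lt_succ_self _) hf
    obtain ⟨h4, h5⟩ := TLproof.conclude hP.bonds hf h2 h1
    exact ⟨_, a, m, h2.2, hm, h4, h5, fun h => (hex h).elim⟩
end
end
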